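/- Let Ω ⊂ ℂ^N be a bounded strongly pseudoconvex domain with C^{2,α}-smooth boundary, α ∈ (0,1]. There exist constants depending only on Ω such that for every complex geodesic φ : Δ → Ω parametrized so that D_Ω(φ) := max_{ζ∈Δ} δ_Ω(φ(ζ)) = δ_Ω(φ(0)), one has the two-sided estimates D_Ω(φ)^{1/2} ∼ d_e(φ(Δ)) ∼ sup_{ζ∈Δ} ‖φ'(ζ)‖. -/

import Mathlib

open Metric Set Filter Topology MeasureTheory

noncomputable section

namespace InvDist

/-- Complex Euclidean `N`-space. -/
abbrev E (N : ℕ) := EuclideanSpace ℂ (Fin N)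

variable {N : ℕ}

/-- The paper's Hermitian product `⟨a,b⟩ = ∑ a_j * conj (b_j)`. -/
def herm (a b : E N) : ℂ := ∑ j, a j * (starRingEnd ℂ) (b j)

/-- Euclidean distance to the boundary of `Ω`. -/
def bdist (Ω : Set (E N)) (x : E N) : ℝ := Metric.infDist x (frontier Ω)

/-- `π` selects, for each point of `Ω`, a closest point on the boundary. -/
def IsClosestPointSelection (Ω : Set (E N)) (π : E N → E N) : Prop :=
  ∀ z ∈ Ω, π z ∈ frontier Ω ∧ dist z (π z) = bdist Ω z

/-- `‖v_z‖`: modulus of the complex normal component of `v` with respect to the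
closest boundary point `π z`; the outer unit normal at `π z` is `(π z - z)/‖π z - z‖`. -/
def ncomp (Ω : Set (E N)) (π : E N → E N) (z v : E N) : ℝ :=
  ‖herm v (π z - z)‖ / bdist Ω z

/-- `‖v_z^ℝ‖`: modulus of the real normal component of `v` at `π z`. -/
def ncompR (Ω : Set (E N)) (π : E N → E N) (z v : E N) : ℝ :=
  |(herm v (π z - z)).re| / bdist Ω z

/-- The quantity `A_Ω(z,w)`. -/
def Afun (Ω : Set (E N)) (π : E N → E N) (z w : E N) : ℝ :=
  (ncomp Ω π z (z - w) + ‖z - w‖ ^ 2 + ‖z - w‖ * Real.sqrt (bdist Ω z)) /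
    (Real.sqrt (bdist Ω z) * Real.sqrt (bdist Ω w))

/-- `h_Ω(z,w) = ‖(z-w)_z‖ + ‖z-w‖ δ_Ω(z)^{1/2}`. -/
def hfun (Ω : Set (E N)) (π : E N → E N) (z w : E N) : ℝ :=
  ncomp Ω π z (z - w) + ‖z - w‖ * Real.sqrt (bdist Ω z)

/-- real analogue of `h_Ω`. -/
def hfunR (Ω : Set (E N)) (π : E N → E N) (z w : E N) : ℝ :=
  ncompR Ω π z (z - w) + ‖z - w‖ * Real.sqrt (bdist Ω z)

/-- inverse hyperbolic tangent -/
def artanh (x : ℝ) : ℝ := Real.log ((1 + x) / (1 - x)) / 2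

/-- The Lempert function of `Ω`. -/
def lempert (Ω : Set (E N)) (z w : E N) : ℝ :=
  artanh (sInf { r : ℝ | ∃ φ : ℂ → E N, DifferentiableOn ℂ φ (ball 0 1) ∧
    MapsTo φ (ball (0:ℂ) 1) Ω ∧ φ 0 = z ∧ ∃ a ∈ ball (0:ℂ) 1, φ a = w ∧ r = ‖a‖ })

/-- The Carathéodory distance of `Ω`. -/
def caratheodory (Ω : Set (E N)) (z w : E N) : ℝ :=
  artanh (sSup { r : ℝ | ∃ f : E N → ℂ, DifferentiableOn ℂ f Ω ∧
    MapsTo f Ω (ball (0:ℂ) 1) ∧ f z = 0 ∧ r = ‖f w‖ })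

/-- The Kobayashi distance: the largest pseudodistance not exceeding the Lempert
function, given as an infimum over chains. -/
def kobayashi (Ω : Set (E N)) (z w : E N) : ℝ :=
  sInf { r : ℝ | ∃ (n : ℕ) (p : Fin (n + 1) → E N), p 0 = z ∧ p (Fin.last n) = w ∧
    (∀ i, p i ∈ Ω) ∧ r = ∑ i : Fin n, lempert Ω (p i.castSucc) (p i.succ) }

/-- The Poincaré distance on the unit disc. -/
def poincare (ζ ξ : ℂ) : ℝ := artanh ‖(ζ - ξ) / (1 - (starRingEnd ℂ) ζ * ξ)‖

/-- A complex geodesic of `Ω`. -/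
def IsComplexGeodesic (Ω : Set (E N)) (φ : ℂ → E N) : Prop :=
  DifferentiableOn ℂ φ (ball 0 1) ∧ MapsTo φ (ball (0:ℂ) 1) Ω ∧
    ∀ ζ ∈ ball (0:ℂ) 1, ∀ ξ ∈ ball (0:ℂ) 1, kobayashi Ω (φ ζ) (φ ξ) = poincare ζ ξ

/-- `ρ` is `C^k` on `U` with `α`-Hölder `k`-th derivative. -/
def IsCkHolderOn (k : ℕ) (α : ℝ) (ρ : E N → ℝ) (U : Set (E N)) : Prop :=
  ContDiffOn ℝ k ρ U ∧ ∃ M : ℝ, ∀ x ∈ U, ∀ y ∈ U,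
    ‖iteratedFDeriv ℝ k ρ x - iteratedFDeriv ℝ k ρ y‖ ≤ M * ‖x - y‖ ^ α

/-- The Levi form of `ρ` at `p` evaluated at `v`. -/
def levi (ρ : E N → ℝ) (p v : E N) : ℝ :=
  (iteratedFDeriv ℝ 2 ρ p ![v, v] +
    iteratedFDeriv ℝ 2 ρ p ![(Complex.I : ℂ) • v, (Complex.I : ℂ) • v]) / 4

/-- Bounded strongly pseudoconvex domain with `C^{k,α}`-smooth boundary. -/
def IsStronglyPseudoconvexDomain (k : ℕ) (α : ℝ) (Ω : Set (E N)) : Prop :=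
  IsOpen Ω ∧ IsConnected Ω ∧ Bornology.IsBounded Ω ∧
  ∃ (U : Set (E N)) (ρ : E N → ℝ), IsOpen U ∧ closure Ω ⊆ U ∧
    IsCkHolderOn k α ρ U ∧ Ω = {x ∈ U | ρ x < 0} ∧
    (∀ p ∈ frontier Ω, fderiv ℝ ρ p ≠ 0) ∧
    ∀ p ∈ frontier Ω, ∀ v : E N, v ≠ 0 → fderiv ℝ ρ p v = 0 →
      fderiv ℝ ρ p ((Complex.I : ℂ) • v) = 0 → 0 < levi ρ p v

/-- `η` is the outer unit normal of `Ω` at the boundary point `p`. -/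
def IsOuterUnitNormalAt (Ω : Set (E N)) (p η : E N) : Prop :=
  ‖η‖ = 1 ∧ p ∈ frontier Ω ∧ ∃ ε > 0, ∀ t : ℝ, 0 < t → t < ε →
    p - t • η ∈ Ω ∧ bdist Ω (p - t • η) = t

open Classical in
/-- signed boundary distance -/
def signedDist (Ω : Set (E N)) (x : E N) : ℝ :=
  if x ∈ closure Ω then -(bdist Ω x) else bdist Ω x

/-- Hessian quadratic form of the signed boundary distance. -/
def hessSD (Ω : Set (E N)) (p v : E N) : ℝ :=
  iteratedFDeriv ℝ 2 (signedDist Ω) p ![v, v]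

/-- strict linear convexity at `p` (with outer unit normal `η`). -/
def StrictlyLinearlyConvexAt (Ω : Set (E N)) (p η : E N) : Prop :=
  ∀ v : E N, v ≠ 0 → herm v η = 0 → 0 < hessSD Ω p v

/-- strong convexity at `p` (with outer unit normal `η`). -/
def StronglyConvexAt (Ω : Set (E N)) (p η : E N) : Prop :=
  ∀ v : E N, v ≠ 0 → (herm v η).re = 0 → 0 < hessSD Ω p v

/-- `p` is a `C^k`-smooth boundary point of `Ω`. -/
def IsCkBoundaryPoint (k : ℕ) (Ω : Set (E N)) (p : E N) : Prop :=
  p ∈ frontier Ω ∧ ∃ (U : Set (E N)) (ρ : E N → ℝ), IsOpen U ∧ p ∈ U ∧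
    ContDiffOn ℝ k ρ U ∧ (∀ x ∈ U, (x ∈ Ω ↔ ρ x < 0)) ∧
    ∀ x ∈ U ∩ frontier Ω, fderiv ℝ ρ x ≠ 0

/-- bounded domain with `C^k`-smooth boundary. -/
def IsCkDomain (k : ℕ) (Ω : Set (E N)) : Prop :=
  IsOpen Ω ∧ IsConnected Ω ∧ Bornology.IsBounded Ω ∧
    ∀ p ∈ frontier Ω, IsCkBoundaryPoint k Ω p

/-- bounded domain with `C^{1,1}`-smooth boundary. -/
def IsC11Domain (Ω : Set (E N)) : Prop :=
  IsOpen Ω ∧ IsConnected Ω ∧ Bornology.IsBounded Ω ∧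
  ∀ p ∈ frontier Ω, ∃ (U : Set (E N)) (ρ : E N → ℝ), IsOpen U ∧ p ∈ U ∧
    IsCkHolderOn 1 1 ρ U ∧ (∀ x ∈ U, (x ∈ Ω ↔ ρ x < 0)) ∧
    ∀ x ∈ U ∩ frontier Ω, fderiv ℝ ρ x ≠ 0

/-- `p` is a `C^{2,α}`-smooth strongly pseudoconvex boundary point of `Ω`. -/
def IsSPSCBoundaryPoint (α : ℝ) (Ω : Set (E N)) (p : E N) : Prop :=
  p ∈ frontier Ω ∧ ∃ (U : Set (E N)) (ρ : E N → ℝ), IsOpen U ∧ p ∈ U ∧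
    IsCkHolderOn 2 α ρ U ∧ (∀ x ∈ U, (x ∈ Ω ↔ ρ x < 0)) ∧
    (∀ x ∈ U ∩ frontier Ω, fderiv ℝ ρ x ≠ 0) ∧
    ∀ x ∈ U ∩ frontier Ω, ∀ v : E N, v ≠ 0 → fderiv ℝ ρ x v = 0 →
      fderiv ℝ ρ x ((Complex.I : ℂ) • v) = 0 → 0 < levi ρ x v

instance (N : ℕ) : MeasurableSpace (E N) := borel _

instance (N : ℕ) : BorelSpace (E N) := ⟨rfl⟩

/-- Lebesgue measure on `E N`. -/
def vol (N : ℕ) : Measure (E N) :=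
  letI : InnerProductSpace ℝ (E N) := InnerProductSpace.rclikeToReal ℂ (E N)
  letI : MeasureSpace (E N) := measureSpaceOfInnerProductSpace
  volume

/-- Bergman kernel on the diagonal. -/
def bergmanKernelDiag (Ω : Set (E N)) (z : E N) : ℝ :=
  sSup { r : ℝ | ∃ f : E N → ℂ, DifferentiableOn ℂ f Ω ∧
    (∫ x in Ω, ‖f x‖ ^ 2 ∂(vol N)) ≤ 1 ∧ r = ‖f z‖ ^ 2 }

/-- `M_Ω(z;v)`. -/
def bergmanM (Ω : Set (E N)) (z v : E N) : ℝ :=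
  sSup { r : ℝ | ∃ f : E N → ℂ, DifferentiableOn ℂ f Ω ∧
    (∫ x in Ω, ‖f x‖ ^ 2 ∂(vol N)) ≤ 1 ∧ f z = 0 ∧ r = ‖fderiv ℂ f z v‖ }

/-- The Bergman metric. -/
def bergmanMetric (Ω : Set (E N)) (z v : E N) : ℝ :=
  bergmanM Ω z v / Real.sqrt (bergmanKernelDiag Ω z)

/-- The Bergman distance: inner distance of the Bergman metric. -/
def bergmanDist (Ω : Set (E N)) (z w : E N) : ℝ :=
  sInf { r : ℝ | ∃ γ : ℝ → E N, ContDiffOn ℝ 1 γ (Icc 0 1) ∧ γ 0 = z ∧ γ 1 = w ∧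
    (∀ t ∈ Icc (0:ℝ) 1, γ t ∈ Ω) ∧
    r = ∫ t in (0:ℝ)..(1:ℝ), bergmanMetric Ω (γ t) (derivWithin γ (Icc 0 1) t) }

/-- Normalized arc length on the unit circle, as a measure on `ℂ`. -/
def circ : Measure ℂ :=
  ENNReal.ofReal (2 * Real.pi)⁻¹ •
    (volume.restrict (Ioc 0 (2 * Real.pi))).map (circleMap 0 1)

lemma measurable_circleMap_zero_one : Measurable (circleMap 0 1) :=
  (continuous_circleMap 0 1).measurable

instance : IsProbabilityMeasure circ := by
  constructor
  have h : (0:ℝ) < 2 * Real.pi := by positivity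
  rw [circ, Measure.smul_apply, Measure.map_apply measurable_circleMap_zero_one MeasurableSet.univ]
  simp only [preimage_univ, Measure.restrict_apply_univ, Real.volume_Ioc, sub_zero, smul_eq_mul]
  rw [← ENNReal.ofReal_mul (by positivity), inv_mul_cancel₀ h.ne', ENNReal.ofReal_one]

lemma ae_circ_norm : ∀ᵐ ω ∂circ, ‖ω‖ = 1 := by
  have hs : MeasurableSet {ω : ℂ | ‖ω‖ = 1} := measurableSet_eq_fun measurable_norm measurable_const
  refine Measure.ae_smul_measure ?_ _
  rw [ae_map_iff measurable_circleMap_zero_one.aemeasurable hs]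
  filter_upwards with θ
  simp

lemma ae_circ_sphere : ∀ᵐ ω ∂circ, ω ∈ sphere (0:ℂ) 1 := by
  filter_upwards [ae_circ_norm] with ω h
  simpa using h

lemma circ_restrict_sphere : circ.restrict (sphere (0:ℂ) 1) = circ :=
  Measure.restrict_eq_self_of_ae_mem ae_circ_sphere

section
variable {F : Type*} [NormedAddCommGroup F]

lemma aesm_circ {f : ℂ → F} (hf : ContinuousOn f (sphere (0:ℂ) 1)) :
    AEStronglyMeasurable f circ := by
  rw [← circ_restrict_sphere]
  exact hf.aestronglyMeasurable isClosed_sphere.measurableSet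

lemma integrable_circ {f : ℂ → F} (hf : ContinuousOn f (sphere (0:ℂ) 1)) :
    Integrable f circ := by
  obtain ⟨C, hC⟩ := (isCompact_sphere (0:ℂ) 1).exists_bound_of_continuousOn hf
  refine Integrable.of_bound (aesm_circ hf) C ?_
  filter_upwards [ae_circ_sphere] with ω h using hC ω h

variable [NormedSpace ℝ F]

lemma integral_circ_congr {f g : ℂ → F} (h : ∀ ω : ℂ, ‖ω‖ = 1 → f ω = g ω) :
    ∫ ω, f ω ∂circ = ∫ ω, g ω ∂circ := by
  refine integral_congr_ae ?_
  filter_upwards [ae_circ_norm] with ω hω using h ω hω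

lemma integral_circ_eq {f : ℂ → F} (hf : ContinuousOn f (sphere (0:ℂ) 1)) :
    ∫ ω, f ω ∂circ = Real.circleAverage f 0 1 := by
  have h : (0:ℝ) < 2 * Real.pi := by positivity
  rw [circ, integral_smul_measure, integral_map measurable_circleMap_zero_one.aemeasurable,
    Real.circleAverage, intervalIntegral.integral_of_le h.le, ENNReal.toReal_ofReal (by positivity)]
  have := aesm_circ hf
  unfold circ at this
  have h0 : ENNReal.ofReal (2 * Real.pi)⁻¹ ≠ 0 := by
    simp only [ne_eq, ENNReal.ofReal_eq_zero, not_le]; positivity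
  exact this.mono_ac (Measure.absolutelyContinuous_smul h0)
end

lemma integral_circ_mono {f g : ℂ → ℝ} (hf : ContinuousOn f (sphere (0:ℂ) 1))
    (hg : ContinuousOn g (sphere (0:ℂ) 1)) (h : ∀ ω : ℂ, ‖ω‖ = 1 → f ω ≤ g ω) :
    ∫ ω, f ω ∂circ ≤ ∫ ω, g ω ∂circ := by
  refine integral_mono_ae (integrable_circ hf) (integrable_circ hg) ?_
  filter_upwards [ae_circ_norm] with ω hω using h ω hω

lemma integral_circ_const {F : Type*} [NormedAddCommGroup F] [NormedSpace ℝ F] [CompleteSpace F]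
    (c : F) : ∫ _, c ∂circ = c := by simp

lemma _root_.DiffContOnCl.integral_circ {F : Type*} [NormedAddCommGroup F] [NormedSpace ℂ F]
    [CompleteSpace F] {f : ℂ → F} (hf : DiffContOnCl ℂ f (ball 0 1)) :
    ∫ ω, f ω ∂circ = f 0 := by
  have hc : ContinuousOn f (sphere (0:ℂ) 1) :=
    hf.continuousOn_ball.mono sphere_subset_closedBall
  rw [integral_circ_eq hc]
  exact DiffContOnCl.circleAverage (by simpa using hf)

/-- A complex function agreeing on `AddCircle 1` with a sum of a polynomial and a
conjugate polynomial. -/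
def IsHarmPoly (f : AddCircle (1:ℝ) → ℂ) : Prop :=
  ∃ q₁ q₂ : Polynomial ℂ, ∀ x, f x =
    q₁.eval (AddCircle.toCircle x : ℂ) + (starRingEnd ℂ) (q₂.eval (AddCircle.toCircle x : ℂ))

lemma isHarmPoly_of_mem_span {f : C(AddCircle (1:ℝ), ℂ)}
    (hf : f ∈ Submodule.span ℂ (Set.range (@fourier (1:ℝ)))) : IsHarmPoly f := by
  induction hf using Submodule.span_induction with
  | mem f hf =>
    obtain ⟨n, rfl⟩ := hf
    obtain ⟨m, rfl | rfl⟩ := n.eq_nat_or_neg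
    · refine ⟨Polynomial.X ^ m, 0, fun x => ?_⟩
      simp [fourier_apply, AddCircle.toCircle_nsmul]
    · refine ⟨0, Polynomial.X ^ m, fun x => ?_⟩
      rw [fourier_neg]
      simp [fourier_apply, AddCircle.toCircle_nsmul]
  | zero => exact ⟨0, 0, fun x => by simp⟩
  | add f g _ _ hf hg =>
    obtain ⟨q₁, q₂, h⟩ := hf
    obtain ⟨r₁, r₂, h'⟩ := hg
    refine ⟨q₁ + r₁, q₂ + r₂, fun x => ?_⟩
    rw [ContinuousMap.add_apply, h, h']
    simp only [Polynomial.eval_add, map_add]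
    ring
  | smul a f _ hf =>
    obtain ⟨q₁, q₂, h⟩ := hf
    refine ⟨Polynomial.C a * q₁, Polynomial.C ((starRingEnd ℂ) a) * q₂, fun x => ?_⟩
    rw [ContinuousMap.smul_apply, h]
    simp only [Polynomial.eval_mul, Polynomial.eval_C, map_mul, Complex.conj_conj, smul_eq_mul]
    ring

lemma exists_poly_approx {g : ℂ → ℝ} (hg : ContinuousOn g (sphere (0:ℂ) 1)) {ε : ℝ}
    (hε : 0 < ε) : ∃ q : Polynomial ℂ, ∀ ω : ℂ, ‖ω‖ = 1 → |g ω - (q.eval ω).re| ≤ ε := by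
  have hcont : Continuous fun x : AddCircle (1:ℝ) => ((g (AddCircle.toCircle x : ℂ) : ℝ) : ℂ) := by
    refine Complex.continuous_ofReal.comp ?_
    refine hg.comp_continuous (continuous_subtype_val.comp AddCircle.continuous_toCircle) ?_
    intro x; exact mem_sphere_zero_iff_norm.2 (Circle.norm_coe _)
  let G : C(AddCircle (1:ℝ), ℂ) := ⟨_, hcont⟩
  have hmem : G ∈ (Submodule.span ℂ (Set.range (@fourier (1:ℝ)))).topologicalClosure := by
    rw [span_fourier_closure_eq_top]; trivial
  rw [← SetLike.mem_coe, Submodule.topologicalClosure_coe, Metric.mem_closure_iff] at hmem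
  obtain ⟨f, hf, hd⟩ := hmem ε hε
  obtain ⟨q₁, q₂, h⟩ := isHarmPoly_of_mem_span hf
  refine ⟨q₁ + q₂, fun ω hω => ?_⟩
  obtain ⟨x, hx⟩ := (AddCircle.homeomorphCircle (T := (1:ℝ)) one_ne_zero).surjective
    ⟨ω, mem_sphere_zero_iff_norm.2 hω⟩
  rw [AddCircle.homeomorphCircle_apply] at hx
  have hx' : (AddCircle.toCircle x : ℂ) = ω := by rw [hx]
  have h1 : ‖G x - f x‖ ≤ ε := by
    rw [← dist_eq_norm]
    exact ((ContinuousMap.dist_apply_le_dist x).trans hd.le)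
  rw [h x] at h1
  have h2 : (G x - (q₁.eval (AddCircle.toCircle x : ℂ) +
      (starRingEnd ℂ) (q₂.eval (AddCircle.toCircle x : ℂ)))).re
      = g ω - ((q₁ + q₂).eval ω).re := by
    simp [G, hx']
  rw [← h2]
  exact (Complex.abs_re_le_norm _).trans h1

/-- Sum of the values at the four points `z ± t`, `z ± i t`. -/
def quad {F : Type*} [AddCommGroup F] (w : ℂ → F) (z : ℂ) (t : ℝ) : F :=
  w (z + t) + w (z - t) + w (z + t * Complex.I) + w (z - t * Complex.I)

/-- A discrete form of `Δ w ≥ 0` at the point `z`. -/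
def SubLap (w : ℂ → ℝ) (z : ℂ) : Prop :=
  ∀ ε > 0, ∀ᶠ t in 𝓝[>] (0:ℝ), -(ε * t ^ 2) ≤ quad w z t - 4 * w z

lemma SubLap.add {w v : ℂ → ℝ} {z : ℂ} (hw : SubLap w z) (hv : SubLap v z) :
    SubLap (fun x => w x + v x) z := by
  intro ε hε
  filter_upwards [hw (ε / 2) (by linarith), hv (ε / 2) (by linarith)] with t h1 h2
  simp only [quad] at *
  linarith

lemma SubLap.const_mul {w : ℂ → ℝ} {z : ℂ} (hw : SubLap w z) {a : ℝ} (ha : 0 ≤ a) :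
    SubLap (fun x => a * w x) z := by
  intro ε hε
  filter_upwards [hw (ε / (a + 1)) (by positivity)] with t h1
  have h2 : a * (ε / (a + 1)) ≤ ε := by
    rw [mul_div_assoc', div_le_iff₀ (by positivity)]; nlinarith
  have h3 := mul_le_mul_of_nonneg_left h1 ha
  have h4 : a * (ε / (a + 1)) * t ^ 2 ≤ ε * t ^ 2 := by gcongr
  simp only [quad] at *
  linarith

lemma subLap_const (a : ℝ) (z : ℂ) : SubLap (fun _ => a) z := by
  intro ε hε
  filter_upwards with t
  simp only [quad]
  nlinarith [mul_nonneg hε.le (sq_nonneg t)]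

lemma SubLap.mono {w v : ℂ → ℝ} {z : ℂ} (hw : SubLap w z) (hv : ∀ x, w x ≤ v x)
    (h : v z = w z) : SubLap v z := by
  intro ε hε
  filter_upwards [hw ε hε] with t h1
  have := hv (z + t)
  have := hv (z - t)
  have := hv (z + t * Complex.I)
  have := hv (z - t * Complex.I)
  simp only [quad] at *
  linarith

lemma SubLap.max {w v : ℂ → ℝ} {z : ℂ} (hw : v z ≤ w z → SubLap w z)
    (hv : w z ≤ v z → SubLap v z) : SubLap (fun x => max (w x) (v x)) z := by
  rcases le_total (v z) (w z) with h | h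
  · exact (hw h).mono (fun x => le_max_left _ _) (max_eq_left h)
  · exact (hv h).mono (fun x => le_max_right _ _) (max_eq_right h)

lemma tendsto_add_small (z a : ℂ) :
    Tendsto (fun t : ℝ => z + t * a) (𝓝[>] (0:ℝ)) (𝓝 z) := by
  have : Tendsto (fun t : ℝ => z + t * a) (𝓝 (0:ℝ)) (𝓝 (z + ((0:ℝ):ℂ) * a)) := by
    apply Continuous.tendsto; fun_prop
  simp only [Complex.ofReal_zero, zero_mul, add_zero] at this
  exact this.mono_left nhdsWithin_le_nhds

lemma eventually_quad_points {z : ℂ} {P : ℂ → Prop} (hP : ∀ᶠ x in 𝓝 z, P x) :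
    ∀ᶠ t : ℝ in 𝓝[>] (0:ℝ), P (z + (t:ℂ)) ∧ P (z - t) ∧ P (z + t * Complex.I) ∧
      P (z - t * Complex.I) := by
  have h1 := (tendsto_add_small z 1).eventually hP
  have h2 := (tendsto_add_small z (-1)).eventually hP
  have h3 := (tendsto_add_small z (Complex.I)).eventually hP
  have h4 := (tendsto_add_small z (-Complex.I)).eventually hP
  filter_upwards [h1, h2, h3, h4] with t h1 h2 h3 h4
  simp only [mul_one, mul_neg, ← sub_eq_add_neg] at h1 h2 h3 h4
  exact ⟨h1, h2, h3, h4⟩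

lemma SubLap.congr {w v : ℂ → ℝ} {z : ℂ} (hw : SubLap w z) (h : w =ᶠ[𝓝 z] v) : SubLap v z := by
  intro ε hε
  filter_upwards [hw ε hε, eventually_quad_points h] with t h1 h2
  obtain ⟨a, b, c, d⟩ := h2
  simp only [quad] at *
  rw [← a, ← b, ← c, ← d, ← h.self_of_nhds]
  exact h1

lemma quad_norm_sq (z : ℂ) (t : ℝ) :
    quad (fun x : ℂ => ‖x‖ ^ 2) z t - 4 * ‖z‖ ^ 2 = 4 * t ^ 2 := by
  simp only [quad, Complex.sq_norm, Complex.normSq_apply, Complex.add_re, Complex.add_im,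
    Complex.sub_re, Complex.sub_im, Complex.ofReal_re, Complex.ofReal_im, Complex.mul_re,
    Complex.mul_im, Complex.I_re, Complex.I_im]
  ring

/-- The maximum principle for functions with `SubLap`. -/
lemma max_principle {K O : Set ℂ} (hK : IsCompact K) (hO : IsOpen O) (hOK : O ⊆ K)
    {w : ℂ → ℝ} (hw : ContinuousOn w K) (hs : ∀ z ∈ O, SubLap w z) {b : ℝ}
    (hb : ∀ z ∈ K \ O, w z ≤ b) : ∀ z ∈ K, w z ≤ b := by
  intro z hz
  obtain ⟨R, hR⟩ := hK.isBounded.exists_norm_le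
  refine le_of_forall_pos_le_add fun ε hε => ?_
  have hR0 : 0 ≤ R := (norm_nonneg z).trans (hR z hz)
  set η := ε / (R ^ 2 + 1) with hη
  have hη0 : 0 < η := by positivity
  have hηR : η * R ^ 2 ≤ ε := by
    rw [hη, div_mul_eq_mul_div, div_le_iff₀ (by positivity)]; nlinarith
  have hc : ContinuousOn (fun x : ℂ => w x + η * ‖x‖ ^ 2) K := by fun_prop
  obtain ⟨x, hxK, hx⟩ := hK.exists_isMaxOn ⟨z, hz⟩ hc
  have hx' : ∀ y ∈ K, w y + η * ‖y‖ ^ 2 ≤ w x + η * ‖x‖ ^ 2 := fun y hy => hx hy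
  have hxO : x ∉ O := by
    intro hxO
    have h1 := hs x hxO (2 * η) (by positivity)
    have h2 := eventually_quad_points (hO.mem_nhds hxO)
    obtain ⟨t, ht, ⟨p1, p2, p3, p4⟩, ht0⟩ := (h1.and (h2.and self_mem_nhdsWithin)).exists
    have ht0 : 0 < t := ht0
    have q1 := hx' _ (hOK p1)
    have q2 := hx' _ (hOK p2)
    have q3 := hx' _ (hOK p3)
    have q4 := hx' _ (hOK p4)
    have e := quad_norm_sq x t
    simp only [quad] at ht e
    nlinarith [mul_pos hη0 (pow_pos ht0 2)]
  have h1 := hb x ⟨hxK, hxO⟩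
  have h2 := hx' z hz
  have h3 : η * ‖x‖ ^ 2 ≤ ε := by
    refine le_trans ?_ hηR
    have := hR x hxK
    gcongr
  nlinarith [mul_nonneg hη0.le (sq_nonneg ‖z‖)]

section
variable {F : Type*} [NormedAddCommGroup F] [NormedSpace ℂ F] [CompleteSpace F]

lemma tendsto_quad_sub {f : ℂ → F} {z : ℂ} (hf : AnalyticAt ℂ f z) :
    Tendsto (fun t : ℝ => (t ^ 2)⁻¹ • (quad f z t - (4:ℝ) • f z)) (𝓝[>] (0:ℝ)) (𝓝 0) := by
  obtain ⟨p, hp⟩ := hf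
  have hO := hp.isBigO_sub_partialSum_pow 3
  obtain ⟨C, hC⟩ := hO.bound
  have hC' : ∀ᶠ y in 𝓝 z, ‖f y - p.partialSum 3 (y - z)‖ ≤ C * ‖y - z‖ ^ 3 := by
    have : Tendsto (fun y => y - z) (𝓝 z) (𝓝 0) := by
      have : Tendsto (fun y => y - z) (𝓝 z) (𝓝 (z - z)) := by
        apply Continuous.tendsto; fun_prop
      simpa using this
    filter_upwards [this.eventually hC] with y hy
    simpa using hy
  have hsum : ∀ t : ℝ, p.partialSum 3 (t:ℂ) + p.partialSum 3 (-(t:ℂ)) +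
      p.partialSum 3 (t * Complex.I) + p.partialSum 3 (-(t * Complex.I)) = (4:ℝ) • f z := by
    intro t
    have h0 : (p 0 fun _ => (0:ℂ)) = f z := hp.coeff_zero _
    have hI : (Complex.I)^2 = -1 := Complex.I_sq
    have e0 : p.coeff 0 = f z := by
      rw [← h0]; unfold FormalMultilinearSeries.coeff; congr 1; ext i; exact i.elim0
    simp only [FormalMultilinearSeries.partialSum, Finset.sum_range_succ, Finset.sum_range_zero,
      FormalMultilinearSeries.apply_eq_pow_smul_coeff, pow_zero, pow_one, one_smul, zero_add, e0]
    have e4 : ((4:ℝ) • f z) = (4:ℂ) • f z := by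
      rw [← Complex.coe_smul]; norm_num
    rw [e4]
    have : ((t:ℂ) * Complex.I)^2 = -(t:ℂ)^2 := by rw [mul_pow, hI]; ring
    rw [neg_sq, neg_sq, this]
    module
  rw [tendsto_zero_iff_norm_tendsto_zero]
  have hlim : Tendsto (fun t : ℝ => 4 * C * t) (𝓝[>] (0:ℝ)) (𝓝 0) := by
    have : Tendsto (fun t : ℝ => 4 * C * t) (𝓝 (0:ℝ)) (𝓝 (4 * C * 0)) := by
      apply Continuous.tendsto; fun_prop
    rw [mul_zero] at this
    exact this.mono_left nhdsWithin_le_nhds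
  refine squeeze_zero' (Eventually.of_forall fun t => norm_nonneg _) ?_ hlim
  filter_upwards [eventually_quad_points hC', self_mem_nhdsWithin] with t ht ht0
  have ht0 : 0 < t := ht0
  obtain ⟨h1, h2, h3, h4⟩ := ht
  have nI : ‖(t:ℂ) * Complex.I‖ = t := by simp [abs_of_pos ht0]
  have nt : ‖(t:ℂ)‖ = t := by simp [abs_of_pos ht0]
  have s1 : z + (t:ℂ) - z = t := by ring
  have s2 : z - (t:ℂ) - z = -t := by ring
  have s3 : z + t * Complex.I - z = t * Complex.I := by ring
  have s4 : z - t * Complex.I - z = -(t * Complex.I) := by ring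
  rw [s1, nt] at h1
  rw [s2, norm_neg, nt] at h2
  rw [s3, nI] at h3
  rw [s4, norm_neg, nI] at h4
  have key : ‖quad f z t - (4:ℝ) • f z‖ ≤ 4 * (C * t ^ 3) := by
    rw [← hsum t]
    have : quad f z t - (p.partialSum 3 (t:ℂ) + p.partialSum 3 (-(t:ℂ)) +
      p.partialSum 3 (t * Complex.I) + p.partialSum 3 (-(t * Complex.I))) =
      (f (z + t) - p.partialSum 3 (t:ℂ)) + (f (z - t) - p.partialSum 3 (-(t:ℂ))) +
      (f (z + t * Complex.I) - p.partialSum 3 (t * Complex.I)) +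
      (f (z - t * Complex.I) - p.partialSum 3 (-(t * Complex.I))) := by
      simp only [quad]; abel
    rw [this]
    refine (norm_add₄_le ..).trans ?_
    linarith
  rw [norm_smul, Real.norm_eq_abs, abs_of_pos (by positivity), inv_mul_le_iff₀ (by positivity)]
  nlinarith

lemma tendsto_diff_quot {f : ℂ → F} {z : ℂ} (hf : DifferentiableAt ℂ f z) (a : ℂ) :
    Tendsto (fun t : ℝ => t⁻¹ • (f (z + t * a) - f z)) (𝓝[>] (0:ℝ)) (𝓝 (a • deriv f z)) := by
  have h : HasDerivAt (fun t : ℝ => f (z + t * a)) (a • deriv f z) 0 := by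
    have h1 : HasDerivAt (fun t : ℝ => z + (t:ℂ) * a) a 0 := by
      have := ((Complex.ofRealCLM.hasDerivAt (x := (0:ℝ))).mul_const a).const_add z
      simpa using this
    have h2 : HasDerivAt f (deriv f z) ((fun t : ℝ => z + (t:ℂ) * a) 0) := by
      simpa using hf.hasDerivAt
    exact h2.scomp 0 h1
  have := h.tendsto_slope_zero_right
  simpa using this
end

lemma subLap_re {f : ℂ → ℂ} {z : ℂ} (hf : AnalyticAt ℂ f z) : SubLap (fun x => (f x).re) z := by
  intro ε hε
  have h := tendsto_quad_sub hf
  have h2 : Tendsto (fun t : ℝ => ((t ^ 2)⁻¹ • (quad f z t - (4:ℝ) • f z)).re)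
      (𝓝[>] (0:ℝ)) (𝓝 0) := by
    have := (Complex.continuous_re.tendsto 0).comp h
    rw [Complex.zero_re] at this
    exact this
  filter_upwards [h2.eventually (lt_mem_nhds (show -ε < 0 by linarith)), self_mem_nhdsWithin]
    with t ht ht0
  have ht0 : 0 < t := ht0
  simp only [quad, Complex.smul_re, Complex.sub_re, Complex.add_re, smul_eq_mul] at *
  rw [inv_mul_eq_div, lt_div_iff₀ (by positivity)] at ht
  linarith

/-- Sub-mean value property over the unit circle. -/
lemma sub_mean {w : ℂ → ℝ} (hw : ContinuousOn w (closedBall (0:ℂ) 1))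
    (hs : ∀ z ∈ ball (0:ℂ) 1, SubLap w z) : w 0 ≤ ∫ ω, w ω ∂circ := by
  have hws : ContinuousOn w (sphere (0:ℂ) 1) := hw.mono sphere_subset_closedBall
  refine le_of_forall_pos_le_add fun ε hε => ?_
  obtain ⟨q, hq⟩ := exists_poly_approx hws (half_pos hε)
  have hqa : ∀ z, AnalyticAt ℂ (fun x => -q.eval x) z := fun z =>
    (q.differentiable.analyticAt z).neg
  have h1 := max_principle (isCompact_closedBall (0:ℂ) 1) isOpen_ball ball_subset_closedBall
    (w := fun x => w x + (-q.eval x).re) (b := ε / 2) (by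
      have : Continuous fun x => (-q.eval x).re := by fun_prop
      exact hw.add this.continuousOn)
    (fun z hz => (hs z hz).add (subLap_re (hqa z))) (fun z hz => by
      rw [closedBall_sdiff_ball] at hz
      have := abs_le.1 (hq z (by simpa using hz))
      simp only [Complex.neg_re]; linarith) 0 (by simp)
  have h2 : ∫ ω, (q.eval ω).re ∂circ = (q.eval 0).re := by
    have hd : DiffContOnCl ℂ (fun x => q.eval x) (ball 0 1) := q.differentiable.diffContOnCl
    rw [← hd.integral_circ]
    exact integral_re (𝕜 := ℂ) (integrable_circ q.continuous.continuousOn)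
  have h3 : ∫ ω, ((q.eval ω).re - ε / 2) ∂circ ≤ ∫ ω, w ω ∂circ := by
    refine integral_circ_mono (by
      have : Continuous fun x => (q.eval x).re - ε / 2 := by fun_prop
      exact this.continuousOn) hws fun ω hω => ?_
    have := abs_le.1 (hq ω hω)
    linarith
  rw [integral_sub (integrable_circ (by
      have : Continuous fun x => (q.eval x).re := by fun_prop
      exact this.continuousOn)) (integrable_const _), h2, integral_circ_const] at h3
  simp only [Complex.neg_re] at h1
  linarith

/-- The `ℂ`-linear form with real part `dρ`. -/
def ell (ρ : E N → ℝ) (x : E N) : E N →L[ℂ] ℂ := StrongDual.extendRCLike (fderiv ℝ ρ x)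

/-- The second derivative of `ρ`. -/
def hess (ρ : E N → ℝ) (x : E N) : E N →L[ℝ] E N →L[ℝ] ℝ := fderiv ℝ (fderiv ℝ ρ) x

lemma re_ell (ρ : E N → ℝ) (x v : E N) : (ell ρ x v).re = fderiv ℝ ρ x v :=
  StrongDual.re_extendRCLike_apply (𝕜 := ℂ) (fderiv ℝ ρ x) v

lemma im_ell (ρ : E N → ℝ) (x v : E N) :
    (ell ρ x v).im = -fderiv ℝ ρ x (Complex.I • v) := by
  have h := re_ell ρ x (Complex.I • v)
  rw [map_smul, smul_eq_mul, Complex.mul_re, Complex.I_re, Complex.I_im] at h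
  linarith

lemma norm_ell_sq (ρ : E N → ℝ) (x v : E N) :
    ‖ell ρ x v‖ ^ 2 = fderiv ℝ ρ x v ^ 2 + fderiv ℝ ρ x (Complex.I • v) ^ 2 := by
  rw [Complex.sq_norm, Complex.normSq_apply, re_ell, im_ell]; ring

lemma ell_sub_norm (ρ : E N → ℝ) (x y : E N) :
    ‖ell ρ x - ell ρ y‖ = ‖fderiv ℝ ρ x - fderiv ℝ ρ y‖ := by
  have h := StrongDual.norm_extendRCLike (𝕜 := ℂ) (fderiv ℝ ρ x - fderiv ℝ ρ y)
  rw [← h]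
  congr 1
  exact ((StrongDual.extendRCLikeₗ (𝕜 := ℂ)).map_sub (fderiv ℝ ρ x) (fderiv ℝ ρ y)).symm

lemma levi_eq (ρ : E N → ℝ) (x v : E N) :
    levi ρ x v = (hess ρ x v v + hess ρ x (Complex.I • v) (Complex.I • v)) / 4 := by
  simp [levi, iteratedFDeriv_two_apply, hess]

lemma hess_symm {ρ : E N → ℝ} {x : E N} (h : ContDiffAt ℝ 2 ρ x) (v w : E N) :
    hess ρ x v w = hess ρ x w v :=
  (h.isSymmSndFDerivAt (by simp)) v w

lemma hasFDerivAt_fderiv {ρ : E N → ℝ} {x : E N} (h : ContDiffAt ℝ 2 ρ x) :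
    HasFDerivAt (fderiv ℝ ρ) (hess ρ x) x := by
  have h1 : ContDiffAt ℝ 1 (fderiv ℝ ρ) x := h.fderiv_right (by norm_num)
  exact (h1.differentiableAt (by norm_num)).hasFDerivAt

/-- Second-order Taylor expansion of a `C²` function. -/
lemma taylor_two {ρ : E N → ℝ} {x : E N} (h : ContDiffAt ℝ 2 ρ x) {ε : ℝ} (hε : 0 < ε) :
    ∀ᶠ y in 𝓝 x, |ρ y - ρ x - fderiv ℝ ρ x (y - x) - hess ρ x (y - x) (y - x) / 2|
      ≤ ε * ‖y - x‖ ^ 2 := by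
  have h1 : ∀ᶠ y in 𝓝 x, HasFDerivAt ρ (fderiv ℝ ρ y) y := by
    filter_upwards [h.eventually (by simp)] with y hy
    exact (hy.differentiableAt (by norm_num)).hasFDerivAt
  have h2 := (hasFDerivAt_fderiv h).isLittleO.bound hε
  obtain ⟨r, hr, hball⟩ := Metric.eventually_nhds_iff_ball.1 (h1.and h2)
  refine Metric.eventually_nhds_iff_ball.2 ⟨r, hr, fun y hy => ?_⟩
  set R := ‖y - x‖ with hR
  have hyr : R < r := by rw [hR, ← dist_eq_norm]; exact hy
  let g : E N → ℝ := fun z => ρ z - hess ρ x (z - x) (z - x) / 2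
  have hg : ∀ z ∈ closedBall x R, HasFDerivWithinAt g
      (fderiv ℝ ρ z - hess ρ x (z - x)) (closedBall x R) z := by
    intro z hz
    have hz' : z ∈ ball x r := mem_ball.2 ((mem_closedBall.1 hz).trans_lt hyr)
    have d1 := (hball z hz').1
    have d2 : HasFDerivAt (fun z => z - x) (ContinuousLinearMap.id ℝ (E N)) z :=
      (hasFDerivAt_id z).sub_const x
    have d3 : HasFDerivAt (fun z => hess ρ x (z - x)) (hess ρ x) z :=
      (hess ρ x).hasFDerivAt.comp z d2
    have d4 := d3.clm_apply d2
    have d5 := (d1.sub (d4.const_mul (1/2:ℝ))).hasFDerivWithinAt (s := closedBall x R)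
    refine (d5.congr_fderiv ?_).congr (fun w _ => ?_) ?_
    · ext w
      simp only [ContinuousLinearMap.sub_apply, ContinuousLinearMap.smul_apply,
        ContinuousLinearMap.add_apply, ContinuousLinearMap.comp_apply,
        ContinuousLinearMap.flip_apply, ContinuousLinearMap.id_apply, smul_eq_mul]
      rw [hess_symm h w (z - x)]; ring
    · simp only [g]; show _ = ρ w - 1/2 * _; ring
    · simp only [g]; show _ = ρ z - 1/2 * _; ring
  have hb : ∀ z ∈ closedBall x R, ‖(fderiv ℝ ρ z - hess ρ x (z - x)) - fderiv ℝ ρ x‖ ≤ ε * R := by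
    intro z hz
    have hz' : z ∈ ball x r := mem_ball.2 ((mem_closedBall.1 hz).trans_lt hyr)
    have := (hball z hz').2
    have e : (fderiv ℝ ρ z - hess ρ x (z - x)) - fderiv ℝ ρ x =
      fderiv ℝ ρ z - fderiv ℝ ρ x - hess ρ x (z - x) := by abel
    rw [e]
    refine this.trans ?_
    have : ‖z - x‖ ≤ R := by rw [← dist_eq_norm]; exact hz
    gcongr
  have key := (convex_closedBall x R).norm_image_sub_le_of_norm_hasFDerivWithin_le' hg hb
    (mem_closedBall_self (norm_nonneg _)) (show y ∈ closedBall x R by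
      rw [mem_closedBall, dist_eq_norm])
  simp only [g, sub_self, map_zero, zero_div, sub_zero, Real.norm_eq_abs] at key
  calc _ = |ρ y - hess ρ x (y - x) (y - x) / 2 - ρ x - fderiv ℝ ρ x (y - x)| := by
        congr 1; ring
    _ ≤ _ := by rw [pow_two, ← mul_assoc]; exact key

/-- increments along the four directions -/
lemma tendsto_incr {ρ : E N → ℝ} {ψ : ℂ → E N} {z : ℂ} (hψ : AnalyticAt ℂ ψ z)
    (h : ContDiffAt ℝ 2 ρ (ψ z)) (a : ℂ) :
    Tendsto (fun t : ℝ => t⁻¹ * (ρ (ψ (z + t * a)) - ρ (ψ z))) (𝓝[>] (0:ℝ))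
      (𝓝 (fderiv ℝ ρ (ψ z) (a • deriv ψ z))) := by
  have h1 : HasDerivAt (fun t : ℝ => z + (t:ℂ) * a) a 0 := by
    have := ((Complex.ofRealCLM.hasDerivAt (x := (0:ℝ))).mul_const a).const_add z
    simpa using this
  have h2 : HasDerivAt ψ (deriv ψ z) ((fun t : ℝ => z + (t:ℂ) * a) 0) := by
    simpa using hψ.differentiableAt.hasDerivAt
  have h3 : HasDerivAt (fun t : ℝ => ψ (z + t * a)) (a • deriv ψ z) 0 := h2.scomp 0 h1
  have h4 : HasFDerivAt ρ (fderiv ℝ ρ (ψ z)) (ψ (z + ((0:ℝ):ℂ) * a)) := by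
    simpa using (h.differentiableAt (by norm_num)).hasFDerivAt
  have := (h4.comp_hasDerivAt (0:ℝ) h3).tendsto_slope_zero_right
  simpa using this

lemma tendsto_rem {ρ : E N → ℝ} {ψ : ℂ → E N} {z : ℂ} (hψ : AnalyticAt ℂ ψ z)
    (h : ContDiffAt ℝ 2 ρ (ψ z)) (a : ℂ) :
    Tendsto (fun t : ℝ => (t^2)⁻¹ * (ρ (ψ (z + t * a)) - ρ (ψ z) -
        fderiv ℝ ρ (ψ z) (ψ (z + t * a) - ψ z))) (𝓝[>] (0:ℝ))
      (𝓝 (hess ρ (ψ z) (a • deriv ψ z) (a • deriv ψ z) / 2)) := by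
  have hq := tendsto_diff_quot hψ.differentiableAt a
  have hB : Tendsto (fun t : ℝ => hess ρ (ψ z) (t⁻¹ • (ψ (z + t * a) - ψ z))
      (t⁻¹ • (ψ (z + t * a) - ψ z)) / 2) (𝓝[>] (0:ℝ))
      (𝓝 (hess ρ (ψ z) (a • deriv ψ z) (a • deriv ψ z) / 2)) := by
    have hc : Continuous fun v : E N => hess ρ (ψ z) v v / 2 := by fun_prop
    exact (hc.tendsto _).comp hq
  have hn : Tendsto (fun t : ℝ => ‖t⁻¹ • (ψ (z + t * a) - ψ z)‖) (𝓝[>] (0:ℝ))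
      (𝓝 ‖a • deriv ψ z‖) := hq.norm
  have h0 : Tendsto (fun t : ℝ => (t^2)⁻¹ * (ρ (ψ (z + t * a)) - ρ (ψ z) -
        fderiv ℝ ρ (ψ z) (ψ (z + t * a) - ψ z)) - hess ρ (ψ z) (t⁻¹ • (ψ (z + t * a) - ψ z))
      (t⁻¹ • (ψ (z + t * a) - ψ z)) / 2) (𝓝[>] (0:ℝ)) (𝓝 0) := by
    rw [Metric.tendsto_nhds]
    intro ε hε
    set L := ‖a • deriv ψ z‖ with hL
    have hL0 : 0 ≤ L := norm_nonneg _
    have hδ : 0 < ε / (2 * (L + 1) ^ 2) := by positivity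
    have ht1 := taylor_two h hδ
    have hcont : Tendsto (fun t : ℝ => ψ (z + t * a)) (𝓝[>] (0:ℝ)) (𝓝 (ψ z)) :=
      (hψ.continuousAt.tendsto).comp (tendsto_add_small z a)
    filter_upwards [hcont.eventually ht1, hn.eventually (gt_mem_nhds (show L < L + 1 by linarith)),
      self_mem_nhdsWithin] with t h1 h2 ht0
    have ht0 : 0 < t := ht0
    rw [Real.dist_eq, sub_zero]
    simp only [map_smul, ContinuousLinearMap.smul_apply, smul_eq_mul]
    rw [norm_smul, Real.norm_eq_abs, abs_of_pos (inv_pos.2 ht0)] at h2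
    have e : (t ^ 2)⁻¹ * (ρ (ψ (z + t * a)) - ρ (ψ z) - fderiv ℝ ρ (ψ z) (ψ (z + t * a) - ψ z)) -
        t⁻¹ * (t⁻¹ * hess ρ (ψ z) (ψ (z + t * a) - ψ z) (ψ (z + t * a) - ψ z)) / 2 =
        (t^2)⁻¹ * (ρ (ψ (z + t * a)) - ρ (ψ z) - fderiv ℝ ρ (ψ z) (ψ (z + t * a) - ψ z) -
          hess ρ (ψ z) (ψ (z + t * a) - ψ z) (ψ (z + t * a) - ψ z) / 2) := by
      rw [pow_two, mul_inv]; ring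
    rw [e, abs_mul, abs_of_pos (by positivity)]
    have h3 : (t^2)⁻¹ * (ε / (2 * (L + 1) ^ 2) * ‖ψ (z + t * a) - ψ z‖ ^ 2) =
      ε / (2 * (L + 1) ^ 2) * (t⁻¹ * ‖ψ (z + t * a) - ψ z‖) ^ 2 := by
      rw [mul_pow, inv_pow]; ring
    have h4 : (t⁻¹ * ‖ψ (z + t * a) - ψ z‖) ^ 2 ≤ (L + 1) ^ 2 := by gcongr
    calc _ ≤ (t^2)⁻¹ * (ε / (2 * (L + 1) ^ 2) * ‖ψ (z + t * a) - ψ z‖ ^ 2) := by gcongr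
      _ ≤ ε / (2 * (L + 1) ^ 2) * (L + 1) ^ 2 := by rw [h3]; gcongr
      _ = ε / 2 := by field_simp
      _ < ε := by linarith
  have := h0.add hB
  simpa using this

/-- The Laplacian of `ρ ∘ ψ` via four-point sums. -/
lemma tendsto_quad_comp {ρ : E N → ℝ} {ψ : ℂ → E N} {z : ℂ} (hψ : AnalyticAt ℂ ψ z)
    (h : ContDiffAt ℝ 2 ρ (ψ z)) :
    Tendsto (fun t : ℝ => (t^2)⁻¹ * (quad (fun x => ρ (ψ x)) z t - 4 * ρ (ψ z))) (𝓝[>] (0:ℝ))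
      (𝓝 (4 * levi ρ (ψ z) (deriv ψ z))) := by
  have h1 := tendsto_rem hψ h 1
  have h2 := tendsto_rem hψ h (-1)
  have h3 := tendsto_rem hψ h Complex.I
  have h4 := tendsto_rem hψ h (-Complex.I)
  have h5 : Tendsto (fun t : ℝ => fderiv ℝ ρ (ψ z) ((t ^ 2)⁻¹ • (quad ψ z t - (4:ℝ) • ψ z)))
      (𝓝[>] (0:ℝ)) (𝓝 (fderiv ℝ ρ (ψ z) 0)) :=
    ((fderiv ℝ ρ (ψ z)).continuous.tendsto 0).comp (tendsto_quad_sub hψ)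
  have := (((h1.add h2).add h3).add h4).add h5
  simp only [neg_smul, map_neg, ContinuousLinearMap.neg_apply, one_smul, neg_neg, map_zero,
    add_zero] at this
  have e : 4 * levi ρ (ψ z) (deriv ψ z) = hess ρ (ψ z) (deriv ψ z) (deriv ψ z) / 2
      + hess ρ (ψ z) (deriv ψ z) (deriv ψ z) / 2 +
      hess ρ (ψ z) (Complex.I • deriv ψ z) (Complex.I • deriv ψ z) / 2 +
      hess ρ (ψ z) (Complex.I • deriv ψ z) (Complex.I • deriv ψ z) / 2 := by
    rw [levi_eq]; ring
  rw [e]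
  refine this.congr fun t => ?_
  simp only [quad, map_smul, map_sub, map_add, smul_eq_mul, mul_one, mul_neg, ← sub_eq_add_neg]
  ring

lemma tendsto_quad_sq {ρ : E N → ℝ} {ψ : ℂ → E N} {z : ℂ} (hψ : AnalyticAt ℂ ψ z)
    (h : ContDiffAt ℝ 2 ρ (ψ z)) :
    Tendsto (fun t : ℝ => (t^2)⁻¹ * quad (fun x => (ρ (ψ x) - ρ (ψ z)) ^ 2) z t) (𝓝[>] (0:ℝ))
      (𝓝 (2 * ‖ell ρ (ψ z) (deriv ψ z)‖ ^ 2)) := by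
  have h1 := (tendsto_incr hψ h 1).pow 2
  have h2 := (tendsto_incr hψ h (-1)).pow 2
  have h3 := (tendsto_incr hψ h Complex.I).pow 2
  have h4 := (tendsto_incr hψ h (-Complex.I)).pow 2
  have := ((h1.add h2).add h3).add h4
  simp only [neg_smul, map_neg, one_smul, neg_sq] at this
  rw [norm_ell_sq]
  have e : 2 * (fderiv ℝ ρ (ψ z) (deriv ψ z) ^ 2 +
      fderiv ℝ ρ (ψ z) (Complex.I • deriv ψ z) ^ 2) =
    fderiv ℝ ρ (ψ z) (deriv ψ z) ^ 2 + fderiv ℝ ρ (ψ z) (deriv ψ z) ^ 2 +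
    fderiv ℝ ρ (ψ z) (Complex.I • deriv ψ z) ^ 2 +
    fderiv ℝ ρ (ψ z) (Complex.I • deriv ψ z) ^ 2 := by ring
  rw [e]
  refine this.congr fun t => ?_
  simp only [quad, mul_one, mul_neg, ← sub_eq_add_neg, mul_pow, inv_pow]
  ring

lemma tendsto_quad_normSq {ψ : ℂ → E N} {z : ℂ} (hψ : AnalyticAt ℂ ψ z) :
    Tendsto (fun t : ℝ => (t^2)⁻¹ * (quad (fun x => ‖ψ x‖ ^ 2) z t - 4 * ‖ψ z‖ ^ 2))
      (𝓝[>] (0:ℝ)) (𝓝 (4 * ‖deriv ψ z‖ ^ 2)) := by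
  have k := fun a => ((tendsto_diff_quot hψ.differentiableAt a).norm).pow 2
  have h5 : Tendsto (fun t : ℝ => 2 * (inner ℂ (ψ z)
      ((t ^ 2)⁻¹ • (quad ψ z t - (4:ℝ) • ψ z)) : ℂ).re)
      (𝓝[>] (0:ℝ)) (𝓝 (2 * (inner ℂ (ψ z) (0 : E N) : ℂ).re)) := by
    have hc : Continuous fun v : E N => 2 * (inner ℂ (ψ z) v : ℂ).re := by fun_prop
    exact (hc.tendsto 0).comp (tendsto_quad_sub hψ)
  have := ((((k 1).add (k (-1))).add (k Complex.I)).add (k (-Complex.I))).add h5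
  simp only [norm_smul, norm_neg, norm_one, Complex.norm_I, one_mul, inner_zero_right,
    Complex.zero_re, mul_zero, add_zero] at this
  have e : 4 * ‖deriv ψ z‖ ^ 2 = ‖deriv ψ z‖ ^ 2 + ‖deriv ψ z‖ ^ 2 + ‖deriv ψ z‖ ^ 2 +
    ‖deriv ψ z‖ ^ 2 := by ring
  rw [e]
  refine this.congr fun t => ?_
  have hs : ∀ y : E N, ‖y‖ ^ 2 = ‖y - ψ z‖ ^ 2 + 2 * (inner ℂ (ψ z) (y - ψ z) : ℂ).re +
      ‖ψ z‖ ^ 2 := by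
    intro y
    have := norm_add_sq (𝕜 := ℂ) (ψ z) (y - ψ z)
    rw [add_sub_cancel] at this
    rw [this]; simp only [RCLike.re_eq_complex_re]; ring
  have hI : ∀ w : E N, (inner ℂ (ψ z) ((t^2)⁻¹ • w) : ℂ).re = (t^2)⁻¹ * (inner ℂ (ψ z) w : ℂ).re := by
    intro w
    rw [← Complex.coe_smul, inner_smul_right, Complex.re_ofReal_mul]
  have hq : quad ψ z t - (4:ℝ) • ψ z = (ψ (z + t) - ψ z) + (ψ (z - t) - ψ z) +
      (ψ (z + t * Complex.I) - ψ z) + (ψ (z - t * Complex.I) - ψ z) := by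
    simp only [quad]; module
  rw [hI, hq]
  simp only [quad, inner_add_right, Complex.add_re]
  rw [hs (ψ (z + t)), hs (ψ (z - t)), hs (ψ (z + t * Complex.I)), hs (ψ (z - t * Complex.I))]
  simp only [mul_one, mul_neg, ← sub_eq_add_neg, mul_pow, inv_pow, Real.norm_eq_abs, sq_abs]
  ring

lemma exp_ge_quadratic {y : ℝ} (hy : |y| ≤ 1) : y + y ^ 2 / 4 ≤ Real.exp y - 1 := by
  have h := Real.exp_bound hy (n := 3) (by norm_num)
  simp only [Finset.sum_range_succ, Finset.sum_range_zero, Nat.factorial] at h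
  norm_num at h
  have h2 := (abs_le.1 h).1
  have h3 : |y| ^ 3 ≤ y ^ 2 := by
    rw [pow_succ, sq_abs]; nlinarith [sq_nonneg y]
  nlinarith [sq_nonneg y]

/-- Strict plurisubharmonicity of `exp (l ρ)` along holomorphic discs. -/
lemma subLap_exp_comp {ρ : E N → ℝ} {ψ : ℂ → E N} {z : ℂ} (hψ : AnalyticAt ℂ ψ z)
    (h : ContDiffAt ℝ 2 ρ (ψ z)) {l c : ℝ} (hl : 0 < l)
    (hc : c * ‖deriv ψ z‖ ^ 2 ≤ Real.exp (l * ρ (ψ z)) * l *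
      (levi ρ (ψ z) (deriv ψ z) + l / 8 * ‖ell ρ (ψ z) (deriv ψ z)‖ ^ 2)) :
    SubLap (fun x => Real.exp (l * ρ (ψ x)) - c * ‖ψ x‖ ^ 2) z := by
  intro ε hε
  set e := Real.exp (l * ρ (ψ z)) with he
  have he0 : 0 < e := Real.exp_pos _
  have h1 := ((tendsto_quad_comp hψ h).const_mul (e * l))
  have h2 := ((tendsto_quad_sq hψ h).const_mul (e * l ^ 2 / 4))
  have h3 := ((tendsto_quad_normSq hψ).const_mul c)
  have hlim := (h1.add h2).sub h3
  have hpos : -ε < e * l * (4 * levi ρ (ψ z) (deriv ψ z)) +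
      e * l ^ 2 / 4 * (2 * ‖ell ρ (ψ z) (deriv ψ z)‖ ^ 2) - c * (4 * ‖deriv ψ z‖ ^ 2) := by
    nlinarith
  have hcont : ContinuousAt (fun x => l * (ρ (ψ x) - ρ (ψ z))) z := by
    have := (ContinuousAt.comp (f := ψ) (g := ρ) (x := z)
      (h.continuousAt) hψ.continuousAt)
    exact (this.sub continuousAt_const).const_mul l
  have hsm : ∀ᶠ x in 𝓝 z, |l * (ρ (ψ x) - ρ (ψ z))| ≤ 1 := by
    have := hcont.abs.tendsto.eventually 
      (ge_mem_nhds (show |l * (ρ (ψ z) - ρ (ψ z))| < 1 by rw [sub_self, mul_zero, abs_zero]; norm_num))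
    exact this
  filter_upwards [hlim.eventually (lt_mem_nhds hpos), eventually_quad_points hsm,
    self_mem_nhdsWithin] with t ht ⟨p1, p2, p3, p4⟩ ht0
  have ht0 : 0 < t := ht0
  have key : ∀ x, |l * (ρ (ψ x) - ρ (ψ z))| ≤ 1 →
      e * (l * (ρ (ψ x) - ρ (ψ z)) + (l * (ρ (ψ x) - ρ (ψ z))) ^ 2 / 4) ≤
        Real.exp (l * ρ (ψ x)) - e := by
    intro x hx
    have h1 := mul_le_mul_of_nonneg_left (exp_ge_quadratic hx) he0.le
    have h2 : Real.exp (l * ρ (ψ x)) = e * Real.exp (l * (ρ (ψ x) - ρ (ψ z))) := by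
      rw [he, ← Real.exp_add]; congr 1; ring
    rw [h2]; linarith
  have k1 := key _ p1
  have k2 := key _ p2
  have k3 := key _ p3
  have k4 := key _ p4
  have e2 : e * l * ((t ^ 2)⁻¹ * (quad (fun x => ρ (ψ x)) z t - 4 * ρ (ψ z))) +
        e * l ^ 2 / 4 * ((t ^ 2)⁻¹ * quad (fun x => (ρ (ψ x) - ρ (ψ z)) ^ 2) z t) -
      c * ((t ^ 2)⁻¹ * (quad (fun x => ‖ψ x‖ ^ 2) z t - 4 * ‖ψ z‖ ^ 2)) =
      (t^2)⁻¹ * (e * l * (quad (fun x => ρ (ψ x)) z t - 4 * ρ (ψ z)) +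
        e * l ^ 2 / 4 * quad (fun x => (ρ (ψ x) - ρ (ψ z)) ^ 2) z t -
        c * (quad (fun x => ‖ψ x‖ ^ 2) z t - 4 * ‖ψ z‖ ^ 2)) := by ring
  rw [e2, inv_mul_eq_div, lt_div_iff₀ (by positivity)] at ht
  simp only [quad] at ht ⊢
  nlinarith

/-- Quantitative geometry of a strongly pseudoconvex domain `Ω = {ρ < 0}`. -/
structure Geom (α : ℝ) (Ω : Set (E N)) where
  ρ : E N → ℝ
  ν : E N → E N
  M : ℝ
  m : ℝ
  lam : ℝ
  κ : ℝ
  δ : ℝ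
  hα : 0 < α
  hα1 : α ≤ 1
  hM : 1 ≤ M
  hm : 0 < m
  hlam : 0 < lam
  hκ : 0 < κ
  hδ : 0 < δ
  isOpen : IsOpen Ω
  conn : IsConnected Ω
  bdd : Bornology.IsBounded Ω
  C2 : ∀ x ∈ thickening δ (closure Ω), ContDiffAt ℝ 2 ρ x
  neg : ∀ x ∈ Ω, ρ x < 0
  inside : ∀ x ∈ thickening δ (closure Ω), ρ x < 0 → x ∈ Ω
  zero : ∀ x ∈ closure Ω, x ∉ Ω → ρ x = 0
  norm_le : ∀ x ∈ closure Ω, ‖x‖ ≤ M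
  rho_ge : ∀ x ∈ closure Ω, -M ≤ ρ x
  hess_le : ∀ x ∈ closure Ω, ‖hess ρ x‖ ≤ M
  taylor_near : ∀ x ∈ closure Ω, ∀ y, ‖y - x‖ < δ →
    |ρ y - ρ x - fderiv ℝ ρ x (y - x)| ≤ M * ‖y - x‖ ^ 2
  taylor : ∀ x ∈ closure Ω, ∀ y ∈ closure Ω,
    |ρ y - ρ x - fderiv ℝ ρ x (y - x)| ≤ M * ‖y - x‖ ^ 2
  lip : ∀ x ∈ closure Ω, ∀ y ∈ closure Ω, ‖fderiv ℝ ρ y - fderiv ℝ ρ x‖ ≤ M * ‖y - x‖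
  holder : ∀ x ∈ closure Ω, ∀ y ∈ closure Ω,
    ‖fderiv ℝ ρ y - fderiv ℝ ρ x - hess ρ x (y - x)‖ ≤ M * ‖y - x‖ ^ (1 + α)
  nu_le : ∀ x ∈ closure Ω, ‖ν x‖ ≤ M
  ell_nu : ∀ x ∈ closure Ω, -κ ≤ ρ x → ell ρ x (ν x) = 1
  levi_ge : ∀ x ∈ thickening δ (closure Ω), -κ ≤ ρ x → ∀ v : E N,
    m * ‖v‖ ^ 2 ≤ levi ρ x v + lam / 8 * ‖ell ρ x v‖ ^ 2
  le_bdist : ∀ x ∈ Ω, -ρ x ≤ M * bdist Ω x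
  bdist_le : ∀ x ∈ Ω, bdist Ω x ≤ M * -ρ x

lemma infDist_frontier_le {Ω : Set (E N)} {x y : E N} (hx : x ∈ Ω) (ho : IsOpen Ω) (hy : y ∉ Ω) :
    infDist x (frontier Ω) ≤ dist x y := by
  by_contra hcon
  push Not at hcon
  have hdisj : ∀ z ∈ segment ℝ x y, z ∉ frontier Ω := by
    intro z hz hzf
    have h1 := infDist_le_dist_of_mem (x := x) hzf
    have h2 : dist x z ≤ dist x y := by
      have := (mem_segment_iff_wbtw.1 hz).dist_add_dist
      linarith [dist_nonneg (x := z) (y := y)]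
    linarith
  have hsub : segment ℝ x y ⊆ Ω ∪ (closure Ω)ᶜ := by
    intro z hz
    by_cases hzc : z ∈ closure Ω
    · left
      by_contra hzo
      exact hdisj z hz ⟨hzc, by rwa [ho.interior_eq]⟩
    · exact Or.inr hzc
  have hpre : IsPreconnected (segment ℝ x y) := (convex_segment x y).isPreconnected
  have := hpre.subset_left_of_subset_union ho isClosed_closure.isOpen_compl
    (disjoint_compl_right.mono_left subset_closure) hsub ⟨x, left_mem_segment ℝ x y, hx⟩
  exact hy (this (right_mem_segment ℝ x y))

lemma exists_nat_inter_empty {X : Type*} [TopologicalSpace X] {Q : Set X} (hQ : IsCompact Q)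
    (Z : ℕ → Set X) (hcl : ∀ n, IsClosed (Q ∩ Z n))
    (hanti : ∀ n, Q ∩ Z (n + 1) ⊆ Q ∩ Z n) (hemp : ∀ x ∈ Q, (∀ n, x ∈ Z n) → False) :
    ∃ n, ∀ x ∈ Q, x ∉ Z n := by
  by_contra hcon
  push Not at hcon
  have h := IsCompact.nonempty_iInter_of_sequence_nonempty_isCompact_isClosed
    (fun n => Q ∩ Z n) hanti (fun n => by
      obtain ⟨x, hx, hz⟩ := hcon n; exact ⟨x, hx, hz⟩) (hQ.of_isClosed_subset (hcl 0)
      inter_subset_left) hcl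
  obtain ⟨x, hx⟩ := h
  rw [mem_iInter] at hx
  exact hemp x (hx 0).1 fun n => (hx n).2

lemma hess_sub_le (ρ : E N → ℝ) (x y : E N) :
    ‖hess ρ x - hess ρ y‖ ≤ ‖iteratedFDeriv ℝ 2 ρ x - iteratedFDeriv ℝ 2 ρ y‖ := by
  refine ContinuousLinearMap.opNorm_le_bound _ (norm_nonneg _) fun v => ?_
  refine ContinuousLinearMap.opNorm_le_bound _ (by positivity) fun w => ?_
  have h := (iteratedFDeriv ℝ 2 ρ x - iteratedFDeriv ℝ 2 ρ y).le_opNorm ![v, w]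
  simp only [Fin.prod_univ_two, Matrix.cons_val_zero, Matrix.cons_val_one] at h
  calc _ = ‖(iteratedFDeriv ℝ 2 ρ x - iteratedFDeriv ℝ 2 ρ y) ![v, w]‖ := by
        simp [iteratedFDeriv_two_apply, hess]
    _ ≤ _ := by rw [mul_assoc]; exact h

lemma exists_bound_on {X : Type*} [TopologicalSpace X] {F : Type*} [NormedAddCommGroup F]
    {K : Set X} (hK : IsCompact K) {f : X → F} (hf : ContinuousOn f K) :
    ∃ C, 0 ≤ C ∧ ∀ x ∈ K, ‖f x‖ ≤ C := by
  obtain ⟨C, hC⟩ := hK.exists_bound_of_continuousOn hf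
  exact ⟨max C 0, le_max_right _ _, fun x hx => (hC x hx).trans (le_max_left _ _)⟩

/-- Uniform estimate for a function bounded by `A r^p` at small scale and by `B` in general. -/
lemma two_scale {r δ A B p v : ℝ} (hδ : 0 < δ) (hA : 0 ≤ A) (hB : 0 ≤ B) (hr : 0 ≤ r)
    (hp : 0 ≤ p)
    (h1 : r < δ → v ≤ A * r ^ p) (h2 : v ≤ B) : v ≤ (A + B / δ ^ p) * r ^ p := by
  have hδp : 0 < δ ^ p := Real.rpow_pos_of_pos hδ p
  have hrp : 0 ≤ r ^ p := Real.rpow_nonneg hr p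
  rcases lt_or_ge r δ with h | h
  · have : 0 ≤ B / δ ^ p * r ^ p := by positivity
    nlinarith [h1 h]
  · have h3 : δ ^ p ≤ r ^ p := Real.rpow_le_rpow hδ.le h hp
    have h4 : B ≤ B / δ ^ p * r ^ p := by
      rw [div_mul_eq_mul_div, le_div_iff₀ hδp]; gcongr
    nlinarith [mul_nonneg hA hrp]

lemma continuousOn_hess {ρ : E N → ℝ} {U : Set (E N)} (hU : IsOpen U) (h2 : ContDiffOn ℝ 2 ρ U) :
    ContinuousOn (fderiv ℝ ρ) U ∧ ContinuousOn (hess ρ) U := by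
  have h1 : ContDiffOn ℝ 1 (fderiv ℝ ρ) U := h2.fderiv_of_isOpen hU (by norm_num)
  exact ⟨h1.continuousOn, h1.continuousOn_fderiv_of_isOpen hU (by norm_num)⟩

lemma levi_smul (ρ : E N → ℝ) (x v : E N) (r : ℝ) : levi ρ x (r • v) = r ^ 2 * levi ρ x v := by
  rw [levi_eq, levi_eq, smul_comm Complex.I r v]
  simp only [map_smul, smul_apply, smul_eq_mul]
  ring

lemma exists_levi {Ω U : Set (E N)} {ρ : E N → ℝ} (hU : IsOpen U)
    (hΩ : Ω.Nonempty) (hK : IsCompact (closure Ω)) (h2 : ContDiffOn ℝ 2 ρ U) {δ₀ : ℝ}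
    (hδ₀ : 0 < δ₀) (hsub : cthickening δ₀ (closure Ω) ⊆ U)
    (hfr : ∀ x ∈ closure Ω, 0 ≤ ρ x → x ∈ frontier Ω)
    (hl : ∀ p ∈ frontier Ω, ∀ v : E N, v ≠ 0 → fderiv ℝ ρ p v = 0 →
      fderiv ℝ ρ p ((Complex.I : ℂ) • v) = 0 → 0 < levi ρ p v) :
    ∃ m lam κ δ : ℝ, 0 < m ∧ 0 < lam ∧ 0 < κ ∧ 0 < δ ∧ δ ≤ δ₀ ∧
      ∀ x ∈ thickening δ (closure Ω), -κ ≤ ρ x → ∀ v : E N,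
        m * ‖v‖ ^ 2 ≤ levi ρ x v + lam / 8 * ‖ell ρ x v‖ ^ 2 := by
  obtain ⟨c1, c2⟩ := continuousOn_hess hU h2
  have hne : (closure Ω).Nonempty := hΩ.closure
  let Q : Set (E N × E N) := cthickening δ₀ (closure Ω) ×ˢ sphere (0 : E N) 1
  have hQ : IsCompact Q := hK.cthickening.prod (isCompact_sphere _ _)
  let f : ℕ → E N × E N → ℝ × ℝ × ℝ := fun n p =>
    (infDist p.1 (closure Ω), ρ p.1, levi ρ p.1 p.2 + n * ‖ell ρ p.1 p.2‖ ^ 2)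
  let Z : ℕ → Set (E N × E N) := fun n =>
    f n ⁻¹' (Iic (δ₀ / (n + 1)) ×ˢ Ici (-(1 / (n + 1) : ℝ)) ×ˢ Iic (1 / (n + 1) : ℝ))
  have hm1 : MapsTo (fun p : E N × E N => p.1) Q U := fun p hp => hsub hp.1
  have cd : ContinuousOn (fun p : E N × E N => fderiv ℝ ρ p.1) Q :=
    c1.comp continuousOn_fst hm1
  have ch : ContinuousOn (fun p : E N × E N => hess ρ p.1) Q :=
    c2.comp continuousOn_fst hm1
  have cr : ContinuousOn (fun p : E N × E N => ρ p.1) Q :=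
    h2.continuousOn.comp continuousOn_fst hm1
  have cf : ∀ n, ContinuousOn (f n) Q := by
    intro n
    refine ContinuousOn.prodMk (by fun_prop) (ContinuousOn.prodMk cr ?_)
    simp only [norm_ell_sq, levi_eq]
    have e1 : ContinuousOn (fun p : E N × E N => hess ρ p.1 p.2 p.2) Q :=
      (ch.clm_apply continuousOn_snd).clm_apply continuousOn_snd
    have cI : ContinuousOn (fun p : E N × E N => Complex.I • p.2) Q := by fun_prop
    have e2 : ContinuousOn (fun p : E N × E N =>
      hess ρ p.1 (Complex.I • p.2) (Complex.I • p.2)) Q := (ch.clm_apply cI).clm_apply cI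
    have e3 : ContinuousOn (fun p : E N × E N => fderiv ℝ ρ p.1 p.2) Q :=
      cd.clm_apply continuousOn_snd
    have e4 : ContinuousOn (fun p : E N × E N => fderiv ℝ ρ p.1 (Complex.I • p.2)) Q :=
      cd.clm_apply cI
    fun_prop
  obtain ⟨n, hn⟩ := exists_nat_inter_empty hQ Z
    (fun n => (cf n).preimage_isClosed_of_isClosed hQ.isClosed
      (isClosed_Iic.prod (isClosed_Ici.prod isClosed_Iic)))
    (by
      rintro n p ⟨hp, ⟨h1, h2, h3⟩⟩
      refine ⟨hp, ⟨?_, ?_, ?_⟩⟩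
      · simp only [f, mem_Iic, Nat.cast_add, Nat.cast_one] at h1 ⊢
        refine h1.trans ?_
        gcongr; linarith
      · simp only [f, mem_Ici, Nat.cast_add, Nat.cast_one] at h2 ⊢
        refine le_trans ?_ h2
        rw [neg_le_neg_iff]
        gcongr; linarith
      · simp only [f, mem_Iic, Nat.cast_add, Nat.cast_one] at h3 ⊢
        have h4 : (1:ℝ) / (n + 1 + 1) ≤ 1 / (n + 1) := by gcongr; linarith
        nlinarith [sq_nonneg ‖ell ρ p.1 p.2‖])
    (by
      rintro ⟨x, v⟩ hp hz
      have hv : ‖v‖ = 1 := mem_sphere_zero_iff_norm.1 hp.2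
      have hz1 : ∀ n : ℕ, infDist x (closure Ω) ≤ δ₀ / (n + 1) := fun n => (hz n).1
      have hz2 : ∀ n : ℕ, -(1 / (n + 1) : ℝ) ≤ ρ x := fun n => (hz n).2.1
      have hz3 : ∀ n : ℕ, levi ρ x v + n * ‖ell ρ x v‖ ^ 2 ≤ 1 / ((n:ℝ) + 1) :=
        fun n => (hz n).2.2
      have t1 : Tendsto (fun n : ℕ => 1 / ((n:ℝ) + 1)) atTop (𝓝 0) :=
        tendsto_one_div_add_atTop_nhds_zero_nat
      have t2 : Tendsto (fun n : ℕ => δ₀ / ((n:ℝ) + 1)) atTop (𝓝 0) := by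
        have := t1.const_mul δ₀
        rw [mul_zero] at this
        refine this.congr fun n => by ring
      have t3 : Tendsto (fun n : ℕ => -(1 / ((n:ℝ) + 1))) atTop (𝓝 0) := by
        have := t1.neg; rwa [neg_zero] at this
      have i0 : infDist x (closure Ω) ≤ 0 := ge_of_tendsto' t2 hz1
      have r0 : 0 ≤ ρ x := le_of_tendsto' t3 hz2
      have hxK : x ∈ closure Ω := by
        rw [isClosed_closure.mem_iff_infDist_zero hne]
        exact le_antisymm i0 infDist_nonneg
      have hxf := hfr x hxK r0
      have l0 : levi ρ x v ≤ 0 := ge_of_tendsto' t1 fun n => by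
        have := hz3 n; nlinarith [mul_nonneg (Nat.cast_nonneg (α := ℝ) n) (sq_nonneg ‖ell ρ x v‖)]
      have e0 : ‖ell ρ x v‖ ^ 2 = 0 := by
        by_contra hne0
        have hpos : 0 < ‖ell ρ x v‖ ^ 2 := lt_of_le_of_ne (sq_nonneg _) (Ne.symm hne0)
        obtain ⟨k, hk⟩ := exists_nat_gt ((1 - levi ρ x v) / ‖ell ρ x v‖ ^ 2)
        rw [div_lt_iff₀ hpos] at hk
        have h5 := hz3 k
        have h6 : 1 / ((k:ℝ) + 1) ≤ 1 := by
          rw [div_le_one (by positivity)]; linarith [Nat.cast_nonneg (α := ℝ) k]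
        linarith
      rw [norm_ell_sq] at e0
      have a1 : fderiv ℝ ρ x v = 0 := by
        nlinarith [sq_nonneg (fderiv ℝ ρ x v), sq_nonneg (fderiv ℝ ρ x (Complex.I • v))]
      have a2 : fderiv ℝ ρ x (Complex.I • v) = 0 := by
        nlinarith [sq_nonneg (fderiv ℝ ρ x v), sq_nonneg (fderiv ℝ ρ x (Complex.I • v))]
      have hv0 : v ≠ 0 := by
        intro h; rw [h, norm_zero] at hv; norm_num at hv
      linarith [hl x hxf v hv0 a1 a2])
  have hn1 : (0:ℝ) < n + 1 := by positivity
  refine ⟨1 / (n + 1), 8 * (n + 1), 1 / (n + 1), δ₀ / (n + 1), by positivity, by positivity,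
    by positivity, by positivity, ?_, ?_⟩
  · rw [div_le_iff₀ hn1]; nlinarith [Nat.cast_nonneg (α := ℝ) n]
  · intro x hx hκ v
    rcases eq_or_ne v 0 with rfl | hv
    · have : levi ρ x (0 : E N) = 0 := by rw [levi_eq]; simp
      simp [this]
    have hv0 : 0 < ‖v‖ := norm_pos_iff.2 hv
    set w := ‖v‖⁻¹ • v with hw
    have hw1 : ‖w‖ = 1 := by rw [hw, norm_smul]; simp [hv0.ne']
    have hvw : v = ‖v‖ • w := by rw [hw, smul_smul, mul_inv_cancel₀ hv0.ne', one_smul]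
    have hinf := (mem_thickening_iff_infDist_lt hne).1 hx
    have hle : δ₀ / (n + 1) ≤ δ₀ := by
      rw [div_le_iff₀ hn1]; nlinarith [Nat.cast_nonneg (α := ℝ) n]
    have hxQ : (x, w) ∈ Q := ⟨thickening_subset_cthickening _ _ (thickening_mono hle _ hx),
      mem_sphere_zero_iff_norm.2 hw1⟩
    have hnz := hn _ hxQ
    have key : 1 / ((n:ℝ) + 1) < levi ρ x w + n * ‖ell ρ x w‖ ^ 2 := by
      by_contra hc
      push Not at hc
      exact hnz ⟨hinf.le, hκ, hc⟩
    have e1 : levi ρ x v = ‖v‖ ^ 2 * levi ρ x w := by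
      conv_lhs => rw [hvw]
      rw [levi_smul]
    have e2 : ‖ell ρ x v‖ ^ 2 = ‖v‖ ^ 2 * ‖ell ρ x w‖ ^ 2 := by
      conv_lhs => rw [hvw]
      rw [← Complex.coe_smul, map_smul, norm_smul, mul_pow]; simp
    rw [e1, e2]
    have : 1 / ((n:ℝ) + 1) ≤ levi ρ x w + 8 * (n + 1) / 8 * ‖ell ρ x w‖ ^ 2 := by
      nlinarith [sq_nonneg ‖ell ρ x w‖]
    nlinarith [mul_le_mul_of_nonneg_left this (sq_nonneg ‖v‖)]

lemma exists_grad {Ω U : Set (E N)} {ρ : E N → ℝ} (hU : IsOpen U)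
    (hK : IsCompact (closure Ω)) (h2 : ContDiffOn ℝ 2 ρ U) (hsub : closure Ω ⊆ U)
    (hfr : ∀ x ∈ closure Ω, 0 ≤ ρ x → x ∈ frontier Ω)
    (hl : ∀ p ∈ frontier Ω, fderiv ℝ ρ p ≠ 0) :
    ∃ κ m : ℝ, 0 < κ ∧ 0 < m ∧ ∀ x ∈ closure Ω, -κ ≤ ρ x → m < ‖fderiv ℝ ρ x‖ := by
  obtain ⟨c1, -⟩ := continuousOn_hess hU h2
  let f : E N → ℝ × ℝ := fun x => (ρ x, ‖fderiv ℝ ρ x‖)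
  let Z : ℕ → Set (E N) := fun n =>
    f ⁻¹' (Ici (-(1 / (n + 1) : ℝ)) ×ˢ Iic (1 / (n + 1) : ℝ))
  have cf : ContinuousOn f (closure Ω) :=
    (h2.continuousOn.mono hsub).prodMk ((c1.mono hsub).norm)
  obtain ⟨n, hn⟩ := exists_nat_inter_empty hK Z
    (fun n => cf.preimage_isClosed_of_isClosed hK.isClosed
      (isClosed_Ici.prod isClosed_Iic))
    (by
      rintro n p ⟨hp, ⟨h2, h3⟩⟩
      have h4 : (1:ℝ) / (n + 1 + 1) ≤ 1 / (n + 1) := by gcongr; linarith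
      refine ⟨hp, ⟨?_, ?_⟩⟩
      · simp only [f, mem_Ici, Nat.cast_add, Nat.cast_one] at h2 ⊢
        linarith
      · simp only [f, mem_Iic, Nat.cast_add, Nat.cast_one] at h3 ⊢
        linarith)
    (by
      intro x hx hz
      have hz2 : ∀ n : ℕ, -(1 / (n + 1) : ℝ) ≤ ρ x := fun n => (hz n).1
      have hz3 : ∀ n : ℕ, ‖fderiv ℝ ρ x‖ ≤ 1 / ((n:ℝ) + 1) := fun n => (hz n).2
      have t1 : Tendsto (fun n : ℕ => 1 / ((n:ℝ) + 1)) atTop (𝓝 0) :=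
        tendsto_one_div_add_atTop_nhds_zero_nat
      have t3 : Tendsto (fun n : ℕ => -(1 / ((n:ℝ) + 1))) atTop (𝓝 0) := by
        have := t1.neg; rwa [neg_zero] at this
      have r0 : 0 ≤ ρ x := le_of_tendsto' t3 hz2
      exact hl x (hfr x hx r0) (norm_le_zero_iff.1 (ge_of_tendsto' t1 hz3)))
  refine ⟨1 / (n + 1), 1 / (n + 1), by positivity, by positivity, fun x hx hκ => ?_⟩
  by_contra hc
  push Not at hc
  exact hn x hx ⟨hκ, hc⟩

lemma near_estimates {U K : Set (E N)} {ρ : E N → ℝ} (hU : IsOpen U)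
    (h2 : ContDiffOn ℝ 2 ρ U) {δ₀ A H α : ℝ} (hα : 0 < α) (hH : 0 ≤ H) (hA : 0 ≤ A)
    (hsub : cthickening δ₀ K ⊆ U)
    (hA2 : ∀ x ∈ cthickening δ₀ K, ‖hess ρ x‖ ≤ A)
    (hHol : ∀ x ∈ U, ∀ y ∈ U, ‖hess ρ x - hess ρ y‖ ≤ H * ‖x - y‖ ^ α)
    {x y : E N} (hx : x ∈ K) (hy : ‖y - x‖ < δ₀) :
    ‖fderiv ℝ ρ y - fderiv ℝ ρ x‖ ≤ A * ‖y - x‖ ∧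
    |ρ y - ρ x - fderiv ℝ ρ x (y - x)| ≤ A * ‖y - x‖ ^ 2 ∧
    ‖fderiv ℝ ρ y - fderiv ℝ ρ x - hess ρ x (y - x)‖ ≤ H * ‖y - x‖ ^ (1 + α) := by
  have hin : ∀ z, ‖z - x‖ < δ₀ → z ∈ cthickening δ₀ K := fun z hz =>
    thickening_subset_cthickening _ _ (mem_thickening_iff.2 ⟨x, hx, by rwa [dist_eq_norm]⟩)
  have hC : ∀ z, ‖z - x‖ < δ₀ → ContDiffAt ℝ 2 ρ z := fun z hz =>
    h2.contDiffAt (hU.mem_nhds (hsub (hin z hz)))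
  have L : ∀ z, ‖z - x‖ < δ₀ → ‖fderiv ℝ ρ z - fderiv ℝ ρ x‖ ≤ A * ‖z - x‖ := by
    intro z hz
    have hb : ∀ w ∈ closedBall x ‖z - x‖, ‖w - x‖ < δ₀ := fun w hw =>
      lt_of_le_of_lt (by rw [← dist_eq_norm]; exact hw) hz
    exact (convex_closedBall x ‖z - x‖).norm_image_sub_le_of_norm_hasFDerivWithin_le
      (fun w hw => (hasFDerivAt_fderiv (hC w (hb w hw))).hasFDerivWithinAt)
      (fun w hw => hA2 w (hin w (hb w hw)))
      (mem_closedBall_self (norm_nonneg _)) (by rw [mem_closedBall, dist_eq_norm])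
  have hb : ∀ w ∈ closedBall x ‖y - x‖, ‖w - x‖ ≤ ‖y - x‖ := fun w hw => by
      rw [← dist_eq_norm]; exact hw
  refine ⟨L y hy, ?_, ?_⟩
  · have := (convex_closedBall x ‖y - x‖).norm_image_sub_le_of_norm_hasFDerivWithin_le'
      (f := ρ) (f' := fderiv ℝ ρ) (φ := fderiv ℝ ρ x) (C := A * ‖y - x‖)
      (fun w hw => ((hC w ((hb w hw).trans_lt hy)).differentiableAt
        (by norm_num)).hasFDerivAt.hasFDerivWithinAt)
      (fun w hw => (L w ((hb w hw).trans_lt hy)).trans (by have := hb w hw; gcongr))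
      (mem_closedBall_self (norm_nonneg _)) (show y ∈ closedBall x ‖y - x‖ by
        rw [mem_closedBall, dist_eq_norm])
    rw [Real.norm_eq_abs] at this
    rw [pow_two, ← mul_assoc]; exact this
  · have := (convex_closedBall x ‖y - x‖).norm_image_sub_le_of_norm_hasFDerivWithin_le'
      (f := fderiv ℝ ρ) (f' := hess ρ) (φ := hess ρ x) (C := H * ‖y - x‖ ^ α)
      (fun w hw => (hasFDerivAt_fderiv (hC w ((hb w hw).trans_lt hy))).hasFDerivWithinAt)
      (fun w hw => (hHol w (hsub (hin w ((hb w hw).trans_lt hy))) x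
        (hsub (hin x (by rw [sub_self, norm_zero]; exact (norm_nonneg _).trans_lt hy)))).trans
        (by have := hb w hw; gcongr))
      (mem_closedBall_self (norm_nonneg _)) (show y ∈ closedBall x ‖y - x‖ by
        rw [mem_closedBall, dist_eq_norm])
    refine this.trans ?_
    rcases (norm_nonneg (y - x)).eq_or_lt with h0 | h0
    · rw [← h0, mul_zero]; positivity
    · rw [Real.rpow_add h0, Real.rpow_one]
      exact le_of_eq (by ring)

set_option maxHeartbeats 1600000 in
theorem exists_geom {α : ℝ} (hα : α ∈ Set.Ioc (0:ℝ) 1) {Ω : Set (E N)}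
    (h : IsStronglyPseudoconvexDomain 2 α Ω) (hfr : (frontier Ω).Nonempty) :
    Nonempty (Geom α Ω) := by
  obtain ⟨ho, hc, hb, U, ρ, hU, hKU, ⟨h2, M0, hM0⟩, hΩ, hd, hl⟩ := h
  have hne : Ω.Nonempty := hc.nonempty
  have hK : IsCompact (closure Ω) := hb.isCompact_closure
  have h2 : ContDiffOn ℝ 2 ρ U := by exact_mod_cast h2
  obtain ⟨c1, c2⟩ := continuousOn_hess hU h2
  obtain ⟨δ₀, hδ₀, hsub⟩ := hK.exists_cthickening_subset_open hU hKU
  have hneg : ∀ x ∈ Ω, ρ x < 0 := fun x hx => by rw [hΩ] at hx; exact hx.2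
  have hnonneg : ∀ x ∈ U, x ∉ Ω → 0 ≤ ρ x := fun x hx hn => by
    by_contra hcon
    push Not at hcon
    exact hn (by rw [hΩ]; exact ⟨hx, hcon⟩)
  have hle : ∀ x ∈ closure Ω, ρ x ≤ 0 := by
    intro x hx
    have hcl : IsClosed (closure Ω ∩ ρ ⁻¹' Iic 0) :=
      (h2.continuousOn.mono hKU).preimage_isClosed_of_isClosed isClosed_closure isClosed_Iic
    have : closure Ω ⊆ closure Ω ∩ ρ ⁻¹' Iic 0 :=
      closure_minimal (fun y hy => ⟨subset_closure hy, (hneg y hy).le⟩) hcl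
    exact (this hx).2
  have hfr' : ∀ x ∈ closure Ω, 0 ≤ ρ x → x ∈ frontier Ω := by
    intro x hx h0
    refine ⟨hx, fun hi => ?_⟩
    rw [ho.interior_eq] at hi
    linarith [hneg x hi]
  have hfrK : frontier Ω ⊆ closure Ω := frontier_subset_closure
  have hfrn : ∀ x ∈ frontier Ω, x ∉ Ω := fun x hx hx' => hx.2 (by rwa [ho.interior_eq])
  obtain ⟨m, lam, κ₁, δ, hm, hlam, hκ₁, hδ, hδδ, hlevi⟩ :=
    exists_levi hU hne hK h2 hδ₀ hsub hfr' hl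
  obtain ⟨κ₂, m₂, hκ₂, hm₂, hgrad⟩ := exists_grad hU hK h2 hKU hfr' hd
  obtain ⟨A1, hA1, hA1'⟩ := exists_bound_on hK.cthickening (c1.mono hsub).norm
  have c2n : ContinuousOn (fun x => ‖hess ρ x‖) (cthickening δ₀ (closure Ω)) :=
    ContinuousOn.norm (E := E N →L[ℝ] E N →L[ℝ] ℝ) (f := hess ρ) (c2.mono hsub)
  obtain ⟨A2, hA2, hA2'⟩ := exists_bound_on hK.cthickening c2n
  simp only [norm_norm] at hA1'
  have hA2' : ∀ x ∈ cthickening δ₀ (closure Ω), ‖hess ρ x‖ ≤ A2 := fun x hx => by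
    exact (le_abs_self _).trans (hA2' x hx)
  obtain ⟨A3, hA3, hA3'⟩ := exists_bound_on hK.cthickening (h2.continuousOn.mono hsub)
  obtain ⟨A4, hA4, hA4'⟩ := exists_bound_on hK (continuousOn_id (α := E N))
  have hKc : closure Ω ⊆ cthickening δ₀ (closure Ω) := self_subset_cthickening _
  set A := A1 + A2 + A3 + A4 + 1 with hA
  set H := max M0 0 with hH
  have hHol : ∀ x ∈ U, ∀ y ∈ U, ‖hess ρ x - hess ρ y‖ ≤ H * ‖x - y‖ ^ α := fun x hx y hy =>
    (hess_sub_le ρ x y).trans ((hM0 x hx y hy).trans (by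
      have := le_max_left M0 0
      gcongr))
  have near := fun (x y : E N) (hx : x ∈ closure Ω) (hy : ‖y - x‖ < δ₀) =>
    near_estimates hU h2 hα.1 (le_max_right M0 0) (by positivity : 0 ≤ A) hsub
      (fun x hx => (hA2' x hx).trans (show A2 ≤ A by rw [hA]; linarith)) hHol hx hy
  have bD : ∀ x ∈ closure Ω, ‖fderiv ℝ ρ x‖ ≤ A := fun x hx =>
    (hA1' x (hKc hx)).trans (by rw [hA]; linarith)
  have bH : ∀ x ∈ closure Ω, ‖hess ρ x‖ ≤ A := fun x hx =>
    (hA2' x (hKc hx)).trans (by rw [hA]; linarith)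
  have br : ∀ x ∈ closure Ω, |ρ x| ≤ A := fun x hx =>
    (hA3' x (hKc hx)).trans (by rw [hA]; linarith)
  have bx : ∀ x ∈ closure Ω, ‖x‖ ≤ A := fun x hx =>
    (hA4' x hx).trans (by rw [hA]; linarith)
  have hA0 : 1 ≤ A := by rw [hA]; linarith
  have bxy : ∀ x ∈ closure Ω, ∀ y ∈ closure Ω, ‖y - x‖ ≤ 2 * A := fun x hx y hy =>
    (norm_sub_le _ _).trans (by linarith [bx x hx, bx y hy])
  set T := A + (2 * A + A * (2 * A)) / δ₀ ^ (2:ℝ) with hT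
  set L := A + (2 * A) / δ₀ ^ (1:ℝ) with hL
  set S := H + (2 * A + A * (2 * A)) / δ₀ ^ (1 + α) with hS
  have hT0 : A ≤ T := by rw [hT]; have : 0 ≤ (2 * A + A * (2 * A)) / δ₀ ^ (2:ℝ) := by positivity
                         linarith
  have hL0 : 0 ≤ L := by positivity
  have hH0 : 0 ≤ H := le_max_right _ _
  have hS0 : 0 ≤ S := by positivity
  have gD : ∀ x ∈ closure Ω, ∀ y ∈ closure Ω, |fderiv ℝ ρ x (y - x)| ≤ A * (2 * A) := by
    intro x hx y hy
    refine ((fderiv ℝ ρ x).le_opNorm _).trans ?_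
    have := bD x hx
    have := bxy x hx y hy
    gcongr
  have gT : ∀ x ∈ closure Ω, ∀ y ∈ closure Ω,
      |ρ y - ρ x - fderiv ℝ ρ x (y - x)| ≤ T * ‖y - x‖ ^ 2 := by
    intro x hx y hy
    have := two_scale (p := 2) hδ₀ (by linarith : 0 ≤ A) (by positivity : 0 ≤ 2 * A + A * (2 * A))
      (norm_nonneg (y - x)) (by norm_num) (v := |ρ y - ρ x - fderiv ℝ ρ x (y - x)|)
      (fun h => by rw [Real.rpow_two]; exact (near x y hx h).2.1) (by
        have e1 := abs_sub (ρ y - ρ x) (fderiv ℝ ρ x (y - x))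
        have e2 := abs_sub (ρ y) (ρ x)
        linarith [br x hx, br y hy, gD x hx y hy])
    rwa [Real.rpow_two (‖y - x‖)] at this
  have gL : ∀ x ∈ closure Ω, ∀ y ∈ closure Ω,
      ‖fderiv ℝ ρ y - fderiv ℝ ρ x‖ ≤ L * ‖y - x‖ := by
    intro x hx y hy
    have := two_scale (p := 1) hδ₀ (by linarith : 0 ≤ A) (by positivity : 0 ≤ 2 * A)
      (norm_nonneg (y - x)) (by norm_num) (v := ‖fderiv ℝ ρ y - fderiv ℝ ρ x‖)
      (fun h => by rw [Real.rpow_one]; exact (near x y hx h).1) (by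
        have e1 := norm_sub_le (fderiv ℝ ρ y) (fderiv ℝ ρ x)
        linarith [bD x hx, bD y hy])
    rwa [Real.rpow_one (‖y - x‖)] at this
  have gS : ∀ x ∈ closure Ω, ∀ y ∈ closure Ω,
      ‖fderiv ℝ ρ y - fderiv ℝ ρ x - hess ρ x (y - x)‖ ≤ S * ‖y - x‖ ^ (1 + α) := by
    intro x hx y hy
    exact two_scale (p := 1 + α) hδ₀ hH0 (by positivity : 0 ≤ 2 * A + A * (2 * A))
      (norm_nonneg (y - x)) (by linarith [hα.1])
      (fun h => (near x y hx h).2.2) (by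
        have e1 := norm_sub_le (fderiv ℝ ρ y - fderiv ℝ ρ x) (hess ρ x (y - x))
        have e2 := norm_sub_le (fderiv ℝ ρ y) (fderiv ℝ ρ x)
        have e3 : ‖hess ρ x (y - x)‖ ≤ A * (2 * A) := by
          refine ((hess ρ x).le_opNorm _).trans ?_
          have := bH x hx
          have := bxy x hx y hy
          gcongr
        linarith [bD x hx, bD y hy])
  have hν : ∀ x : E N, ∃ v : E N, ‖v‖ ≤ 1 / m₂ ∧ (x ∈ closure Ω → -κ₂ ≤ ρ x → ell ρ x v = 1) := by
    intro x
    by_cases hx : x ∈ closure Ω ∧ -κ₂ ≤ ρ x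
    · have hn : m₂ < ‖ell ρ x‖ := by
        have := hgrad x hx.1 hx.2
        rw [ell, StrongDual.norm_extendRCLike]; exact this
      obtain ⟨w, hw, hlw⟩ := (ell ρ x).exists_lt_apply_of_lt_opNorm hn
      have h0 : ell ρ x w ≠ 0 := by
        intro h; rw [h, norm_zero] at hlw; linarith
      refine ⟨(ell ρ x w)⁻¹ • w, ?_, fun _ _ => by rw [map_smul, smul_eq_mul, inv_mul_cancel₀ h0]⟩
      rw [norm_smul, norm_inv, inv_mul_eq_div]
      gcongr
    · exact ⟨0, by rw [norm_zero]; positivity, fun h1 h2 => absurd ⟨h1, h2⟩ hx⟩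
  choose ν hν1 hν2 using hν
  set V := 1 / m₂ with hV
  have hV0 : 0 < V := by positivity
  have low : ∀ x ∈ Ω, -ρ x ≤ (A + T * (2 * A)) * bdist Ω x := by
    intro x hx
    have hcf : IsCompact (frontier Ω) := hK.of_isClosed_subset isClosed_frontier hfrK
    obtain ⟨y, hy, hxy⟩ := hcf.exists_infDist_eq_dist hfr x
    have hy0 : ρ y = 0 := le_antisymm (hle y (hfrK hy)) (hnonneg y (hKU (hfrK hy)) (hfrn y hy))
    have e1 := (abs_le.1 (gT x (subset_closure hx) y (hfrK hy))).2
    have e2 : fderiv ℝ ρ x (y - x) ≤ A * ‖y - x‖ :=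
      (le_abs_self _).trans (((fderiv ℝ ρ x).le_opNorm _).trans (by
        have := bD x (subset_closure hx); gcongr))
    have e3 := bxy x (subset_closure hx) y (hfrK hy)
    have e4 : T * ‖y - x‖ ^ 2 ≤ T * (2 * A) * ‖y - x‖ := by
      rw [pow_two, ← mul_assoc]
      have : 0 ≤ T := by linarith
      gcongr
    have e5 : bdist Ω x = ‖y - x‖ := by rw [bdist, hxy, dist_eq_norm, norm_sub_rev]
    rw [e5]; linarith
  set κ' := min κ₂ (min (δ₀ / (4 * V)) (1 / (8 * A * V ^ 2))) with hκ'
  have hκ'0 : 0 < κ' := by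
    have hA' : 0 < A := by linarith
    rw [hκ']; refine lt_min hκ₂ (lt_min (by positivity) (by positivity))
  have high : ∀ x ∈ Ω, bdist Ω x ≤ (2 * A / κ' + 2 * V) * -ρ x := by
    intro x hx
    have hxK := subset_closure hx
    have hu0 : 0 < -ρ x := by linarith [hneg x hx]
    rcases le_or_gt κ' (-ρ x) with hu | hu
    · obtain ⟨p, hp⟩ := hfr
      have e1 : bdist Ω x ≤ 2 * A := by
        refine (infDist_le_dist_of_mem hp).trans ?_
        rw [dist_eq_norm, norm_sub_rev]
        exact bxy x hxK p (hfrK hp)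
      have e2 : 2 * A ≤ 2 * A / κ' * -ρ x := by
        rw [div_mul_eq_mul_div, le_div_iff₀ hκ'0]; gcongr
      nlinarith
    · set u := -ρ x with hu'
      have k1 : u < κ₂ := hu.trans_le (min_le_left _ _)
      have k2 : u < δ₀ / (4 * V) := hu.trans_le ((min_le_right _ _).trans (min_le_left _ _))
      have k3 : u < 1 / (8 * A * V ^ 2) := hu.trans_le ((min_le_right _ _).trans (min_le_right _ _))
      rw [lt_div_iff₀ (by positivity)] at k2 k3
      have hl1 := hν2 x hxK (by linarith)
      have hre : fderiv ℝ ρ x (ν x) = 1 := by rw [← re_ell, hl1, Complex.one_re]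
      set y := x + (2 * u) • ν x with hy
      have hyx : y - x = (2 * u) • ν x := by rw [hy]; abel
      have hnyx : ‖y - x‖ ≤ 2 * u * V := by
        rw [hyx, norm_smul, Real.norm_eq_abs, abs_of_pos (by positivity)]
        have := hν1 x; gcongr
      have hnear := (abs_le.1 (near x y hxK (by nlinarith)).2.1).1
      rw [hyx, map_smul, hre, smul_eq_mul, mul_one, ← hyx] at hnear
      have hsq : A * ‖y - x‖ ^ 2 ≤ A * (2 * u * V) ^ 2 := by gcongr
      have hpos : 0 < ρ y := by
        have : A * (2 * u * V) ^ 2 = u / 2 * (u * (8 * A * V ^ 2)) := by ring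
        nlinarith
      have hyΩ : y ∉ Ω := fun hy' => by linarith [hneg y hy']
      have := infDist_frontier_le hx ho hyΩ
      rw [dist_eq_norm, norm_sub_rev] at this
      have e2 : 0 ≤ 2 * A / κ' * u := by positivity
      rw [bdist]
      nlinarith
  set G1 := A + T * (2 * A)
  set G2 := 2 * A / κ' + 2 * V
  have hG1 : 0 ≤ G1 := by
    have : 0 ≤ T := by linarith
    positivity
  have hG2 : 0 ≤ G2 := by positivity
  have bdn : ∀ x, 0 ≤ bdist Ω x := fun x => infDist_nonneg
  have hT0' : 0 ≤ T := by linarith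
  set M := A + T + L + S + V + G1 + G2 with hM
  have mA : A ≤ M := by rw [hM]; linarith
  have mT : T ≤ M := by rw [hM]; linarith
  have mL : L ≤ M := by rw [hM]; linarith
  have mS : S ≤ M := by rw [hM]; linarith
  have mV : V ≤ M := by rw [hM]; linarith
  have mG1 : G1 ≤ M := by rw [hM]; linarith
  have mG2 : G2 ≤ M := by rw [hM]; linarith
  have hthU : ∀ x ∈ thickening δ (closure Ω), x ∈ U := fun x hx =>
    hsub (thickening_subset_cthickening _ _ (thickening_mono hδδ _ hx))
  exact ⟨{
    ρ := ρ, ν := ν, M := M, m := m, lam := lam, κ := min κ₁ κ₂, δ := δ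
    hα := hα.1, hα1 := hα.2, hM := by linarith
    hm := hm, hlam := hlam, hκ := lt_min hκ₁ hκ₂, hδ := hδ
    isOpen := ho, conn := hc, bdd := hb
    C2 := fun x hx => h2.contDiffAt (hU.mem_nhds (hthU x hx))
    neg := hneg
    inside := fun x hx h => by rw [hΩ]; exact ⟨hthU x hx, h⟩
    zero := fun x hx hn => le_antisymm (hle x hx) (hnonneg x (hKU hx) hn)
    norm_le := fun x hx => (bx x hx).trans mA
    rho_ge := fun x hx => by linarith [(abs_le.1 (br x hx)).1]
    hess_le := fun x hx => (bH x hx).trans mA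
    taylor_near := fun x hx y hy => (near x y hx (hy.trans_le hδδ)).2.1.trans (by gcongr)
    taylor := fun x hx y hy => (gT x hx y hy).trans (by gcongr)
    lip := fun x hx y hy => (gL x hx y hy).trans (by gcongr)
    holder := fun x hx y hy => (gS x hx y hy).trans (by gcongr)
    nu_le := fun x _ => (hν1 x).trans mV
    ell_nu := fun x hx h => hν2 x hx (by linarith [min_le_right κ₁ κ₂])
    levi_ge := fun x hx h => hlevi x hx (by linarith [min_le_left κ₁ κ₂])
    le_bdist := fun x hx => (low x hx).trans (by have := bdn x; gcongr)
    bdist_le := fun x hx => (high x hx).trans (by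
      have : 0 ≤ -ρ x := by linarith [hneg x hx]
      gcongr) }⟩

/-- The disc automorphism `ω ↦ (ω + z) / (1 + conj z * ω)`. -/
def mob (z ω : ℂ) : ℂ := (ω + z) / (1 + starRingEnd ℂ z * ω)

lemma mob_den_ge {z ω : ℂ} (hω : ‖ω‖ ≤ 1) :
    1 - ‖z‖ ≤ ‖1 + starRingEnd ℂ z * ω‖ := by
  have h1 : ‖starRingEnd ℂ z * ω‖ ≤ ‖z‖ := by
    rw [norm_mul, RCLike.norm_conj]; nlinarith [norm_nonneg z]
  have h2 := norm_sub_le (1 + starRingEnd ℂ z * ω) (starRingEnd ℂ z * ω)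
  rw [add_sub_cancel_right, norm_one] at h2
  linarith

lemma mob_den_ne {z ω : ℂ} (hz : ‖z‖ < 1) (hω : ‖ω‖ ≤ 1) : 1 + starRingEnd ℂ z * ω ≠ 0 := by
  intro h
  have := mob_den_ge (z := z) hω
  rw [h, norm_zero] at this
  linarith

lemma mob_zero (z : ℂ) : mob z 0 = z := by simp [mob]

lemma mob_sub {z ω : ℂ} (hz : ‖z‖ < 1) (hω : ‖ω‖ ≤ 1) :
    mob z ω - z = (1 - ‖z‖ ^ 2 : ℝ) * ω / (1 + starRingEnd ℂ z * ω) := by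
  have h := mob_den_ne hz hω
  rw [mob, eq_div_iff h, sub_mul, div_mul_cancel₀ _ h]
  push_cast
  rw [← Complex.mul_conj']
  ring

lemma one_sub_mob {z ω : ℂ} (hz : ‖z‖ < 1) (hω : ‖ω‖ ≤ 1) :
    1 - ‖mob z ω‖ ^ 2 =
      (1 - ‖z‖ ^ 2) * (1 - ‖ω‖ ^ 2) / ‖1 + starRingEnd ℂ z * ω‖ ^ 2 := by
  have h := norm_ne_zero_iff.2 (mob_den_ne hz hω)
  rw [mob, norm_div, div_pow, eq_div_iff (by positivity), sub_mul, div_mul_cancel₀ _ (by positivity)]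
  rw [← Complex.normSq_eq_norm_sq, ← Complex.normSq_eq_norm_sq, ← Complex.normSq_eq_norm_sq,
    ← Complex.normSq_eq_norm_sq]
  simp only [Complex.normSq_apply, Complex.add_re, Complex.add_im, Complex.mul_re, Complex.mul_im,
    Complex.conj_re, Complex.conj_im, Complex.one_re, Complex.one_im]
  ring

lemma norm_mob_lt {z ω : ℂ} (hz : ‖z‖ < 1) (hω : ‖ω‖ < 1) : ‖mob z ω‖ < 1 := by
  have h := one_sub_mob hz hω.le
  have h1 : 0 < ‖1 + starRingEnd ℂ z * ω‖ := norm_pos_iff.2 (mob_den_ne hz hω.le)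
  have h2 : 0 < (1 - ‖z‖ ^ 2) * (1 - ‖ω‖ ^ 2) / ‖1 + starRingEnd ℂ z * ω‖ ^ 2 := by
    have a1 : 0 < 1 - ‖z‖ ^ 2 := by nlinarith [norm_nonneg z]
    have a2 : 0 < 1 - ‖ω‖ ^ 2 := by nlinarith [norm_nonneg ω]
    positivity
  nlinarith [norm_nonneg (mob z ω)]

lemma norm_mob_eq {z ω : ℂ} (hz : ‖z‖ < 1) (hω : ‖ω‖ = 1) : ‖mob z ω‖ = 1 := by
  have h := one_sub_mob hz hω.le
  rw [hω] at h
  simp only [one_pow, sub_self, mul_zero, zero_div] at h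
  nlinarith [norm_nonneg (mob z ω)]

lemma norm_mob_le {z ω : ℂ} (hz : ‖z‖ < 1) (hω : ‖ω‖ ≤ 1) : ‖mob z ω‖ ≤ 1 := by
  rcases hω.lt_or_eq with h | h
  · exact (norm_mob_lt hz h).le
  · exact (norm_mob_eq hz h).le

lemma differentiableAt_mob {z ω : ℂ} (hz : ‖z‖ < 1) (hω : ‖ω‖ ≤ 1) :
    DifferentiableAt ℂ (mob z) ω := by
  unfold mob
  exact DifferentiableAt.div (by fun_prop) (by fun_prop) (mob_den_ne hz hω)

lemma hasDerivAt_mob_zero (z : ℂ) : HasDerivAt (mob z) (1 - ‖z‖ ^ 2 : ℝ) 0 := by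
  have h := ((hasDerivAt_id (0:ℂ)).add_const z).div
    (((hasDerivAt_id (0:ℂ)).const_mul (starRingEnd ℂ z)).const_add 1) (by simp)
  refine h.congr_deriv ?_
  simp only [id, mul_zero, add_zero, mul_one, zero_add, one_pow, div_one]
  push_cast
  rw [← Complex.mul_conj']

section
variable {α : ℝ} {Ω : Set (E N)}

namespace Geom

/-- The positive defining function. -/
def u (G : Geom α Ω) (x : E N) : ℝ := -G.ρ x

/-- A function whose compositions with holomorphic discs are subharmonic. -/
def bar (G : Geom α Ω) (c : ℝ) (x : E N) : ℝ :=
  max (Real.exp (G.lam * G.ρ x) - 1 - c * ‖x‖ ^ 2) (Real.exp (-(G.lam * G.κ)) - 1)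

variable (G : Geom α Ω)

lemma closure_sub : closure Ω ⊆ thickening G.δ (closure Ω) := self_subset_thickening G.hδ _

lemma continuousAt_rho {x : E N} (hx : x ∈ thickening G.δ (closure Ω)) : ContinuousAt G.ρ x :=
  (G.C2 x hx).continuousAt

lemma continuousOn_rho : ContinuousOn G.ρ (thickening G.δ (closure Ω)) := fun _ hx =>
  (G.continuousAt_rho hx).continuousWithinAt

lemma u_pos {x : E N} (hx : x ∈ Ω) : 0 < G.u x := neg_pos.2 (G.neg x hx)

lemma u_nonneg {x : E N} (hx : x ∈ closure Ω) : 0 ≤ G.u x := by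
  by_cases h : x ∈ Ω
  · exact (G.u_pos h).le
  · rw [u, G.zero x hx h, neg_zero]

lemma u_le {x : E N} (hx : x ∈ closure Ω) : G.u x ≤ G.M := by
  have := G.rho_ge x hx; rw [u]; linarith

lemma continuousOn_u : ContinuousOn G.u (closure Ω) :=
  (G.continuousOn_rho.mono G.closure_sub).neg

lemma M_pos : 0 < G.M := lt_of_lt_of_le one_pos G.hM

lemma dist_le {x y : E N} (hx : x ∈ closure Ω) (hy : y ∈ closure Ω) : ‖x - y‖ ≤ 2 * G.M :=
  (norm_sub_le _ _).trans (by linarith [G.norm_le x hx, G.norm_le y hy])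

/-- The threshold below which `bar` is subharmonic along discs. -/
def c₀ : ℝ := Real.exp (-(G.lam * G.κ)) * G.lam * G.m

lemma c₀_pos : 0 < G.c₀ := by have := G.hlam; have := G.hm; unfold c₀; positivity

lemma subLap_bar {c : ℝ} (hc0 : 0 ≤ c) (hc : c ≤ G.c₀) {ψ : ℂ → E N} {z : ℂ}
    (hψ : AnalyticAt ℂ ψ z) (hz : ψ z ∈ thickening G.δ (closure Ω)) :
    SubLap (fun ξ => G.bar c (ψ ξ)) z := by
  refine SubLap.max (w := fun ξ => Real.exp (G.lam * G.ρ (ψ ξ)) - 1 - c * ‖ψ ξ‖ ^ 2)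
    (v := fun _ => Real.exp (-(G.lam * G.κ)) - 1) (fun h => ?_) (fun _ => subLap_const _ _)
  have hκ : -G.κ ≤ G.ρ (ψ z) := by
    have h1 : Real.exp (-(G.lam * G.κ)) ≤ Real.exp (G.lam * G.ρ (ψ z)) := by
      have : 0 ≤ c * ‖ψ z‖ ^ 2 := by positivity
      linarith
    rw [Real.exp_le_exp] at h1
    have := G.hlam
    nlinarith
  have key := subLap_exp_comp hψ (G.C2 _ hz) G.hlam (c := c) ?_
  · refine (key.add (subLap_const (-1) z)).congr ?_
    filter_upwards with ξ
    ring
  · have h1 := G.levi_ge _ hz hκ (deriv ψ z)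
    have h2 : Real.exp (-(G.lam * G.κ)) ≤ Real.exp (G.lam * G.ρ (ψ z)) := by
      rw [Real.exp_le_exp]; have := G.hlam; nlinarith
    have := G.hlam; have := G.hm
    calc c * ‖deriv ψ z‖ ^ 2 ≤ G.c₀ * ‖deriv ψ z‖ ^ 2 := by gcongr
      _ = Real.exp (-(G.lam * G.κ)) * G.lam * (G.m * ‖deriv ψ z‖ ^ 2) := by unfold c₀; ring
      _ ≤ _ := by gcongr

lemma continuousOn_bar (c : ℝ) : ContinuousOn (G.bar c) (thickening G.δ (closure Ω)) := by
  have := G.continuousOn_rho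
  unfold bar
  refine ContinuousOn.sup ?_ continuousOn_const
  refine ((this.const_mul _).rexp.sub continuousOn_const).sub ?_
  fun_prop

lemma bar_ge (c : ℝ) (x : E N) : -(G.lam * G.u x) - c * ‖x‖ ^ 2 ≤ G.bar c x := by
  refine le_trans ?_ (le_max_left _ _)
  have := Real.add_one_le_exp (G.lam * G.ρ x)
  rw [u]; linarith

/-- The constants in the upper bound for `bar`. -/
lemma exists_bar_le : ∃ c a : ℝ, 0 < c ∧ 0 < a ∧ c ≤ G.c₀ ∧
    ∀ x ∈ closure Ω, G.bar c x ≤ -(a * G.u x + c * ‖x‖ ^ 2) ∧ G.bar 0 x ≤ -(a * G.u x) := by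
  have hl := G.hlam; have hk := G.hκ; have hM := G.M_pos
  set b := 1 - Real.exp (-(G.lam * G.κ)) with hb
  have hb0 : 0 < b := by
    rw [hb, sub_pos, Real.exp_lt_one_iff]; have := mul_pos hl hk; linarith
  refine ⟨min G.c₀ (b / (2 * G.M ^ 2)), min (G.lam * Real.exp (-(G.lam * G.M))) (b / (2 * G.M)),
    lt_min G.c₀_pos (by positivity), lt_min (by positivity) (by positivity), min_le_left _ _, ?_⟩
  intro x hx
  set c := min G.c₀ (b / (2 * G.M ^ 2))
  set a := min (G.lam * Real.exp (-(G.lam * G.M))) (b / (2 * G.M))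
  have hc0 : 0 ≤ c := (lt_min G.c₀_pos (by positivity)).le
  have ha0 : 0 ≤ a := le_min (by positivity) (by positivity)
  have hu := G.u_le hx
  have hu0 := G.u_nonneg hx
  have h1 : a * G.u x ≤ b / 2 := by
    calc a * G.u x ≤ b / (2 * G.M) * G.M := by gcongr; exact min_le_right _ _
      _ = b / 2 := by field_simp
  have h2 : c * ‖x‖ ^ 2 ≤ b / 2 := by
    have := G.norm_le x hx
    calc c * ‖x‖ ^ 2 ≤ b / (2 * G.M ^ 2) * G.M ^ 2 := by gcongr; exact min_le_right _ _
      _ = b / 2 := by field_simp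
  have h3 : Real.exp (G.lam * G.ρ x) - 1 ≤ -(a * G.u x) := by
    have e1 := Real.add_one_le_exp (G.lam * G.u x)
    have e2 : Real.exp (G.lam * G.ρ x) * Real.exp (G.lam * G.u x) = 1 := by
      rw [← Real.exp_add, u]; simp
    have e3 : Real.exp (-(G.lam * G.M)) ≤ Real.exp (G.lam * G.ρ x) := by
      rw [Real.exp_le_exp]; have := G.rho_ge x hx; nlinarith
    have e4 : a ≤ G.lam * Real.exp (G.lam * G.ρ x) := (min_le_left _ _).trans (by gcongr)
    have e5 := Real.exp_pos (G.lam * G.ρ x)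
    have e6 : a * G.u x ≤ G.lam * Real.exp (G.lam * G.ρ x) * G.u x := by gcongr
    nlinarith
  constructor
  · exact max_le (by linarith) (by linarith)
  · exact max_le (by linarith) (by linarith)

end Geom

/-- The integral of `‖g‖` is controlled by that of `‖g‖ ^ 2`. -/
lemma integral_circ_norm_le {F : Type*} [NormedAddCommGroup F] {g : ℂ → F}
    (hg : ContinuousOn g (sphere (0:ℂ) 1)) {s A : ℝ} (hs : 0 < s)
    (h : ∫ ω, ‖g ω‖ ^ 2 ∂circ ≤ A * s ^ 2) : ∫ ω, ‖g ω‖ ∂circ ≤ (A + 1) / 2 * s := by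
  have h1 : ∫ ω, ‖g ω‖ ∂circ ≤ ∫ ω, (‖g ω‖ ^ 2 * (1 / (2 * s)) + s / 2) ∂circ := by
    refine integral_circ_mono hg.norm ?_ fun ω _ => ?_
    · exact ((hg.norm.pow 2).mul continuousOn_const).add continuousOn_const
    · have : 0 ≤ (‖g ω‖ - s) ^ 2 / (2 * s) := by positivity
      have e : (‖g ω‖ - s) ^ 2 / (2 * s) = ‖g ω‖ ^ 2 * (1 / (2 * s)) + s / 2 - ‖g ω‖ := by
        field_simp; ring
      linarith
  have hi : Integrable (fun ω => ‖g ω‖ ^ 2 * (1 / (2 * s))) circ :=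
    integrable_circ ((hg.norm.pow 2).mul continuousOn_const)
  rw [integral_add hi (integrable_const _), integral_mul_const, integral_circ_const] at h1
  have h2 : (∫ ω, ‖g ω‖ ^ 2 ∂circ) * (1 / (2 * s)) ≤ A * s ^ 2 * (1 / (2 * s)) := by gcongr
  have h3 : A * s ^ 2 * (1 / (2 * s)) = A / 2 * s := by field_simp
  linarith

lemma integral_circ_deriv {F : Type*} [NormedAddCommGroup F] [NormedSpace ℂ F] [CompleteSpace F]
    {f : ℂ → F} (hf : DiffContOnCl ℂ f (ball 0 1)) :
    ∫ ω, starRingEnd ℂ ω • (f ω - f 0) ∂circ = deriv f 0 := by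
  have hd : DiffContOnCl ℂ (dslope f 0) (ball 0 1) := by
    refine ⟨(Complex.differentiableOn_dslope (ball_mem_nhds 0 one_pos)).2 hf.differentiableOn, ?_⟩
    rw [closure_ball _ one_ne_zero]
    exact (continuousOn_dslope (closedBall_mem_nhds 0 one_pos)).2 ⟨hf.continuousOn_ball,
      hf.differentiableAt isOpen_ball (mem_ball_self one_pos)⟩
  have h := hd.integral_circ
  rw [dslope_same] at h
  rw [← h]
  refine integral_circ_congr fun ω hω => ?_
  have h0 : ω ≠ 0 := by intro h0; rw [h0, norm_zero] at hω; norm_num at hω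
  rw [dslope_of_ne _ h0, slope_def_module, sub_zero, Complex.inv_def, Complex.normSq_eq_norm_sq, hω]
  simp

lemma integral_circ_mul_self {F : Type*} [NormedAddCommGroup F] [NormedSpace ℂ F] [CompleteSpace F]
    {f : ℂ → F} (hf : DiffContOnCl ℂ f (ball 0 1)) : ∫ ω, ω • f ω ∂circ = 0 := by
  have h := (DiffContOnCl.smul (f := f) (𝕜 := ℂ) (c := fun ω => ω)
    differentiable_id.diffContOnCl hf).integral_circ
  simpa using h

/-- The derivative at the origin is controlled by the real part. -/
lemma norm_deriv_le_integral_re {h : ℂ → ℂ} (hh : DiffContOnCl ℂ h (ball 0 1)) (h0 : h 0 = 0) :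
    ‖deriv h 0‖ ≤ 2 * ∫ ω, |(h ω).re| ∂circ := by
  have hc : ContinuousOn h (sphere (0:ℂ) 1) := hh.continuousOn_ball.mono sphere_subset_closedBall
  have cc : ContinuousOn (starRingEnd ℂ) (sphere (0:ℂ) 1) := Complex.continuous_conj.continuousOn
  have h1 := integral_circ_deriv hh
  have h2 : ∫ ω, starRingEnd ℂ ω * starRingEnd ℂ (h ω) ∂circ = 0 := by
    have := integral_circ_mul_self hh
    have h3 := congrArg (starRingEnd ℂ) this
    rw [← integral_conj] at h3
    simpa using h3
  have h4 : deriv h 0 = ∫ ω, starRingEnd ℂ ω * (2 * (h ω).re : ℝ) ∂circ := by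
    simp only [h0, sub_zero] at h1
    rw [← h1, ← add_zero (∫ ω, starRingEnd ℂ ω • h ω ∂circ), ← h2, ← integral_add]
    · refine integral_circ_congr fun ω _ => ?_
      rw [smul_eq_mul, ← mul_add, Complex.add_conj]
    · exact integrable_circ (cc.smul hc)
    · exact integrable_circ (cc.mul (Complex.continuous_conj.comp_continuousOn hc))
  rw [h4, ← integral_const_mul]
  refine (norm_integral_le_integral_norm _).trans (integral_circ_mono ?_ ?_ fun ω hω => ?_)
  · refine (cc.mul (Complex.continuous_ofReal.comp_continuousOn (continuousOn_const.mul ?_))).norm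
    exact Complex.continuous_re.comp_continuousOn hc
  · exact continuousOn_const.mul (Complex.continuous_re.comp_continuousOn hc).abs
  · rw [norm_mul, RCLike.norm_conj, hω, one_mul, Complex.norm_real, Real.norm_eq_abs, abs_mul]
    simp


lemma DiffContOnCl.continuousOn_sphere {F : Type*} [NormedAddCommGroup F] [NormedSpace ℂ F]
    {f : ℂ → F} (hf : DiffContOnCl ℂ f (ball 0 1)) : ContinuousOn f (sphere (0:ℂ) 1) :=
  hf.continuousOn_ball.mono sphere_subset_closedBall

lemma mapsTo_closedBall {f : ℂ → E N} (hf : DiffContOnCl ℂ f (ball 0 1))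
    (hm : MapsTo f (ball (0:ℂ) 1) Ω) : MapsTo f (closedBall (0:ℂ) 1) (closure Ω) := by
  have := hm.closure_of_continuousOn hf.continuousOn
  rwa [closure_ball _ one_ne_zero] at this

lemma integral_circ_norm_sq {f : ℂ → E N} (hf : DiffContOnCl ℂ f (ball 0 1)) :
    ∫ ω, ‖f ω‖ ^ 2 ∂circ = ‖f 0‖ ^ 2 + ∫ ω, ‖f ω - f 0‖ ^ 2 ∂circ := by
  have hX : DiffContOnCl ℂ (fun ω => f ω - f 0) (ball 0 1) := hf.sub_const _
  have hi : DiffContOnCl ℂ (fun ω => innerSL ℂ (f 0) (f ω - f 0)) (ball 0 1) :=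
    (innerSL ℂ (f 0)).differentiable.comp_diffContOnCl hX
  have h0 := congrArg Complex.re hi.integral_circ
  have cX := DiffContOnCl.continuousOn_sphere hX
  have ci := DiffContOnCl.continuousOn_sphere hi
  have e1 : ∫ ω, (innerSL ℂ (f 0) (f ω - f 0)).re ∂circ = 0 := by
    have := integral_re (integrable_circ ci)
    simp only [RCLike.re_eq_complex_re] at this
    rw [this, h0]; simp
  have i1 : Integrable (fun ω => ‖f ω - f 0‖ ^ 2) circ := integrable_circ (cX.norm.pow 2)
  have i2 : Integrable (fun ω => 2 * (innerSL ℂ (f 0) (f ω - f 0)).re) circ :=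
    integrable_circ (continuousOn_const.mul (Complex.continuous_re.comp_continuousOn ci))
  have e2 : ∫ ω, ‖f ω‖ ^ 2 ∂circ = ∫ ω, (‖f 0‖ ^ 2 +
      2 * (innerSL ℂ (f 0) (f ω - f 0)).re + ‖f ω - f 0‖ ^ 2) ∂circ := by
    refine integral_circ_congr fun ω _ => ?_
    have := norm_add_sq (𝕜 := ℂ) (f 0) (f ω - f 0)
    rw [add_sub_cancel] at this
    rw [this]; rfl
  have i3 : Integrable (fun ω => ‖f 0‖ ^ 2 + 2 * (innerSL ℂ (f 0) (f ω - f 0)).re) circ :=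
    (integrable_const _).add i2
  rw [e2, integral_add i3 i1, integral_add (integrable_const _) i2,
    integral_const_mul, e1, integral_circ_const]
  ring

namespace Geom
variable (G : Geom α Ω)

theorem exists_mean_estimate : ∃ C : ℝ, 1 ≤ C ∧ ∀ f : ℂ → E N, DiffContOnCl ℂ f (ball 0 1) →
    MapsTo f (ball (0:ℂ) 1) Ω →
    ∫ ω, G.u (f ω) ∂circ ≤ C * G.u (f 0) ∧ ∫ ω, ‖f ω - f 0‖ ^ 2 ∂circ ≤ C * G.u (f 0) := by
  obtain ⟨c, a, hc, ha, hcc, hbar⟩ := G.exists_bar_le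
  have hl := G.hlam
  refine ⟨1 + G.lam / a + G.lam / c, by have : 0 ≤ G.lam / a + G.lam / c := by positivity
                                        linarith, fun f hf hm => ?_⟩
  have hmc := mapsTo_closedBall hf hm
  have hcl : MapsTo f (closedBall (0:ℂ) 1) (thickening G.δ (closure Ω)) := fun z hz =>
    G.closure_sub (hmc hz)
  have hsp : MapsTo f (sphere (0:ℂ) 1) (closure Ω) := fun z hz => hmc (sphere_subset_closedBall hz)
  have cb : ContinuousOn (fun ξ => G.bar c (f ξ)) (closedBall (0:ℂ) 1) :=
    (G.continuousOn_bar c).comp hf.continuousOn_ball hcl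
  have h1 := sub_mean cb (fun z hz => G.subLap_bar hc.le hcc
    (hf.differentiableOn.analyticAt (isOpen_ball.mem_nhds hz)) (hcl (ball_subset_closedBall hz)))
  have cf := DiffContOnCl.continuousOn_sphere hf
  have cu : ContinuousOn (fun ω => G.u (f ω)) (sphere (0:ℂ) 1) := G.continuousOn_u.comp cf hsp
  have h2 : ∫ ω, G.bar c (f ω) ∂circ ≤ ∫ ω, -(a * G.u (f ω) + c * ‖f ω‖ ^ 2) ∂circ := by
    refine integral_circ_mono (cb.mono sphere_subset_closedBall)
      ((cu.const_mul a).add ((cf.norm.pow 2).const_mul c)).neg fun ω hω => ?_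
    exact (hbar _ (hsp (by simpa using hω))).1
  have i1 : Integrable (fun ω => a * G.u (f ω)) circ := integrable_circ (cu.const_mul a)
  have i2 : Integrable (fun ω => c * ‖f ω‖ ^ 2) circ :=
    integrable_circ ((cf.norm.pow 2).const_mul c)
  rw [integral_neg, integral_add i1 i2, integral_const_mul, integral_const_mul,
    integral_circ_norm_sq hf] at h2
  have h3 := G.bar_ge c (f 0)
  have n1 : 0 ≤ ∫ ω, G.u (f ω) ∂circ := by
    rw [← integral_circ_const (0:ℝ)]
    exact integral_circ_mono continuousOn_const cu fun ω hω => G.u_nonneg (hsp (by simpa using hω))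
  have n2 : 0 ≤ ∫ ω, ‖f ω - f 0‖ ^ 2 ∂circ := integral_nonneg fun _ => by positivity
  have n3 := G.u_pos (hm (mem_ball_self one_pos))
  have key : a * ∫ ω, G.u (f ω) ∂circ + c * ∫ ω, ‖f ω - f 0‖ ^ 2 ∂circ ≤ G.lam * G.u (f 0) := by
    nlinarith
  have b1 : 0 ≤ G.lam / a := by positivity
  have b2 : 0 ≤ G.lam / c := by positivity
  constructor
  · have : ∫ ω, G.u (f ω) ∂circ ≤ G.lam / a * G.u (f 0) := by
      rw [div_mul_eq_mul_div, le_div_iff₀ ha]; nlinarith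
    nlinarith
  · have : ∫ ω, ‖f ω - f 0‖ ^ 2 ∂circ ≤ G.lam / c * G.u (f 0) := by
      rw [div_mul_eq_mul_div, le_div_iff₀ hc]; nlinarith
    nlinarith

theorem exists_deriv_zero_estimate : ∃ C : ℝ, 1 ≤ C ∧ ∀ f : ℂ → E N, DiffContOnCl ℂ f (ball 0 1) →
    MapsTo f (ball (0:ℂ) 1) Ω →
    ‖deriv f 0‖ ≤ C * √(G.u (f 0)) ∧ ‖ell G.ρ (f 0) (deriv f 0)‖ ≤ C * G.u (f 0) := by
  obtain ⟨C, hC, H⟩ := G.exists_mean_estimate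
  have hM := G.hM
  refine ⟨2 * (C + 1 + G.M * C), by nlinarith, fun f hf hm => ?_⟩
  obtain ⟨h1, h2⟩ := H f hf hm
  have n3 := G.u_pos (hm (mem_ball_self one_pos))
  have cf := DiffContOnCl.continuousOn_sphere hf
  have cX : ContinuousOn (fun ω => f ω - f 0) (sphere (0:ℂ) 1) := cf.sub continuousOn_const
  have hmc := mapsTo_closedBall hf hm
  have hsp : MapsTo f (sphere (0:ℂ) 1) (closure Ω) := fun z hz => hmc (sphere_subset_closedBall hz)
  have h0 : f 0 ∈ closure Ω := subset_closure (hm (mem_ball_self one_pos))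
  constructor
  · have e1 := integral_circ_norm_le cX (Real.sqrt_pos.2 n3) (A := C) (by rwa [Real.sq_sqrt n3.le])
    rw [← integral_circ_deriv hf]
    refine (norm_integral_le_integral_norm _).trans ?_
    have e2 : ∫ ω, ‖starRingEnd ℂ ω • (f ω - f 0)‖ ∂circ = ∫ ω, ‖f ω - f 0‖ ∂circ :=
      integral_circ_congr fun ω hω => by rw [norm_smul, RCLike.norm_conj, hω, one_mul]
    rw [e2]
    refine e1.trans ?_
    gcongr
    nlinarith
  · set h : ℂ → ℂ := fun ω => ell G.ρ (f 0) (f ω - f 0) with hh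
    have hd : DiffContOnCl ℂ h (ball 0 1) :=
      (ell G.ρ (f 0)).differentiable.comp_diffContOnCl (hf.sub_const _)
    have e1 := norm_deriv_le_integral_re hd (by simp [hh])
    have e2 : deriv h 0 = ell G.ρ (f 0) (deriv f 0) := by
      have := (hf.differentiableAt isOpen_ball (mem_ball_self one_pos)).hasDerivAt.sub_const (f 0)
      exact ((ell G.ρ (f 0)).hasFDerivAt.comp_hasDerivAt (0:ℂ) this).deriv
    rw [← e2]
    have ch := DiffContOnCl.continuousOn_sphere hd
    have cu : ContinuousOn (fun ω => G.u (f ω)) (sphere (0:ℂ) 1) := G.continuousOn_u.comp cf hsp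
    have e3 : ∫ ω, |(h ω).re| ∂circ ≤
        ∫ ω, (G.u (f ω) + G.u (f 0) + G.M * ‖f ω - f 0‖ ^ 2) ∂circ := by
      refine integral_circ_mono (Complex.continuous_re.comp_continuousOn ch).abs
        ((cu.add continuousOn_const).add ((cX.norm.pow 2).const_mul _)) fun ω hω => ?_
      have hω' : f ω ∈ closure Ω := hsp (by simpa using hω)
      have t := abs_le.1 (G.taylor _ h0 _ hω')
      have r : (h ω).re = fderiv ℝ G.ρ (f 0) (f ω - f 0) := re_ell _ _ _
      have p1 := G.u_nonneg hω'
      rw [r, abs_le]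
      simp only [u] at p1 n3 ⊢
      constructor <;> linarith
    have i1 : Integrable (fun ω => G.u (f ω)) circ := integrable_circ cu
    have i2 : Integrable (fun ω => G.M * ‖f ω - f 0‖ ^ 2) circ :=
      integrable_circ ((cX.norm.pow 2).const_mul _)
    have i3 : Integrable (fun ω => G.u (f ω) + G.u (f 0)) circ := i1.add (integrable_const _)
    rw [integral_add i3 i2, integral_add i1 (integrable_const _),
      integral_const_mul, integral_circ_const] at e3
    have : G.M * ∫ ω, ‖f ω - f 0‖ ^ 2 ∂circ ≤ G.M * (C * G.u (f 0)) := by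
      have := G.M_pos; gcongr
    nlinarith

end Geom

/-- The disc `φ` recentred at `z` and shrunk by `R`. -/
lemma recentre_props {φ : ℂ → E N} (hφ : DifferentiableOn ℂ φ (ball 0 1))
    (hm : MapsTo φ (ball (0:ℂ) 1) Ω) {z : ℂ} (hz : ‖z‖ < 1) {R : ℝ} (hR : 0 < R) (hR1 : R < 1) :
    DiffContOnCl ℂ (fun ω => φ (mob z (R * ω))) (ball 0 1) ∧
    (∀ ω ∈ closedBall (0:ℂ) 1, φ (mob z (R * ω)) ∈ Ω) ∧
    HasDerivAt (fun ω => φ (mob z (R * ω))) (((1 - ‖z‖ ^ 2) * R : ℝ) • deriv φ z) 0 := by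
  have hlt : ∀ ω : ℂ, ‖ω‖ ≤ 1 → ‖(R:ℂ) * ω‖ < 1 := fun ω hω => by
    rw [norm_mul, Complex.norm_real, Real.norm_eq_abs, abs_of_pos hR]; nlinarith [norm_nonneg ω]
  have hin : ∀ ω : ℂ, ‖ω‖ ≤ 1 → mob z (R * ω) ∈ ball (0:ℂ) 1 := fun ω hω => by
    rw [mem_ball_zero_iff]; exact norm_mob_lt hz (hlt ω hω)
  have hd : ∀ ω : ℂ, ‖ω‖ ≤ 1 → DifferentiableAt ℂ (fun ω => φ (mob z (R * ω))) ω := fun ω hω => by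
    have d1 : DifferentiableAt ℂ (fun ω : ℂ => mob z (R * ω)) ω :=
      DifferentiableAt.comp ω (differentiableAt_mob hz (hlt ω hω).le) (by fun_prop)
    exact DifferentiableAt.comp ω (hφ.differentiableAt (isOpen_ball.mem_nhds (hin ω hω))) d1
  refine ⟨?_, fun ω hω => hm (hin ω (by simpa using hω)), ?_⟩
  · refine ⟨fun ω hω => (hd ω (by have := mem_ball_zero_iff.1 hω; exact this.le)).differentiableWithinAt, ?_⟩
    rw [closure_ball _ one_ne_zero]
    exact fun ω hω => (hd ω (by simpa using hω)).continuousAt.continuousWithinAt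
  · have h1 : HasDerivAt (fun ω : ℂ => (R:ℂ) * ω) R 0 := by
      simpa using (hasDerivAt_id (0:ℂ)).const_mul (R:ℂ)
    have h2 : HasDerivAt (mob z) (1 - ‖z‖ ^ 2 : ℝ) ((R:ℂ) * 0) := by
      rw [mul_zero]; exact hasDerivAt_mob_zero z
    have h3 := h2.comp (0:ℂ) h1
    have h4 : HasDerivAt φ (deriv φ z) (mob z ((R:ℂ) * 0)) := by
      rw [mul_zero, mob_zero]
      exact (hφ.differentiableAt (isOpen_ball.mem_nhds (by simpa using hz))).hasDerivAt
    have h5 := h4.scomp (0:ℂ) h3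
    rw [← Complex.ofReal_mul] at h5
    exact h5

theorem Geom.exists_deriv_estimate (G : Geom α Ω) : ∃ C : ℝ, 1 ≤ C ∧ ∀ φ : ℂ → E N,
    DifferentiableOn ℂ φ (ball 0 1) → MapsTo φ (ball (0:ℂ) 1) Ω → ∀ z : ℂ, ‖z‖ < 1 →
    (1 - ‖z‖) * ‖deriv φ z‖ ≤ C * √(G.u (φ z)) ∧
    (1 - ‖z‖) * ‖ell G.ρ (φ z) (deriv φ z)‖ ≤ C * G.u (φ z) := by
  obtain ⟨C, hC, H⟩ := G.exists_deriv_zero_estimate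
  refine ⟨C, hC, fun φ hφ hm z hz => ?_⟩
  have lim : ∀ a b : ℝ, 0 ≤ a → (∀ R, 0 < R → R < 1 → ((1 - ‖z‖ ^ 2) * R) * a ≤ b) →
      (1 - ‖z‖) * a ≤ b := by
    intro a b ha h
    have h1 : Tendsto (fun R : ℝ => ((1 - ‖z‖ ^ 2) * R) * a) (𝓝[<] 1)
        (𝓝 (((1 - ‖z‖ ^ 2) * 1) * a)) := by
      apply tendsto_nhdsWithin_of_tendsto_nhds
      exact Continuous.tendsto (by fun_prop) 1
    have h2 := le_of_tendsto h1 (b := b) (by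
      filter_upwards [Ioo_mem_nhdsLT (zero_lt_one (α := ℝ))] with R hR using h R hR.1 hR.2)
    refine le_trans ?_ h2
    have := norm_nonneg z
    gcongr
    nlinarith
  have hz2 : 0 ≤ 1 - ‖z‖ ^ 2 := by nlinarith [norm_nonneg z]
  constructor
  · refine lim _ _ (norm_nonneg _) fun R h0 h1 => ?_
    obtain ⟨p1, p2, p3⟩ := recentre_props hφ hm hz h0 h1
    have := (H _ p1 fun ω hω => p2 ω (ball_subset_closedBall hω)).1
    rwa [p3.deriv, mul_zero, mob_zero, norm_smul, Real.norm_eq_abs,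
      abs_of_nonneg (by positivity)] at this
  · refine lim _ _ (norm_nonneg _) fun R h0 h1 => ?_
    obtain ⟨p1, p2, p3⟩ := recentre_props hφ hm hz h0 h1
    have := (H _ p1 fun ω hω => p2 ω (ball_subset_closedBall hω)).2
    rwa [p3.deriv, mul_zero, mob_zero, ← Complex.coe_smul, map_smul, norm_smul, Complex.norm_real,
      Real.norm_eq_abs, abs_of_nonneg (by positivity)] at this


lemma artanh_mono {x y : ℝ} (hx : 0 ≤ x) (hxy : x ≤ y) (hy : y < 1) : artanh x ≤ artanh y := by
  unfold artanh
  have h1 : (1 + x) / (1 - x) ≤ (1 + y) / (1 - y) := by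
    rw [div_le_div_iff₀ (by linarith) (by linarith)]; nlinarith
  have h2 : 0 < (1 + x) / (1 - x) := div_pos (by linarith) (by linarith)
  have := Real.log_le_log h2 h1
  linarith

lemma artanh_zero : artanh 0 = 0 := by simp [artanh]

lemma artanh_nonneg {x : ℝ} (hx : 0 ≤ x) (hy : x < 1) : 0 ≤ artanh x := by
  rw [← artanh_zero]; exact artanh_mono le_rfl hx hy

lemma artanh_strictMono {x y : ℝ} (hx : 0 ≤ x) (hxy : x < y) (hy : y < 1) :
    artanh x < artanh y := by
  unfold artanh
  have h1 : (1 + x) / (1 - x) < (1 + y) / (1 - y) := by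
    rw [div_lt_div_iff₀ (by linarith) (by linarith)]; nlinarith
  have h2 : 0 < (1 + x) / (1 - x) := div_pos (by linarith) (by linarith)
  have := Real.log_lt_log h2 h1
  linarith

/-- The radii of the discs competing in the Lempert function. -/
def discRadii (Ω : Set (E N)) (z w : E N) : Set ℝ :=
  { r : ℝ | ∃ φ : ℂ → E N, DifferentiableOn ℂ φ (ball 0 1) ∧
    MapsTo φ (ball (0:ℂ) 1) Ω ∧ φ 0 = z ∧ ∃ a ∈ ball (0:ℂ) 1, φ a = w ∧ r = ‖a‖ }

lemma lempert_eq (Ω : Set (E N)) (z w : E N) : lempert Ω z w = artanh (sInf (discRadii Ω z w)) := rfl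

lemma discRadii_bdd (z w : E N) : ∀ r ∈ discRadii Ω z w, 0 ≤ r ∧ r < 1 := by
  rintro r ⟨φ, -, -, -, a, ha, -, rfl⟩
  exact ⟨norm_nonneg _, by simpa using ha⟩

lemma discRadii_bddBelow (z w : E N) : BddBelow (discRadii Ω z w) :=
  ⟨0, fun r hr => (discRadii_bdd z w r hr).1⟩

lemma sInf_discRadii_mem (z w : E N) :
    0 ≤ sInf (discRadii Ω z w) ∧ sInf (discRadii Ω z w) < 1 := by
  refine ⟨Real.sInf_nonneg fun r hr => (discRadii_bdd z w r hr).1, ?_⟩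
  rcases (discRadii Ω z w).eq_empty_or_nonempty with h | ⟨r, hr⟩
  · rw [h, Real.sInf_empty]; exact one_pos
  · exact (csInf_le (discRadii_bddBelow z w) hr).trans_lt (discRadii_bdd z w r hr).2

lemma lempert_nonneg (z w : E N) : 0 ≤ lempert Ω z w := by
  rw [lempert_eq]
  exact artanh_nonneg (sInf_discRadii_mem z w).1 (sInf_discRadii_mem z w).2

lemma lempert_le {φ : ℂ → E N} (hφ : DifferentiableOn ℂ φ (ball 0 1))
    (hm : MapsTo φ (ball (0:ℂ) 1) Ω) {a : ℂ} (ha : ‖a‖ < 1) :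
    lempert Ω (φ 0) (φ a) ≤ artanh ‖a‖ := by
  rw [lempert_eq]
  refine artanh_mono (sInf_discRadii_mem _ _).1 ?_ ha
  exact csInf_le (discRadii_bddBelow _ _) ⟨φ, hφ, hm, rfl, a, by simpa using ha, rfl, rfl⟩

lemma mob_neg_mob {z ω : ℂ} (hz : ‖z‖ < 1) (hω : ‖ω‖ < 1) : mob z (mob (-z) ω) = ω := by
  have h1 : 1 + starRingEnd ℂ (-z) * ω ≠ 0 := mob_den_ne (by rwa [norm_neg]) hω.le
  have h2 : 1 + starRingEnd ℂ z * mob (-z) ω ≠ 0 :=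
    mob_den_ne hz (norm_mob_lt (by rwa [norm_neg]) hω).le
  rw [mob, div_eq_iff h2]
  rw [mob]
  have h3 : mob (-z) ω * (1 + starRingEnd ℂ (-z) * ω) = ω + -z := by
    rw [mob, div_mul_cancel₀ _ h1]
  apply mul_right_cancel₀ h1
  have : (ω + -z) / (1 + starRingEnd ℂ (-z) * ω) * (1 + starRingEnd ℂ (-z) * ω) = ω + -z :=
    div_mul_cancel₀ _ h1
  rw [add_mul, this, mul_assoc ω, add_mul 1, mul_assoc (starRingEnd ℂ z), this, map_neg]
  ring

lemma differentiableOn_comp_mob {F : Type*} [NormedAddCommGroup F] [NormedSpace ℂ F]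
    {φ : ℂ → F} (hφ : DifferentiableOn ℂ φ (ball 0 1)) {z : ℂ}
    (hz : ‖z‖ < 1) : DifferentiableOn ℂ (fun ω => φ (mob z ω)) (ball 0 1) :=
  hφ.comp (fun ω hω => (differentiableAt_mob hz
    (by have := mem_ball_zero_iff.1 hω; exact this.le)).differentiableWithinAt)
    fun ω hω => by
      rw [mem_ball_zero_iff] at hω ⊢
      exact norm_mob_lt hz hω

lemma lempert_le_poincare {φ : ℂ → E N} (hφ : DifferentiableOn ℂ φ (ball 0 1))
    (hm : MapsTo φ (ball (0:ℂ) 1) Ω) {a b : ℂ} (ha : ‖a‖ < 1) (hb : ‖b‖ < 1) :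
    lempert Ω (φ a) (φ b) ≤ poincare a b := by
  have hna : ‖-a‖ < 1 := by rwa [norm_neg]
  have h := lempert_le (differentiableOn_comp_mob hφ ha)
    (fun ω hω => hm (by
      rw [mem_ball_zero_iff] at hω ⊢
      exact norm_mob_lt ha hω)) (norm_mob_lt hna hb)
  rw [mob_zero, mob_neg_mob ha hb] at h
  refine h.trans (le_of_eq ?_)
  rw [poincare, mob, ← norm_neg]
  congr 2
  rw [map_neg, ← neg_div]
  congr 1 <;> ring

/-- `y` is joined to `x` by a chain of discs of total length at most `r`. -/
inductive Reach (Ω : Set (E N)) (x : E N) : E N → ℝ → Prop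
  | refl {r : ℝ} (hx : x ∈ Ω) (hr : 0 ≤ r) : Reach Ω x x r
  | step {y z : E N} {r s : ℝ} (h : Reach Ω x y r) (hz : z ∈ Ω) (hs : r + lempert Ω y z ≤ s) :
      Reach Ω x z s

lemma Reach.mono {x y : E N} {r s : ℝ} (h : Reach Ω x y r) (hrs : r ≤ s) : Reach Ω x y s := by
  cases h with
  | refl hx hr => exact .refl hx (hr.trans hrs)
  | step h hz hs => exact .step h hz (hs.trans hrs)

lemma Reach.trans {x y z : E N} {r s : ℝ} (h : Reach Ω x y r) (h' : Reach Ω y z s) :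
    Reach Ω x z (r + s) := by
  induction h' with
  | refl hx hr => exact h.mono (by linarith)
  | step _ hz hs ih => exact .step ih hz (by linarith)

lemma Reach.disc {φ : ℂ → E N} (hφ : DifferentiableOn ℂ φ (ball 0 1))
    (hm : MapsTo φ (ball (0:ℂ) 1) Ω) {a b : ℂ} (ha : ‖a‖ < 1) (hb : ‖b‖ < 1) {r : ℝ}
    (hr : poincare a b ≤ r) : Reach Ω (φ a) (φ b) r :=
  .step (.refl (hm (by simpa using ha)) le_rfl) (hm (by simpa using hb)) (by
    rw [zero_add]; exact (lempert_le_poincare hφ hm ha hb).trans hr)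

lemma Reach.kobayashi_le {x y : E N} {r : ℝ} (h : Reach Ω x y r) : kobayashi Ω x y ≤ r := by
  have key : ∃ (n : ℕ) (p : Fin (n + 1) → E N), p 0 = x ∧ p (Fin.last n) = y ∧
      (∀ i, p i ∈ Ω) ∧ ∑ i : Fin n, lempert Ω (p i.castSucc) (p i.succ) ≤ r := by
    induction h with
    | refl hx hr => exact ⟨0, fun _ => x, rfl, rfl, fun _ => hx, by simpa using hr⟩
    | @step y z r s h hz hs ih =>
      obtain ⟨n, p, h0, hl, hp, hsum⟩ := ih
      refine ⟨n + 1, Fin.snoc p z, ?_, by simp, ?_, ?_⟩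
      · rw [← Fin.castSucc_zero, Fin.snoc_castSucc, h0]
      · intro i
        refine Fin.lastCases ?_ (fun j => ?_) i
        · simpa using hz
        · simpa using hp j
      · rw [Fin.sum_univ_castSucc]
        simp only [Fin.succ_last, Fin.snoc_last, Fin.snoc_castSucc, Fin.succ_castSucc, hl]
        linarith
  obtain ⟨n, p, h0, hl, hp, hsum⟩ := key
  unfold kobayashi
  refine le_trans (csInf_le ?_ ⟨n, p, h0, hl, hp, rfl⟩) hsum
  refine ⟨0, ?_⟩
  rintro _ ⟨n, p, -, -, -, rfl⟩
  exact Finset.sum_nonneg fun i _ => lempert_nonneg _ _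

lemma poincare_zero_left (b : ℂ) : poincare 0 b = artanh ‖b‖ := by simp [poincare]

lemma poincare_ofReal {a b : ℝ} (ha : -1 < a) (ha1 : a < 1) (hb : -1 < b) (hb1 : b < 1)
    (hab : b ≤ a) : poincare a b =
      Real.log ((1 + a) * (1 - b) / ((1 - a) * (1 + b))) / 2 := by
  have h1 : 0 < 1 - a * b := by nlinarith
  have h2 : ‖((a:ℂ) - b) / (1 - starRingEnd ℂ (a:ℂ) * b)‖ = (a - b) / (1 - a * b) := by
    rw [Complex.conj_ofReal, ← Complex.ofReal_mul, ← Complex.ofReal_sub, ← Complex.ofReal_one,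
      ← Complex.ofReal_sub, ← Complex.ofReal_div, Complex.norm_real, Real.norm_eq_abs,
      abs_of_nonneg (div_nonneg (by linarith) h1.le)]
  rw [poincare, h2, artanh]
  congr 2
  have h3 : 1 - a ≠ 0 := by linarith
  have h4 : 1 + b ≠ 0 := by linarith
  have h5 : 1 - (a - b) / (1 - a * b) = (1 - a) * (1 + b) / (1 - a * b) := by
    field_simp; ring
  have h6 : 1 + (a - b) / (1 - a * b) = (1 + a) * (1 - b) / (1 - a * b) := by
    field_simp; ring
  rw [h5, h6, div_div_div_cancel_right₀ (ne_of_gt h1)]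

/-- Any two points are joined by a chain; the length is uniform on compact sets. -/
lemma reach_bounded (ho : IsOpen Ω) (hc : IsConnected Ω) {L : Set (E N)} (hL : IsCompact L)
    (hLΩ : L ⊆ Ω) : ∃ r : ℝ, 0 ≤ r ∧ ∀ x ∈ L, ∀ y ∈ L, Reach Ω x y r := by
  have loc : ∀ x ∈ Ω, ∃ ε > 0, ball x ε ⊆ Ω ∧ ∀ y ∈ ball x ε, Reach Ω x y (artanh (1 / 2)) ∧
      Reach Ω y x (artanh (1 / 2)) := by
    intro x hx
    obtain ⟨ε, hε, hsub⟩ := Metric.isOpen_iff.1 ho x hx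
    refine ⟨ε / 2, by positivity, (ball_subset_ball (by linarith)).trans hsub, fun y hy => ?_⟩
    rw [mem_ball, dist_eq_norm] at hy
    set φ : ℂ → E N := fun ξ => x + (2 * ξ) • (y - x) with hφ
    have hd : DifferentiableOn ℂ φ (ball 0 1) := by
      intro ξ _
      simp only [hφ]
      fun_prop
    have hm : MapsTo φ (ball (0:ℂ) 1) Ω := fun ξ hξ => hsub (by
      rw [mem_ball_zero_iff] at hξ
      rw [mem_ball, dist_eq_norm, hφ]
      simp only [add_sub_cancel_left, norm_smul, norm_mul, Complex.norm_ofNat]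
      nlinarith [norm_nonneg (y - x), norm_nonneg ξ])
    have e0 : φ 0 = x := by simp [hφ]
    have e1 : φ (1 / 2) = y := by simp [hφ]
    have n1 : ‖(1 / 2 : ℂ)‖ = 1 / 2 := by norm_num
    have n1' : ‖(1 / 2 : ℂ)‖ < 1 := by rw [n1]; norm_num
    have p1 : poincare 0 (1 / 2 : ℂ) ≤ artanh (1 / 2) := by rw [poincare_zero_left, n1]
    have p2 : poincare (1 / 2 : ℂ) 0 ≤ artanh (1 / 2) := by
      rw [poincare, mul_zero, sub_zero, sub_zero, div_one, n1]
    constructor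
    · have := Reach.disc hd hm (by simp) n1' p1
      rwa [e0, e1] at this
    · have := Reach.disc hd hm n1' (by simp) p2
      rwa [e0, e1] at this
  obtain ⟨p, hp⟩ := hc.nonempty
  set A : Set (E N) := {x | ∃ r, Reach Ω p x r ∧ Reach Ω x p r} with hA
  have hall : Ω ⊆ A := by
    by_contra hcon
    obtain ⟨q, hq, hqA⟩ := not_subset.1 hcon
    have o1 : IsOpen (Ω ∩ A) := by
      rw [Metric.isOpen_iff]
      rintro x ⟨hx, r, h1, h2⟩
      obtain ⟨ε, hε, hs, h⟩ := loc x hx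
      exact ⟨ε, hε, fun y hy => ⟨hs hy, _, h1.trans (h y hy).1,
        ((h y hy).2.trans h2).mono (le_of_eq (add_comm _ _))⟩⟩
    have o2 : IsOpen (Ω ∩ Aᶜ) := by
      rw [Metric.isOpen_iff]
      rintro x ⟨hx, hxA⟩
      obtain ⟨ε, hε, hs, h⟩ := loc x hx
      refine ⟨ε, hε, fun y hy => ⟨hs hy, ?_⟩⟩
      rintro ⟨r, h1, h2⟩
      exact hxA ⟨_, h1.trans (h y hy).2, ((h y hy).1.trans h2).mono (le_of_eq (add_comm _ _))⟩
    obtain ⟨x, _, hx1, hx2⟩ := hc.isPreconnected (Ω ∩ A) (Ω ∩ Aᶜ) o1 o2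
      (fun x hx => by by_cases h : x ∈ A; exacts [Or.inl ⟨hx, h⟩, Or.inr ⟨hx, h⟩])
      ⟨p, hp, hp, 0, .refl hp le_rfl, .refl hp le_rfl⟩ ⟨q, hq, hq, hqA⟩
    exact hx2.2 hx1.2
  have key : ∃ r : ℝ, ∀ x ∈ L, Reach Ω p x r ∧ Reach Ω x p r := by
    refine hL.induction_on (p := fun s => ∃ r : ℝ, ∀ x ∈ s, Reach Ω p x r ∧ Reach Ω x p r)
      ⟨0, fun x hx => absurd hx (notMem_empty x)⟩
      (fun s t hst ⟨r, hr⟩ => ⟨r, fun x hx => hr x (hst hx)⟩) ?_ ?_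
    · rintro s t ⟨r, hr⟩ ⟨r', hr'⟩
      refine ⟨max r r', fun x hx => ?_⟩
      rcases hx with hx | hx
      · exact ⟨(hr x hx).1.mono (le_max_left _ _), (hr x hx).2.mono (le_max_left _ _)⟩
      · exact ⟨(hr' x hx).1.mono (le_max_right _ _), (hr' x hx).2.mono (le_max_right _ _)⟩
    · intro x hx
      obtain ⟨r, h1, h2⟩ := hall (hLΩ hx)
      obtain ⟨ε, hε, -, h⟩ := loc x (hLΩ hx)
      exact ⟨ball x ε, mem_nhdsWithin_of_mem_nhds (ball_mem_nhds x hε), r + artanh (1 / 2),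
        fun y hy => ⟨h1.trans (h y hy).1, ((h y hy).2.trans h2).mono (le_of_eq (add_comm _ _))⟩⟩
  obtain ⟨r, hr⟩ := key
  exact ⟨max (r + r) 0, le_max_right _ _, fun x hx y hy =>
    ((hr x hx).2.trans (hr y hy).1).mono (le_max_left _ _)⟩


namespace Geom
variable (G : Geom α Ω)

lemma rho_le {x y : E N} (hx : x ∈ closure Ω) (hy : ‖y - x‖ < G.δ) :
    G.ρ y ≤ G.ρ x + fderiv ℝ G.ρ x (y - x) + G.M * ‖y - x‖ ^ 2 := by
  have := (abs_le.1 (G.taylor_near x hx y hy)).2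
  linarith

lemma mem_of_near {x y : E N} (hx : x ∈ closure Ω) (hy : ‖y - x‖ < G.δ)
    (h : G.ρ x + fderiv ℝ G.ρ x (y - x) + G.M * ‖y - x‖ ^ 2 < 0) : y ∈ Ω :=
  G.inside y (mem_thickening_iff.2 ⟨x, hx, by rwa [dist_eq_norm]⟩) ((G.rho_le hx hy).trans_lt h)

lemma d_nu {x : E N} (hx : x ∈ closure Ω) (hu : G.u x ≤ G.κ) (s : ℂ) :
    fderiv ℝ G.ρ x (s • G.ν x) = s.re := by
  rw [← re_ell, map_smul, G.ell_nu x hx (by rw [u] at hu; linarith), smul_eq_mul, mul_one]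

set_option maxHeartbeats 1600000 in
theorem exists_normal_disc : ∃ r₀ : ℝ, 0 < r₀ ∧ r₀ ≤ G.κ ∧ ∀ x ∈ Ω, ∀ τ : ℝ, G.u x ≤ τ → τ ≤ r₀ →
    x - τ • G.ν x ∈ Ω ∧ τ / 2 ≤ G.u (x - τ • G.ν x) ∧
    Reach Ω x (x - τ • G.ν x) (Real.log (6 * τ / G.u x) / 2) ∧
    Reach Ω (x - τ • G.ν x) x (Real.log (6 * τ / G.u x) / 2) := by
  have hM := G.M_pos
  have hδ := G.hδ
  set r := min (1 / (2 * G.M ^ 3)) (min (G.δ / (4 * G.M)) G.κ) with hr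
  have hr0 : 0 < r := lt_min (by positivity) (lt_min (by positivity) G.hκ)
  have hr1 : r * (2 * G.M ^ 3) ≤ 1 := by
    rw [← le_div_iff₀ (by positivity)]; exact min_le_left _ _
  have hr2 : r * (4 * G.M) ≤ G.δ := by
    rw [← le_div_iff₀ (by positivity)]; exact (min_le_right _ _).trans (min_le_left _ _)
  have hr3 : r ≤ G.κ := (min_le_right _ _).trans (min_le_right _ _)
  refine ⟨r, hr0, hr3, fun x hx τ hxτ hτ => ?_⟩
  set w := G.u x with hw
  have hw0 : 0 < w := G.u_pos hx
  have hxc : x ∈ closure Ω := subset_closure hx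
  have hν := G.nu_le x hxc
  have hest : ∀ s : ℂ, ‖s‖ ≤ 3 * r → ‖x + s • G.ν x - x‖ < G.δ ∧
      G.M * ‖x + s • G.ν x - x‖ ^ 2 ≤ ‖s‖ ^ 2 / (2 * r) := by
    intro s hs
    rw [add_sub_cancel_left, norm_smul]
    have h1 : ‖s‖ * ‖G.ν x‖ ≤ ‖s‖ * G.M := by gcongr
    have h2 : ‖s‖ * G.M ≤ 3 * r * G.M := by gcongr
    refine ⟨by nlinarith [mul_pos hr0 hM], ?_⟩
    rw [le_div_iff₀ (by positivity)]
    calc G.M * (‖s‖ * ‖G.ν x‖) ^ 2 * (2 * r) ≤ G.M * (‖s‖ * G.M) ^ 2 * (2 * r) := by gcongr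
      _ = ‖s‖ ^ 2 * (r * (2 * G.M ^ 3)) := by ring
      _ ≤ ‖s‖ ^ 2 * 1 := by gcongr
      _ = _ := mul_one _
  set R := √(2 * r * w + r ^ 2) with hR
  have hR2 : R ^ 2 = 2 * r * w + r ^ 2 := Real.sq_sqrt (by positivity)
  have hRr : r < R := by
    rw [hR]; apply Real.lt_sqrt_of_sq_lt; nlinarith [mul_pos hr0 hw0]
  have hR0 : 0 < R := hr0.trans hRr
  have hRle : R ≤ 2 * r := by nlinarith
  set φ : ℂ → E N := fun ξ => x + (-(r:ℂ) + R * ξ) • G.ν x with hφ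
  have hd : DifferentiableOn ℂ φ (ball 0 1) := by
    intro ξ _
    simp only [hφ]
    fun_prop
  have hm : MapsTo φ (ball (0:ℂ) 1) Ω := by
    intro ξ hξ
    rw [mem_ball_zero_iff] at hξ
    set s : ℂ := -(r:ℂ) + R * ξ with hs
    have n1 : ‖s‖ ≤ 3 * r := by
      refine (norm_add_le _ _).trans ?_
      rw [norm_neg, norm_mul, Complex.norm_real, Complex.norm_real, Real.norm_eq_abs,
        Real.norm_eq_abs, abs_of_pos hr0, abs_of_pos hR0]
      nlinarith
    have n2 : ‖s + r‖ ^ 2 < R ^ 2 := by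
      have : s + r = R * ξ := by rw [hs]; ring
      rw [this, norm_mul, Complex.norm_real, Real.norm_eq_abs, abs_of_pos hR0]
      have : R * ‖ξ‖ < R := by nlinarith
      have : 0 ≤ R * ‖ξ‖ := by positivity
      nlinarith
    have n3 : ‖s + r‖ ^ 2 = ‖s‖ ^ 2 + 2 * r * s.re + r ^ 2 := by
      rw [Complex.sq_norm, Complex.sq_norm, Complex.normSq_apply, Complex.normSq_apply]
      simp; ring
    obtain ⟨e1, e2⟩ := hest s n1
    refine G.mem_of_near hxc e1 ?_
    rw [add_sub_cancel_left] at e2 ⊢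
    rw [G.d_nu hxc (hxτ.trans (hτ.trans hr3))]
    have e3 : ‖s‖ ^ 2 / (2 * r) < w - s.re := by
      rw [div_lt_iff₀ (by positivity)]; nlinarith
    have : G.ρ x = -w := by rw [hw, u, neg_neg]
    rw [this]
    linarith
  have hτ0 : 0 < τ := hw0.trans_le hxτ
  set a := r / R with ha
  set b := (r - τ) / R with hb
  have a0 : 0 < a := by positivity
  have a1 : a < 1 := by rwa [ha, div_lt_one hR0]
  have b0 : 0 ≤ b := div_nonneg (by linarith) hR0.le
  have bleq : b ≤ a := by rw [ha, hb]; gcongr; linarith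
  have fa : φ (a:ℂ) = x := by
    have : -(r:ℂ) + R * (a:ℝ) = 0 := by
      rw [ha, ← Complex.ofReal_mul, mul_div_cancel₀ _ hR0.ne']; ring
    simp only [hφ]
    rw [this, zero_smul, add_zero]
  have fb : φ (b:ℂ) = x - τ • G.ν x := by
    have : -(r:ℂ) + R * (b:ℝ) = -(τ:ℂ) := by
      rw [hb, ← Complex.ofReal_mul, mul_div_cancel₀ _ hR0.ne']; push_cast; ring
    simp only [hφ]
    rw [this, neg_smul, ← sub_eq_add_neg, Complex.coe_smul]
  have na : ‖(a:ℂ)‖ < 1 := by rwa [Complex.norm_real, Real.norm_eq_abs, abs_of_pos a0]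
  have nb : ‖(b:ℂ)‖ < 1 := by
    rw [Complex.norm_real, Real.norm_eq_abs, abs_of_nonneg b0]; linarith
  have hp : poincare (a:ℂ) (b:ℂ) ≤ Real.log (6 * τ / w) / 2 := by
    rw [poincare_ofReal (by linarith) a1 (by linarith) (by linarith) bleq]
    have h1a : 0 < 1 - a := by linarith
    have h1b : 0 < 1 - b := by linarith
    have : (1 + a) * (1 - b) / ((1 - a) * (1 + b)) ≤ 6 * τ / w := by
      have e1 : (1 - a) * (R * (R + r)) = 2 * r * w := by
        have : (1 - a) * R = R - r := by rw [ha]; field_simp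
        calc (1 - a) * (R * (R + r)) = ((1 - a) * R) * (R + r) := by ring
          _ = (R - r) * (R + r) := by rw [this]
          _ = R ^ 2 - r ^ 2 := by ring
          _ = _ := by rw [hR2]; ring
      have e2 : (1 - b) * R = R - r + τ := by rw [hb]; field_simp; ring
      have e3 : R - r ≤ w := by nlinarith
      have e4 : (1 - b) * R ≤ 2 * τ := by rw [e2]; linarith
      rw [div_le_div_iff₀ (mul_pos h1a (by linarith)) hw0]
      have e5 : w ≤ (1 - a) * (3 * R / 2) := by
        have : (1 - a) * (R * (R + r)) ≤ (1 - a) * (R * (3 * r)) := by gcongr; linarith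
        rw [e1] at this
        have h5 : 0 ≤ 2 * r * ((1 - a) * (3 * R / 2) - w) := by linear_combination this
        linarith [nonneg_of_mul_nonneg_right h5 (by positivity)]
      have e6 : (1 + a) * (1 - b) * w ≤ 2 * (1 - b) * ((1 - a) * (3 * R / 2)) := by
        gcongr; linarith
      have e7 : 2 * (1 - b) * ((1 - a) * (3 * R / 2)) = 3 * (1 - a) * ((1 - b) * R) := by ring
      have e8 : 3 * (1 - a) * ((1 - b) * R) ≤ 3 * (1 - a) * (2 * τ) := by gcongr
      have e9 : 0 ≤ 6 * τ * (1 - a) * b := by positivity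
      linear_combination e6 + e8 + e9
    have hpos : 0 < (1 + a) * (1 - b) / ((1 - a) * (1 + b)) := by
      have : 0 < 1 + b := by linarith
      positivity
    have := Real.log_le_log hpos this
    linarith
  have hp' : poincare (b:ℂ) (a:ℂ) ≤ Real.log (6 * τ / w) / 2 := by
    have : poincare (b:ℂ) (a:ℂ) = poincare (a:ℂ) (b:ℂ) := by
      simp only [poincare, Complex.conj_ofReal, norm_div, norm_sub_rev (b:ℂ) (a:ℂ),
        mul_comm (b:ℂ) (a:ℂ)]
    rw [this]; exact hp
  have R1 := Reach.disc hd hm na nb hp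
  have R2 := Reach.disc hd hm nb na hp'
  rw [fa, fb] at R1 R2
  refine ⟨?_, ?_, R1, R2⟩
  · have := hm (show (b:ℂ) ∈ ball (0:ℂ) 1 by simpa using nb)
    rwa [fb] at this
  · have hnt : ‖(-τ:ℂ)‖ = τ := by
      rw [norm_neg, Complex.norm_real, Real.norm_eq_abs, abs_of_pos hτ0]
    obtain ⟨e1, e2⟩ := hest (-τ : ℂ) (by rw [hnt]; linarith)
    have e3 := G.rho_le hxc e1
    rw [add_sub_cancel_left, G.d_nu hxc (hxτ.trans (hτ.trans hr3))] at e3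
    rw [add_sub_cancel_left, hnt] at e2
    have e4 : x + (-τ:ℂ) • G.ν x = x - τ • G.ν x := by
      rw [neg_smul, ← sub_eq_add_neg, Complex.coe_smul]
    rw [e4] at e3
    have e5 : τ ^ 2 / (2 * r) ≤ τ / 2 := by
      rw [div_le_iff₀ (by positivity)]; nlinarith
    simp only [Complex.neg_re, Complex.ofReal_re] at e3
    rw [u]
    have : G.ρ x < 0 := G.neg x hx
    linarith

end Geom

namespace Geom
variable (G : Geom α Ω)

lemma mem_middle_disc {r₀ A q τ : ℝ} {x y : E N} (hr : r₀ ≤ G.κ) (hA : A = 8 + 32 * G.M)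
    (q0 : 0 < q) (q1 : q ≤ 1) (q2 : q * (200 * G.M ^ 3 * A) ≤ 1) (q3 : q * (2 + 5 * G.M * A) < G.δ)
    (q4 : A * q ≤ r₀) (hx : x ∈ Ω) (hy : y ∈ Ω) (hux : G.u x ≤ q ^ 2) (huy : G.u y ≤ q ^ 2)
    (hv : ‖y - x‖ ≤ q) (hl : ‖ell G.ρ x (y - x)‖ ≤ q ^ 2) (hτ : τ = A * q ^ 2) {ξ : ℂ}
    (hξ : ‖ξ‖ < 1) :
    (x - τ • G.ν x) + (2 * ξ) • ((y - τ • G.ν y) - (x - τ • G.ν x)) ∈ Ω := by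
  have hM := G.hM
  have hM0 := G.M_pos
  have hA1 : 40 ≤ A := by linarith
  have hxc : x ∈ closure Ω := subset_closure hx
  have hyc : y ∈ closure Ω := subset_closure hy
  have hq2 : q ^ 2 ≤ q := by nlinarith
  have hτ0 : 0 < τ := by rw [hτ]; positivity
  have hqκ : q ^ 2 ≤ G.κ := by nlinarith
  have hνx := G.nu_le x hxc
  have hνy := G.nu_le y hyc
  have h1x : ell G.ρ x (G.ν x) = 1 := G.ell_nu x hxc (by rw [u] at hux; linarith)
  have h1y : ell G.ρ y (G.ν y) = 1 := G.ell_nu y hyc (by rw [u] at huy; linarith)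
  have hw : ‖ell G.ρ x (G.ν y - G.ν x)‖ ≤ G.M ^ 2 * q := by
    have e : ell G.ρ x (G.ν y - G.ν x) = (ell G.ρ x - ell G.ρ y) (G.ν y) := by
      rw [map_sub, h1x, sub_apply, h1y]
    rw [e]
    refine (ContinuousLinearMap.le_opNorm _ _).trans ?_
    have := (ell_sub_norm G.ρ x y)
    have h2 := G.lip y hyc x hxc
    rw [norm_sub_rev x y] at h2
    calc ‖ell G.ρ x - ell G.ρ y‖ * ‖G.ν y‖ ≤ (G.M * q) * G.M := by
          gcongr
          rw [this]
          exact h2.trans (by gcongr)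
      _ = _ := by ring
  set h : E N := -(τ:ℂ) • G.ν x + (2 * ξ) • ((y - x) - (τ:ℂ) • (G.ν y - G.ν x)) with hh
  have hp : (x - τ • G.ν x) + (2 * ξ) • ((y - τ • G.ν y) - (x - τ • G.ν x)) = x + h := by
    rw [hh, ← Complex.coe_smul, ← Complex.coe_smul]
    module
  have hnorm : ‖h‖ ≤ 2 * q + 5 * G.M * τ := by
    have a1 : ‖-(τ:ℂ) • G.ν x‖ ≤ τ * G.M := by
      rw [norm_smul, norm_neg, Complex.norm_real, Real.norm_eq_abs, abs_of_pos hτ0]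
      gcongr
    have a2 : ‖(y - x) - (τ:ℂ) • (G.ν y - G.ν x)‖ ≤ q + τ * (G.M + G.M) := by
      refine (norm_sub_le _ _).trans (add_le_add hv ?_)
      rw [norm_smul, Complex.norm_real, Real.norm_eq_abs, abs_of_pos hτ0]
      gcongr
      exact (norm_sub_le _ _).trans (add_le_add hνy hνx)
    have a3 : ‖2 * ξ‖ ≤ 2 := by
      rw [norm_mul, Complex.norm_ofNat]; linarith
    calc ‖h‖ ≤ τ * G.M + 2 * (q + τ * (G.M + G.M)) := by
          refine (norm_add_le _ _).trans (add_le_add a1 ?_)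
          rw [norm_smul]
          gcongr
      _ = _ := by ring
  have hd : fderiv ℝ G.ρ x h ≤ -τ + 2 * q ^ 2 + 2 * τ * (G.M ^ 2 * q) := by
    rw [← re_ell]
    have : ell G.ρ x h = -(τ:ℂ) + (2 * ξ) * (ell G.ρ x (y - x) - τ * ell G.ρ x (G.ν y - G.ν x)) := by
      rw [hh, map_add, map_smul, map_smul, map_sub (ell G.ρ x) (y - x), map_smul, h1x]
      simp only [smul_eq_mul, mul_one]
    rw [this, Complex.add_re, ← Complex.ofReal_neg, Complex.ofReal_re]
    have a3 : ‖2 * ξ‖ ≤ 2 := by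
      rw [norm_mul, Complex.norm_ofNat]; linarith
    have : ((2 * ξ) * (ell G.ρ x (y - x) - τ * ell G.ρ x (G.ν y - G.ν x))).re ≤
        2 * (q ^ 2 + τ * (G.M ^ 2 * q)) := by
      refine (Complex.re_le_norm _).trans ?_
      rw [norm_mul]
      gcongr
      refine (norm_sub_le _ _).trans (add_le_add hl ?_)
      rw [norm_mul, Complex.norm_real, Real.norm_eq_abs, abs_of_pos hτ0]
      gcongr
    linarith
  rw [hp]
  have hδ : ‖x + h - x‖ < G.δ := by
    rw [add_sub_cancel_left]
    refine hnorm.trans_lt (lt_of_le_of_lt ?_ q3)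
    have : 5 * G.M * τ ≤ 5 * G.M * (A * q) := by rw [hτ]; gcongr
    linarith
  refine G.mem_of_near hxc hδ ?_
  rw [add_sub_cancel_left]
  have hx0 := G.neg x hx
  have b1 : G.M * ‖h‖ ^ 2 ≤ 8 * G.M * q ^ 2 + 50 * G.M ^ 3 * τ ^ 2 := by
    have : ‖h‖ ^ 2 ≤ (2 * q + 5 * G.M * τ) ^ 2 := by gcongr
    have : ‖h‖ ^ 2 ≤ 8 * q ^ 2 + 50 * G.M ^ 2 * τ ^ 2 := by
      nlinarith [sq_nonneg (2 * q - 5 * G.M * τ)]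
    calc G.M * ‖h‖ ^ 2 ≤ G.M * (8 * q ^ 2 + 50 * G.M ^ 2 * τ ^ 2) := by gcongr
      _ = _ := by ring
  have b2 : 2 * q ^ 2 + 8 * G.M * q ^ 2 = τ / 4 := by rw [hτ, hA]; ring
  have b3 : 50 * G.M ^ 3 * τ ^ 2 ≤ τ / 4 := by
    have : 200 * G.M ^ 3 * τ ≤ 1 := by
      refine le_trans ?_ q2
      rw [hτ]
      calc 200 * G.M ^ 3 * (A * q ^ 2) ≤ 200 * G.M ^ 3 * (A * q) := by gcongr
        _ = _ := by ring
    nlinarith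
  have b4 : 2 * τ * (G.M ^ 2 * q) ≤ τ / 4 := by
    have : 8 * (G.M ^ 2 * q) ≤ 1 := by
      refine le_trans ?_ q2
      have h3 : G.M ^ 2 ≤ G.M ^ 3 := pow_le_pow_right₀ hM (by norm_num)
      have : G.M ^ 2 * 8 ≤ G.M ^ 3 * (200 * A) := by gcongr; linarith
      nlinarith
    nlinarith
  linarith

theorem exists_reach : ∃ C : ℝ, 0 ≤ C ∧ ∀ x ∈ Ω, ∀ y ∈ Ω, ∀ s : ℝ, G.u x ≤ s → G.u y ≤ s →
    ‖y - x‖ ^ 2 ≤ s → ‖ell G.ρ x (y - x)‖ ≤ s →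
    Reach Ω x y (Real.log (s / G.u x) / 2 + Real.log (s / G.u y) / 2 + C) := by
  obtain ⟨r₀, hr0, hrκ, hn⟩ := G.exists_normal_disc
  have hM := G.hM
  have hM0 := G.M_pos
  have hδ := G.hδ
  set A := 8 + 32 * G.M with hA
  have hA0 : 0 < A := by positivity
  set b := min 1 (min (1 / (200 * G.M ^ 3 * A)) (min (G.δ / (2 * (2 + 5 * G.M * A))) (r₀ / A)))
    with hb
  have hb0 : 0 < b := by rw [hb]; positivity
  have hb1 : b ≤ 1 := min_le_left _ _
  have hb2 : b * (200 * G.M ^ 3 * A) ≤ 1 := by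
    rw [← le_div_iff₀ (by positivity)]; exact (min_le_right _ _).trans (min_le_left _ _)
  have hb3 : b * (2 * (2 + 5 * G.M * A)) ≤ G.δ := by
    rw [← le_div_iff₀ (by positivity)]
    exact (min_le_right _ _).trans ((min_le_right _ _).trans (min_le_left _ _))
  have hb4 : b * A ≤ r₀ := by
    rw [← le_div_iff₀ (by positivity)]
    exact (min_le_right _ _).trans ((min_le_right _ _).trans (min_le_right _ _))
  set L := {x | x ∈ closure Ω ∧ r₀ / 2 ≤ G.u x} with hL
  have hLc : IsCompact L := by
    have : IsCompact (closure Ω) := G.bdd.isCompact_closure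
    exact this.of_isClosed_subset
      (G.continuousOn_u.preimage_isClosed_of_isClosed isClosed_closure isClosed_Ici)
      fun x hx => hx.1
  have hLΩ : L ⊆ Ω := by
    intro x hx
    by_contra hcon
    have := G.zero x hx.1 hcon
    have := hx.2
    rw [u] at this
    linarith
  obtain ⟨r, hr, hreach⟩ := reach_bounded G.isOpen G.conn hLc hLΩ
  set C₁ := |Real.log (6 * r₀ / b ^ 2)| / 2 with hC1
  set C₂ := |Real.log (6 * A)| / 2 with hC2
  refine ⟨2 * C₁ + 2 * C₂ + r + artanh (1 / 2), ?_, fun x hx y hy s hsx hsy hs hl => ?_⟩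
  · have := artanh_nonneg (x := 1 / 2) (by norm_num) (by norm_num)
    positivity
  have hux := G.u_pos hx
  have huy := G.u_pos hy
  have hs0 : 0 < s := hux.trans_le hsx
  have ha := artanh_nonneg (x := 1 / 2) (by norm_num) (by norm_num)
  have hC1' : 0 ≤ C₁ := by positivity
  have hC2' : 0 ≤ C₂ := by positivity
  rcases le_or_gt s (b ^ 2) with hsb | hsb
  · set q := √s with hq
    have hqs : q ^ 2 = s := Real.sq_sqrt hs0.le
    have hq0 : 0 < q := Real.sqrt_pos.2 hs0
    have hqb : q ≤ b := by
      rw [hq]; exact Real.sqrt_le_iff.2 ⟨hb0.le, hsb⟩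
    set τ := A * q ^ 2 with hτ
    have hqr : A * q ≤ r₀ := le_trans (by rw [mul_comm]; gcongr) hb4
    have hτr : τ ≤ r₀ := le_trans (by rw [hτ, pow_two]; nlinarith [mul_pos hA0 hq0]) hqr
    have hsτ : s ≤ τ := by rw [hτ, hqs]; nlinarith
    obtain ⟨-, -, R1, -⟩ := hn x hx τ (hsx.trans hsτ) hτr
    obtain ⟨-, -, -, R3⟩ := hn y hy τ (hsy.trans hsτ) hτr
    have hmid : ∀ ξ : ℂ, ‖ξ‖ < 1 → 
        (x - τ • G.ν x) + (2 * ξ) • ((y - τ • G.ν y) - (x - τ • G.ν x)) ∈ Ω := fun ξ hξ =>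
      G.mem_middle_disc hrκ hA hq0 (hqb.trans hb1) (le_trans (by gcongr) hb2)
        (by
          have : q * (2 + 5 * G.M * A) ≤ b * (2 + 5 * G.M * A) := by gcongr
          have : 0 < b * (2 + 5 * G.M * A) := by positivity
          linarith)
        hqr hx hy (by rwa [hqs]) (by rwa [hqs]) (by
          rw [hq]; exact Real.le_sqrt_of_sq_le hs) (by rwa [hqs]) hτ hξ
    have R2 : Reach Ω (x - τ • G.ν x) (y - τ • G.ν y) (artanh (1 / 2)) := by
      have := Reach.disc (Ω := Ω)
        (φ := fun ξ : ℂ => (x - τ • G.ν x) + (2 * ξ) • ((y - τ • G.ν y) - (x - τ • G.ν x)))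
        (a := 0) (b := 1 / 2) (r := artanh (1 / 2)) (by fun_prop)
        (fun ξ hξ => hmid ξ (by simpa using hξ)) (by simp) (by norm_num)
        (by rw [poincare_zero_left]; norm_num)
      simpa using this
    refine ((R1.trans R2).trans R3).mono ?_
    have hlog : ∀ w : ℝ, 0 < w → Real.log (6 * τ / w) / 2 ≤ Real.log (s / w) / 2 + C₂ := by
      intro w hw
      have : 6 * τ / w = (6 * A) * (s / w) := by rw [hτ, hqs]; ring
      rw [this, Real.log_mul (by positivity) (by positivity), hC2]
      have := le_abs_self (Real.log (6 * A))
      linarith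
    have := hlog _ hux
    have := hlog _ huy
    linarith
  · have hdeep : ∀ x ∈ Ω, G.u x ≤ s → ∃ x' ∈ L, Reach Ω x x' (Real.log (s / G.u x) / 2 + C₁) ∧
        Reach Ω x' x (Real.log (s / G.u x) / 2 + C₁) := by
      intro x hx hxs
      have hux := G.u_pos hx
      rcases le_or_gt (r₀ / 2) (G.u x) with h | h
      · have h0 : 0 ≤ Real.log (s / G.u x) / 2 + C₁ := by
          have := Real.log_nonneg ((one_le_div hux).2 hxs)
          positivity
        exact ⟨x, ⟨subset_closure hx, h⟩, .refl hx h0, .refl hx h0⟩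
      · obtain ⟨h1, h2, h3, h4⟩ := hn x hx r₀ (by linarith) le_rfl
        have : Real.log (6 * r₀ / G.u x) / 2 ≤ Real.log (s / G.u x) / 2 + C₁ := by
          have e : 6 * r₀ / G.u x ≤ (6 * r₀ / b ^ 2) * (s / G.u x) := by
            rw [div_mul_div_comm, div_le_div_iff₀ hux (by positivity)]
            have : 6 * r₀ * G.u x * b ^ 2 ≤ 6 * r₀ * G.u x * s := by gcongr
            linarith
          have := Real.log_le_log (by positivity) e
          rw [Real.log_mul (by positivity) (by positivity)] at this
          have := le_abs_self (Real.log (6 * r₀ / b ^ 2))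
          linarith
        exact ⟨_, ⟨subset_closure h1, h2⟩, h3.mono this, h4.mono this⟩
    obtain ⟨x', hx', R1, -⟩ := hdeep x hx hsx
    obtain ⟨y', hy', -, R3⟩ := hdeep y hy hsy
    exact ((R1.trans (hreach x' hx' y' hy')).trans R3).mono (by linarith)

end Geom


lemma norm_sub_zero_le {F : Type*} [NormedAddCommGroup F] [NormedSpace ℂ F] {g : ℂ → F}
    (hg : DifferentiableOn ℂ g (ball 0 1)) {B e : ℝ} (he : e ≠ 0)
    (h : ∀ z : ℂ, ‖z‖ < 1 → ‖deriv g z‖ ≤ B * (1 - ‖z‖) ^ (e - 1)) {z : ℂ} (hz : ‖z‖ < 1) :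
    ‖g z - g 0‖ ≤ B * (1 - (1 - ‖z‖) ^ e) / e := by
  have hn : ∀ s ∈ Icc (0:ℝ) 1, ‖(s:ℂ) * z‖ = s * ‖z‖ ∧ s * ‖z‖ < 1 := by
    intro s hs
    refine ⟨by rw [norm_mul, Complex.norm_real, Real.norm_eq_abs, abs_of_nonneg hs.1], ?_⟩
    have := mul_le_mul_of_nonneg_right hs.2 (norm_nonneg z)
    linarith
  have hd : ∀ s ∈ Icc (0:ℝ) 1, HasDerivAt (fun s : ℝ => g (s * z) - g 0) (z • deriv g (s * z)) s := by
    intro s hs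
    have h1 : HasDerivAt g (deriv g (s * z)) (s * z) :=
      (hg.differentiableAt (isOpen_ball.mem_nhds (by
        rw [mem_ball_zero_iff, (hn s hs).1]; exact (hn s hs).2))).hasDerivAt
    have h2 : HasDerivAt (fun s : ℝ => (s:ℂ) * z) z s := by
      simpa using (Complex.ofRealCLM.hasDerivAt (x := s)).mul_const z
    exact (h1.scomp s h2).sub_const _
  have hB : ∀ s ∈ Icc (0:ℝ) 1, HasDerivAt (fun s : ℝ => B * (1 - (1 - s * ‖z‖) ^ e) / e)
      (‖z‖ * (B * (1 - s * ‖z‖) ^ (e - 1))) s := by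
    intro s hs
    have h0 : 1 - s * ‖z‖ ≠ 0 := by linarith [(hn s hs).2]
    have h1 : HasDerivAt (fun s : ℝ => 1 - s * ‖z‖) (-‖z‖) s := by
      simpa using ((hasDerivAt_id s).mul_const ‖z‖).const_sub 1
    have h2 := (((h1.rpow_const (p := e) (Or.inl h0)).const_sub 1).const_mul B).div_const e
    refine h2.congr_deriv ?_
    rw [div_eq_iff he]; ring
  have key := image_norm_le_of_norm_deriv_right_le_deriv_boundary' (a := 0) (b := 1)
    (f := fun s : ℝ => g (s * z) - g 0) (f' := fun s : ℝ => z • deriv g (s * z))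
    (B := fun s : ℝ => B * (1 - (1 - s * ‖z‖) ^ e) / e)
    (B' := fun s : ℝ => ‖z‖ * (B * (1 - s * ‖z‖) ^ (e - 1)))
    (fun s hs => (hd s hs).continuousAt.continuousWithinAt)
    (fun s hs => (hd s ⟨hs.1, hs.2.le⟩).hasDerivWithinAt) (by simp)
    (fun s hs => (hB s hs).continuousAt.continuousWithinAt)
    (fun s hs => (hB s ⟨hs.1, hs.2.le⟩).hasDerivWithinAt)
    (fun s hs => by
      have hs' : s ∈ Icc (0:ℝ) 1 := ⟨hs.1, hs.2.le⟩
      rw [norm_smul]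
      have := h (s * z) (by rw [(hn s hs').1]; exact (hn s hs').2)
      rw [(hn s hs').1] at this
      gcongr)
  simpa using key (x := 1) (by simp)

namespace Geom
variable (G : Geom α Ω)

theorem exists_u_le_of_near : ∃ C : ℝ, 1 ≤ C ∧ ∀ φ : ℂ → E N, IsComplexGeodesic Ω φ →
    ∀ z : ℂ, ‖z‖ < 1 → ∀ P : ℝ, 1 ≤ P → G.u (φ z) ≤ P * G.u (φ 0) →
    ‖φ z - φ 0‖ ^ 2 ≤ P * G.u (φ 0) → ‖ell G.ρ (φ 0) (φ z - φ 0)‖ ≤ P * G.u (φ 0) →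
    G.u (φ z) ≤ C * P ^ 2 * G.u (φ 0) * (1 - ‖z‖) := by
  obtain ⟨C, hC, H⟩ := G.exists_reach
  refine ⟨Real.exp (2 * C), Real.one_le_exp (by positivity), fun φ hφ z hz P hP h1 h2 h3 => ?_⟩
  have h0 : φ 0 ∈ Ω := hφ.2.1 (by simp)
  have hzΩ : φ z ∈ Ω := hφ.2.1 (by simpa using hz)
  have hu0 := G.u_pos h0
  have huz := G.u_pos hzΩ
  have hP0 : 0 < P := by linarith
  have hk := (H _ h0 _ hzΩ (P * G.u (φ 0)) (by nlinarith) h1 h2 h3).kobayashi_le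
  rw [hφ.2.2 0 (by simp) z (by simpa using hz), poincare_zero_left, artanh,
    mul_div_cancel_right₀ _ hu0.ne'] at hk
  have ht : 0 < 1 - ‖z‖ := by linarith
  have e1 : Real.log (1 / (1 - ‖z‖)) ≤ Real.log ((1 + ‖z‖) / (1 - ‖z‖)) := by
    apply Real.log_le_log (by positivity)
    gcongr
    linarith [norm_nonneg z]
  have e2 : Real.log (1 / (1 - ‖z‖)) ≤
      Real.log (P * (P * G.u (φ 0) / G.u (φ z)) * Real.exp (2 * C)) := by
    rw [Real.log_mul (by positivity) (by positivity), Real.log_mul (by positivity) (by positivity),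
      Real.log_exp]
    linarith
  have e3 := (Real.log_le_log_iff (by positivity) (by positivity)).1 e2
  rw [div_le_iff₀ ht] at e3
  have e4 : P * (P * G.u (φ 0) / G.u (φ z)) * Real.exp (2 * C) * (1 - ‖z‖) * G.u (φ z) =
      Real.exp (2 * C) * P ^ 2 * G.u (φ 0) * (1 - ‖z‖) := by
    field_simp
  nlinarith

/-- Complex geodesics whose defining function is comparably largest at the centre. -/
def IsCentred (φ : ℂ → E N) : Prop :=
  IsComplexGeodesic Ω φ ∧ ∀ z : ℂ, ‖z‖ < 1 → G.u (φ z) ≤ G.M ^ 2 * G.u (φ 0)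

lemma ell_deriv_le {φ : ℂ → E N} (hm : MapsTo φ (ball (0:ℂ) 1) Ω) {z : ℂ} (hz : ‖z‖ < 1) :
    ‖ell G.ρ (φ 0) (deriv φ z)‖ ≤ ‖ell G.ρ (φ z) (deriv φ z)‖ +
      G.M * ‖φ z - φ 0‖ * ‖deriv φ z‖ := by
  have h0 : φ 0 ∈ closure Ω := subset_closure (hm (by simp))
  have hzΩ : φ z ∈ closure Ω := subset_closure (hm (by simpa using hz))
  have e : ell G.ρ (φ 0) (deriv φ z) =
      ell G.ρ (φ z) (deriv φ z) - (ell G.ρ (φ z) - ell G.ρ (φ 0)) (deriv φ z) := by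
    rw [sub_apply]; ring
  rw [e]
  refine (norm_sub_le _ _).trans (add_le_add le_rfl ?_)
  refine (ContinuousLinearMap.le_opNorm _ _).trans ?_
  rw [ell_sub_norm]
  have := G.lip _ h0 _ hzΩ
  gcongr

lemma norm_ell_sub_le {φ : ℂ → E N} (hd : DifferentiableOn ℂ φ (ball 0 1)) {L : E N →L[ℂ] ℂ}
    {B e : ℝ} (he : e ≠ 0)
    (h : ∀ z : ℂ, ‖z‖ < 1 → ‖L (deriv φ z)‖ ≤ B * (1 - ‖z‖) ^ (e - 1)) {z : ℂ} (hz : ‖z‖ < 1) :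
    ‖L (φ z - φ 0)‖ ≤ B * (1 - (1 - ‖z‖) ^ e) / e := by
  rw [map_sub]
  refine norm_sub_zero_le (g := fun z => L (φ z)) (L.differentiable.comp_differentiableOn hd) he
    (fun w hw => ?_) hz
  have h1 : HasDerivAt φ (deriv φ w) w :=
    (hd.differentiableAt (isOpen_ball.mem_nhds (by simpa using hw))).hasDerivAt
  have h2 : HasDerivAt (fun z => L (φ z)) (L (deriv φ w)) w := L.hasFDerivAt.comp_hasDerivAt w h1
  rw [h2.deriv]
  exact h w hw

set_option maxHeartbeats 3200000 in
theorem exists_growth : ∃ C : ℝ, 1 ≤ C ∧ ∀ φ : ℂ → E N, G.IsCentred φ → ∀ z : ℂ, ‖z‖ < 1 →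
    G.u (φ z) ≤ C * G.u (φ 0) * (1 - ‖z‖) ∧ ‖φ z - φ 0‖ ≤ C * √(G.u (φ 0)) ∧
    ‖ell G.ρ (φ 0) (φ z - φ 0)‖ ≤ C * G.u (φ 0) := by
  obtain ⟨A, hA, HA⟩ := G.exists_deriv_estimate
  obtain ⟨Q, hQ, HQ⟩ := G.exists_u_le_of_near
  have hM := G.hM
  have hM0 := G.M_pos
  have hQ0 : 0 < Q := by linarith
  have hA0 : 0 < A := by linarith
  set a := A * G.M with ha
  have ha1 : 1 ≤ a := one_le_mul_of_one_le_of_one_le hA hM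
  have ha0 : 0 < a := by linarith
  set P₁ := (16 * (A * G.M ^ 2 + 16 * G.M * a ^ 2)) ^ 2 with hP1
  have haM : a ≤ A * G.M ^ 2 := by
    rw [ha, pow_two, ← mul_assoc]; exact le_mul_of_one_le_right ha0.le hM
  have hMa : 0 ≤ 16 * G.M * a ^ 2 := by positivity
  have hP1a : 16 * a ≤ 16 * (A * G.M ^ 2 + 16 * G.M * a ^ 2) := by linarith
  have hb1 : 1 ≤ 16 * (A * G.M ^ 2 + 16 * G.M * a ^ 2) := by linarith
  have hP1b : 16 * (A * G.M ^ 2 + 16 * G.M * a ^ 2) ≤ P₁ := le_self_pow₀ hb1 (by norm_num)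
  have hP1c : 1 ≤ P₁ := hb1.trans hP1b
  set K := Q * P₁ ^ 2 with hK
  have hK1 : 1 ≤ K := one_le_mul_of_one_le_of_one_le hQ (one_le_pow₀ hP1c)
  have hK0 : 0 < K := by linarith
  set R := 8 / 3 * (A * K) with hR
  have hR1 : 1 ≤ R := by
    have := one_le_mul_of_one_le_of_one_le hA hK1
    linarith
  set S := 8 / 3 * (A * K + G.M * R * (A * K)) with hS
  have hSR : R ≤ S := by
    have : 0 ≤ G.M * R * (A * K) := by positivity
    linarith
  set P₂ := S ^ 2 with hP2
  have hS1 : 1 ≤ S := hR1.trans hSR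
  have hP2S : S ≤ P₂ := le_self_pow₀ hS1 (by norm_num)
  have hP2c : 1 ≤ P₂ := hS1.trans hP2S
  have hAK : 1 ≤ A * K := one_le_mul_of_one_le_of_one_le hA hK1
  have hKS : K ≤ S := by
    have h1 : K ≤ A * K := le_mul_of_one_le_left hK0.le hA
    have h2 : 0 ≤ G.M * R * (A * K) := by positivity
    linarith
  refine ⟨Q * P₂ ^ 2, one_le_mul_of_one_le_of_one_le hQ (one_le_pow₀ hP2c), fun φ hφ => ?_⟩
  obtain ⟨⟨hd, hm, hk⟩, hc⟩ := hφ
  set D := G.u (φ 0) with hD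
  have hD0 : 0 < D := G.u_pos (hm (by simp))
  set d := √D with hdd
  have hd0 : 0 < d := Real.sqrt_pos.2 hD0
  have hd2 : d * d = D := Real.mul_self_sqrt hD0.le
  have hmz : ∀ z : ℂ, ‖z‖ < 1 → φ z ∈ Ω := fun z hz => hm (by simpa using hz)
  have tpos : ∀ z : ℂ, ‖z‖ < 1 → 0 < 1 - ‖z‖ := fun z hz => by linarith
  have tle : ∀ z : ℂ, 1 - ‖z‖ ≤ 1 := fun z => by linarith [norm_nonneg z]
  have hpow : ∀ z : ℂ, ‖z‖ < 1 → ∀ e f : ℝ, f ≤ e → (1 - ‖z‖) ^ e ≤ (1 - ‖z‖) ^ f :=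
    fun z hz e f h => Real.rpow_le_rpow_of_exponent_ge (tpos z hz) (tle z) h
  have hpow1 : ∀ z : ℂ, ‖z‖ < 1 → ∀ f : ℝ, f ≤ 0 → 1 ≤ (1 - ‖z‖) ^ f := fun z hz f h =>
    Real.one_le_rpow_of_pos_of_le_one_of_nonpos (tpos z hz) (tle z) h
  have hsq : ∀ z : ℂ, ‖z‖ < 1 → √(G.u (φ z)) ≤ G.M * d := by
    intro z hz
    rw [Real.sqrt_le_left (by positivity), mul_pow, pow_two d, hd2]
    exact hc z hz
  have d1 : ∀ z : ℂ, ‖z‖ < 1 → ‖deriv φ z‖ ≤ (a * d) * (1 - ‖z‖) ^ (-1/16 - 1 : ℝ) := by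
    intro z hz
    have h1 := (HA φ hd hm z hz).1
    have h2 := hsq z hz
    have h3 : ‖deriv φ z‖ ≤ (a * d) * (1 - ‖z‖) ^ (-1 : ℝ) := by
      rw [Real.rpow_neg_one, ← div_eq_mul_inv, le_div_iff₀ (tpos z hz), ha]
      calc _ = (1 - ‖z‖) * ‖deriv φ z‖ := mul_comm _ _
        _ ≤ A * (G.M * d) := h1.trans (by gcongr)
        _ = _ := by ring
    refine h3.trans ?_
    gcongr ?_ * ?_
    exact hpow z hz _ _ (by norm_num)
  have x1 : ∀ z : ℂ, ‖z‖ < 1 → ‖φ z - φ 0‖ ≤ 16 * (a * d) * (1 - ‖z‖) ^ (-1/16 : ℝ) := by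
    intro z hz
    have := norm_sub_zero_le hd (e := -1/16) (by norm_num) d1 hz
    have : 0 ≤ a * d := by positivity
    linarith
  have l1 : ∀ z : ℂ, ‖z‖ < 1 → ‖ell G.ρ (φ 0) (deriv φ z)‖ ≤
      ((A * G.M ^ 2 + 16 * G.M * a ^ 2) * D) * (1 - ‖z‖) ^ (-1/16 - 1 : ℝ) := by
    intro z hz
    have h0 := G.ell_deriv_le hm hz
    have h1 := (HA φ hd hm z hz)
    have h2 : ‖ell G.ρ (φ z) (deriv φ z)‖ ≤ (A * G.M ^ 2 * D) * (1 - ‖z‖) ^ (-1 : ℝ) := by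
      rw [Real.rpow_neg_one, ← div_eq_mul_inv, le_div_iff₀ (tpos z hz)]
      calc _ = (1 - ‖z‖) * ‖ell G.ρ (φ z) (deriv φ z)‖ := mul_comm _ _
        _ ≤ A * (G.M ^ 2 * D) := h1.2.trans (by have := hc z hz; gcongr)
        _ = _ := by ring
    have h3 : ‖deriv φ z‖ ≤ (a * d) * (1 - ‖z‖) ^ (-1 : ℝ) := by
      rw [Real.rpow_neg_one, ← div_eq_mul_inv, le_div_iff₀ (tpos z hz), ha]
      have h2 := hsq z hz
      calc _ = (1 - ‖z‖) * ‖deriv φ z‖ := mul_comm _ _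
        _ ≤ A * (G.M * d) := h1.1.trans (by gcongr)
        _ = _ := by ring
    have h4 : (1 - ‖z‖) ^ (-1/16 : ℝ) * (1 - ‖z‖) ^ (-1 : ℝ) = (1 - ‖z‖) ^ (-1/16 - 1 : ℝ) := by
      rw [← Real.rpow_add (tpos z hz)]; norm_num
    have h5 : (1 - ‖z‖) ^ (-1 : ℝ) ≤ (1 - ‖z‖) ^ (-1/16 - 1 : ℝ) := hpow z hz _ _ (by norm_num)
    calc _ ≤ (A * G.M ^ 2 * D) * (1 - ‖z‖) ^ (-1 : ℝ) + G.M *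
          (16 * (a * d) * (1 - ‖z‖) ^ (-1/16 : ℝ)) * ((a * d) * (1 - ‖z‖) ^ (-1 : ℝ)) := by
          refine h0.trans (add_le_add h2 ?_)
          have := x1 z hz
          gcongr
      _ = (A * G.M ^ 2 * D) * (1 - ‖z‖) ^ (-1 : ℝ) + (16 * G.M * a ^ 2) * (d * d) *
          ((1 - ‖z‖) ^ (-1/16 : ℝ) * (1 - ‖z‖) ^ (-1 : ℝ)) := by ring
      _ ≤ (A * G.M ^ 2 * D) * (1 - ‖z‖) ^ (-1/16 - 1 : ℝ) + (16 * G.M * a ^ 2) * D *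
          (1 - ‖z‖) ^ (-1/16 - 1 : ℝ) := by rw [h4, hd2]; gcongr
      _ = _ := by ring
  have u1 : ∀ z : ℂ, ‖z‖ < 1 → G.u (φ z) ≤ K * D * (1 - ‖z‖) ^ (3/4 : ℝ) := by
    intro z hz
    set T := (1 - ‖z‖) ^ (-1/16 : ℝ) with hT
    have hT1 : 1 ≤ T := hpow1 z hz _ (by norm_num)
    have hT2 : 1 ≤ T ^ 2 := one_le_pow₀ hT1
    have hTT : T ≤ T ^ 2 := le_self_pow₀ hT1 (by norm_num)
    have := HQ φ ⟨hd, hm, hk⟩ z hz (P₁ * T ^ 2) (one_le_mul_of_one_le_of_one_le hP1c hT2) ?_ ?_ ?_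
    · refine this.trans (le_of_eq ?_)
      have e : T ^ 4 * (1 - ‖z‖) = (1 - ‖z‖) ^ (3/4 : ℝ) := by
        rw [hT, ← Real.rpow_natCast, ← Real.rpow_mul (tpos z hz).le]
        nth_rewrite 2 [← Real.rpow_one (1 - ‖z‖)]
        rw [← Real.rpow_add (tpos z hz)]; norm_num
      rw [← e, hK]; ring
    · refine (hc z hz).trans ?_
      have h : G.M ^ 2 ≤ P₁ * T ^ 2 := by
        have : G.M ^ 2 ≤ P₁ := by
          refine le_trans ?_ hP1b
          have : G.M ^ 2 ≤ A * G.M ^ 2 := le_mul_of_one_le_left (by positivity) hA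
          linarith
        exact this.trans (le_mul_of_one_le_right (by positivity) hT2)
      gcongr
    · have : ‖φ z - φ 0‖ ^ 2 ≤ (16 * (a * d) * T) ^ 2 := by
        have := x1 z hz
        gcongr
      refine this.trans ?_
      calc (16 * (a * d) * T) ^ 2 = (16 * a) ^ 2 * T ^ 2 * (d * d) := by ring
        _ ≤ P₁ * T ^ 2 * D := by rw [hd2, hP1]; gcongr
    · have := norm_ell_sub_le hd (e := -1/16) (by norm_num) l1 hz
      set B := A * G.M ^ 2 + 16 * G.M * a ^ 2 with hB
      have hB0 : 0 < B := by positivity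
      have e1 : B * D * (1 - T) / (-1/16) = 16 * B * D * T - 16 * (B * D) := by ring
      rw [e1] at this
      calc _ ≤ 16 * B * D * T := this.trans (sub_le_self _ (by positivity))
        _ ≤ P₁ * D * T ^ 2 := by gcongr
        _ = _ := by ring
  have d2 : ∀ z : ℂ, ‖z‖ < 1 → ‖deriv φ z‖ ≤ (A * K * d) * (1 - ‖z‖) ^ (3/8 - 1 : ℝ) := by
    intro z hz
    have h1 := (HA φ hd hm z hz).1
    set T := (1 - ‖z‖) ^ (3/8 : ℝ) with hT
    have hT0 : 0 < T := Real.rpow_pos_of_pos (tpos z hz) _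
    have e : T * T = (1 - ‖z‖) ^ (3/4 : ℝ) := by
      rw [hT, ← Real.rpow_add (tpos z hz)]; norm_num
    have h2 : √(G.u (φ z)) ≤ K * d * T := by
      rw [Real.sqrt_le_left (by positivity)]
      refine (u1 z hz).trans ?_
      rw [← e, ← hd2]
      calc K * (d * d) * (T * T) ≤ (K * K) * (d * d) * (T * T) := by
            have : K ≤ K * K := le_mul_of_one_le_left hK0.le hK1
            gcongr
        _ = _ := by ring
    rw [Real.rpow_sub_one (tpos z hz).ne', ← mul_div_assoc, le_div_iff₀ (tpos z hz)]
    calc _ = (1 - ‖z‖) * ‖deriv φ z‖ := mul_comm _ _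
      _ ≤ A * (K * d * T) := h1.trans (by gcongr)
      _ = _ := by ring
  have x2 : ∀ z : ℂ, ‖z‖ < 1 → ‖φ z - φ 0‖ ≤ R * d := by
    intro z hz
    have h1 := norm_sub_zero_le hd (e := 3/8) (by norm_num) d2 hz
    have h2 : 0 ≤ (1 - ‖z‖) ^ (3/8 : ℝ) := Real.rpow_nonneg (tpos z hz).le _
    have h3 : 0 ≤ A * K * d := by positivity
    have := mul_nonneg h3 h2
    rw [hR]
    linarith
  have l2 : ∀ z : ℂ, ‖z‖ < 1 → ‖ell G.ρ (φ 0) (deriv φ z)‖ ≤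
      ((A * K + G.M * R * (A * K)) * D) * (1 - ‖z‖) ^ (3/8 - 1 : ℝ) := by
    intro z hz
    have h0 := G.ell_deriv_le hm hz
    have h2 : ‖ell G.ρ (φ z) (deriv φ z)‖ ≤ (A * K * D) * (1 - ‖z‖) ^ (3/4 - 1 : ℝ) := by
      rw [Real.rpow_sub_one (tpos z hz).ne', ← mul_div_assoc, le_div_iff₀ (tpos z hz)]
      calc _ = (1 - ‖z‖) * ‖ell G.ρ (φ z) (deriv φ z)‖ := mul_comm _ _
        _ ≤ A * (K * D * (1 - ‖z‖) ^ (3/4 : ℝ)) :=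
            (HA φ hd hm z hz).2.trans (by have := u1 z hz; gcongr)
        _ = _ := by ring
    have h5 : (1 - ‖z‖) ^ (3/4 - 1 : ℝ) ≤ (1 - ‖z‖) ^ (3/8 - 1 : ℝ) := hpow z hz _ _ (by norm_num)
    calc _ ≤ (A * K * D) * (1 - ‖z‖) ^ (3/8 - 1 : ℝ) + G.M * (R * d) *
          ((A * K * d) * (1 - ‖z‖) ^ (3/8 - 1 : ℝ)) := by
          have := x2 z hz
          have := d2 z hz
          refine h0.trans (add_le_add (h2.trans (by gcongr)) ?_)
          gcongr
      _ = ((A * K + G.M * R * (A * K)) * (d * d)) * (1 - ‖z‖) ^ (3/8 - 1 : ℝ) := by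
          rw [← hd2]; ring
      _ = _ := by rw [hd2]
  intro z hz
  have hl : ‖ell G.ρ (φ 0) (φ z - φ 0)‖ ≤ S * D := by
    have h1 := norm_ell_sub_le hd (e := 3/8) (by norm_num) l2 hz
    have h2 : 0 ≤ (1 - ‖z‖) ^ (3/8 : ℝ) := Real.rpow_nonneg (tpos z hz).le _
    have h3 : 0 ≤ (A * K + G.M * R * (A * K)) * D := by positivity
    have := mul_nonneg h3 h2
    rw [hS]
    linarith
  have hS2 : S ≤ Q * P₂ ^ 2 := (hP2S.trans (le_self_pow₀ hP2c (by norm_num))).trans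
    (le_mul_of_one_le_left (by positivity) hQ)
  refine ⟨?_, (x2 z hz).trans (by gcongr; exact hSR.trans hS2), hl.trans (by gcongr)⟩
  refine HQ φ ⟨hd, hm, hk⟩ z hz P₂ hP2c ?_ ?_ (hl.trans (by gcongr))
  · refine (u1 z hz).trans ?_
    have : (1 - ‖z‖) ^ (3/4 : ℝ) ≤ 1 := Real.rpow_le_one (tpos z hz).le (tle z) (by norm_num)
    calc K * D * (1 - ‖z‖) ^ (3/4 : ℝ) ≤ K * D * 1 := by gcongr
      _ ≤ P₂ * D := by rw [mul_one]; gcongr; exact hKS.trans hP2S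
  · calc ‖φ z - φ 0‖ ^ 2 ≤ (R * d) ^ 2 := by have := x2 z hz; gcongr
      _ = R ^ 2 * (d * d) := by ring
      _ ≤ P₂ * D := by rw [hd2, hP2]; gcongr

end Geom


section
variable {F : Type*} [NormedAddCommGroup F] [NormedSpace ℂ F]

lemma norm_sub_smul_le {g : ℂ → F} (hg : DifferentiableOn ℂ g (ball 0 1)) {B γ : ℝ} (hB : 0 ≤ B)
    (hγ : 0 < γ) (hγ1 : γ ≤ 1)
    (h : ∀ z : ℂ, ‖z‖ < 1 → ‖deriv g z‖ ≤ B * (1 - ‖z‖) ^ (γ - 1)) {z : ℂ} (hz : ‖z‖ < 1)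
    {l : ℝ} (hl : 0 ≤ l) (hl1 : l ≤ 1) : ‖g z - g (l * z)‖ ≤ B * (1 - l) ^ γ / γ := by
  have hn : ∀ s ∈ Icc l 1, ‖(s:ℂ) * z‖ = s * ‖z‖ ∧ s * ‖z‖ < 1 := by
    intro s hs
    refine ⟨by rw [norm_mul, Complex.norm_real, Real.norm_eq_abs, abs_of_nonneg (hl.trans hs.1)], ?_⟩
    have := mul_le_mul_of_nonneg_right hs.2 (norm_nonneg z)
    linarith
  have hd : ∀ s ∈ Icc l 1, HasDerivAt (fun s : ℝ => g (s * z) - g (l * z))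
      (z • deriv g (s * z)) s := by
    intro s hs
    have h1 : HasDerivAt g (deriv g (s * z)) (s * z) :=
      (hg.differentiableAt (isOpen_ball.mem_nhds (by
        rw [mem_ball_zero_iff, (hn s hs).1]; exact (hn s hs).2))).hasDerivAt
    have h2 : HasDerivAt (fun s : ℝ => (s:ℂ) * z) z s := by
      simpa using (Complex.ofRealCLM.hasDerivAt (x := s)).mul_const z
    exact (h1.scomp s h2).sub_const _
  have hB' : ∀ s ∈ Ico l 1, HasDerivAt (fun s : ℝ => B * ((1 - l) ^ γ - (1 - s) ^ γ) / γ)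
      (B * (1 - s) ^ (γ - 1)) s := by
    intro s hs
    have h0 : 1 - s ≠ 0 := by linarith [hs.2]
    have h1 : HasDerivAt (fun s : ℝ => 1 - s) (-1) s := by
      simpa using (hasDerivAt_id s).const_sub 1
    have h2 := (((h1.rpow_const (p := γ) (Or.inl h0)).const_sub ((1 - l) ^ γ)).const_mul B).div_const γ
    refine h2.congr_deriv ?_
    rw [div_eq_iff hγ.ne']; ring
  have hBc : ContinuousOn (fun s : ℝ => B * ((1 - l) ^ γ - (1 - s) ^ γ) / γ) (Icc l 1) := by
    have : Continuous fun s : ℝ => (1 - s) ^ γ :=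
      (Real.continuous_rpow_const hγ.le).comp (continuous_const.sub continuous_id)
    exact ((continuous_const.mul (continuous_const.sub this)).div_const γ).continuousOn
  have key := image_norm_le_of_norm_deriv_right_le_deriv_boundary' (a := l) (b := 1)
    (f := fun s : ℝ => g (s * z) - g (l * z)) (f' := fun s : ℝ => z • deriv g (s * z))
    (B := fun s : ℝ => B * ((1 - l) ^ γ - (1 - s) ^ γ) / γ)
    (B' := fun s : ℝ => B * (1 - s) ^ (γ - 1))
    (fun s hs => (hd s hs).continuousAt.continuousWithinAt)
    (fun s hs => (hd s ⟨hs.1, hs.2.le⟩).hasDerivWithinAt) (by simp)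
    hBc (fun s hs => (hB' s hs).hasDerivWithinAt)
    (fun s hs => by
      have hs' : s ∈ Icc l 1 := ⟨hs.1, hs.2.le⟩
      rw [norm_smul]
      have h1 := h (s * z) (by rw [(hn s hs').1]; exact (hn s hs').2)
      rw [(hn s hs').1] at h1
      have h2 : (1 - s * ‖z‖) ^ (γ - 1) ≤ (1 - s) ^ (γ - 1) := by
        refine Real.rpow_le_rpow_of_nonpos (by linarith [hs.2]) ?_ (by linarith)
        nlinarith [hl.trans hs.1]
      calc ‖z‖ * ‖deriv g (s * z)‖ ≤ 1 * (B * (1 - s) ^ (γ - 1)) := by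
            gcongr
            exact h1.trans (by gcongr)
        _ = _ := one_mul _)
  have := key (x := 1) ⟨hl1, le_rfl⟩
  simpa [Real.zero_rpow hγ.ne'] using this

/-- The Hardy–Littlewood estimate. -/
theorem norm_sub_le_of_norm_deriv_le {g : ℂ → F} (hg : DifferentiableOn ℂ g (ball 0 1)) {B γ : ℝ}
    (hB : 0 ≤ B) (hγ : 0 < γ) (hγ1 : γ ≤ 1)
    (h : ∀ z : ℂ, ‖z‖ < 1 → ‖deriv g z‖ ≤ B * (1 - ‖z‖) ^ (γ - 1)) {z ζ : ℂ} (hz : ‖z‖ < 1)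
    (hζ : ‖ζ‖ < 1) : ‖g z - g ζ‖ ≤ B * (2 / γ + 1) * ‖z - ζ‖ ^ γ := by
  rcases eq_or_ne z ζ with rfl | hne
  · rw [sub_self, sub_self, norm_zero, norm_zero]; positivity
  have hd : 0 < ‖z - ζ‖ := norm_pos_iff.2 (sub_ne_zero.2 hne)
  set k := min ‖z - ζ‖ 1 with hk
  have hk0 : 0 < k := lt_min hd one_pos
  have hk1 : k ≤ 1 := min_le_right _ _
  have e1 := norm_sub_smul_le hg hB hγ hγ1 h hz (l := 1 - k) (by linarith) (by linarith)
  have e2 := norm_sub_smul_le hg hB hγ hγ1 h hζ (l := 1 - k) (by linarith) (by linarith)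
  rw [sub_sub_cancel] at e1 e2
  have e3 : ‖g (((1 - k : ℝ):ℂ) * z) - g (((1 - k : ℝ):ℂ) * ζ)‖ ≤ B * k ^ γ := by
    rcases le_or_gt ‖z - ζ‖ 1 with hle | hgt
    · have hkd : k = ‖z - ζ‖ := min_eq_left hle
      have hsub : ∀ x ∈ closedBall (0:ℂ) (1 - k), ‖x‖ ≤ 1 - k := fun x hx => by simpa using hx
      have hmem : ∀ w : ℂ, ‖w‖ < 1 → ((1 - k : ℝ):ℂ) * w ∈ closedBall (0:ℂ) (1 - k) := by
        intro w hw
        rw [mem_closedBall_zero_iff, norm_mul, Complex.norm_real, Real.norm_eq_abs,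
          abs_of_nonneg (by linarith)]
        nlinarith
      have := (convex_closedBall (0:ℂ) (1 - k)).norm_image_sub_le_of_norm_deriv_le
        (f := g) (C := B * k ^ (γ - 1)) (fun x hx => hg.differentiableAt (isOpen_ball.mem_nhds (by
          rw [mem_ball_zero_iff]; linarith [hsub x hx]))) (fun x hx => by
          refine (h x (by linarith [hsub x hx])).trans ?_
          have : (1 - ‖x‖) ^ (γ - 1) ≤ k ^ (γ - 1) :=
            Real.rpow_le_rpow_of_nonpos hk0 (by linarith [hsub x hx]) (by linarith)
          gcongr) (hmem ζ hζ) (hmem z hz)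
      refine this.trans ?_
      rw [← mul_sub, norm_mul, Complex.norm_real, Real.norm_eq_abs,
        abs_of_nonneg (by linarith : 0 ≤ 1 - k), ← hkd]
      calc B * k ^ (γ - 1) * ((1 - k) * k) ≤ B * k ^ (γ - 1) * (1 * k) := by
            have := Real.rpow_nonneg hk0.le (γ - 1)
            gcongr
            linarith
        _ = B * k ^ γ := by
            rw [Real.rpow_sub_one hk0.ne']; field_simp
    · have : k = 1 := min_eq_right hgt.le
      rw [this]
      simpa using hB
  have e4 : k ^ γ ≤ ‖z - ζ‖ ^ γ := Real.rpow_le_rpow hk0.le (min_le_left _ _) hγ.le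
  rw [norm_sub_rev] at e2
  have e5 : ‖g z - g ζ‖ ≤ ‖g z - g (((1 - k : ℝ):ℂ) * z)‖ +
      ‖g (((1 - k : ℝ):ℂ) * z) - g (((1 - k : ℝ):ℂ) * ζ)‖ +
      ‖g (((1 - k : ℝ):ℂ) * ζ) - g ζ‖ := by
    have : g z - g ζ = (g z - g (((1 - k : ℝ):ℂ) * z)) +
      (g (((1 - k : ℝ):ℂ) * z) - g (((1 - k : ℝ):ℂ) * ζ)) + (g (((1 - k : ℝ):ℂ) * ζ) - g ζ) := by
      abel
    rw [this]
    exact norm_add₃_le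
  calc ‖g z - g ζ‖ ≤ B * k ^ γ / γ + B * k ^ γ + B * k ^ γ / γ := by linarith
    _ = B * (2 / γ + 1) * k ^ γ := by field_simp; ring
    _ ≤ _ := by gcongr

theorem DiffContOnCl.norm_sub_le_of_norm_deriv_le {g : ℂ → F} (hg : DiffContOnCl ℂ g (ball 0 1))
    {B γ : ℝ} (hB : 0 ≤ B) (hγ : 0 < γ) (hγ1 : γ ≤ 1)
    (h : ∀ z : ℂ, ‖z‖ < 1 → ‖deriv g z‖ ≤ B * (1 - ‖z‖) ^ (γ - 1)) {z ζ : ℂ} (hz : ‖z‖ < 1)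
    (hζ : ‖ζ‖ ≤ 1) : ‖g ζ - g z‖ ≤ B * (2 / γ + 1) * ‖ζ - z‖ ^ γ := by
  have hc : ContinuousWithinAt g (ball 0 1) ζ :=
    (hg.continuousOn_ball ζ (by simpa using hζ)).mono ball_subset_closedBall
  have hcl : ζ ∈ closure (ball (0:ℂ) 1) := by
    rw [closure_ball _ one_ne_zero]; simpa using hζ
  refine ContinuousWithinAt.closure_le hcl (f := fun ζ => ‖g ζ - g z‖)
    (g := fun ζ => B * (2 / γ + 1) * ‖ζ - z‖ ^ γ) (hc.sub continuousWithinAt_const).norm ?_ ?_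
  · have : Continuous fun ζ : ℂ => ‖ζ - z‖ ^ γ :=
      (Real.continuous_rpow_const hγ.le).comp (by fun_prop)
    exact (continuous_const.mul this).continuousWithinAt
  · intro y hy
    rw [mem_ball_zero_iff] at hy
    exact InvDist.norm_sub_le_of_norm_deriv_le hg.differentiableOn hB hγ hγ1 h hy hz

theorem exists_diffContOnCl_extension [CompleteSpace F] {g : ℂ → F}
    (hg : DifferentiableOn ℂ g (ball 0 1)) {B γ : ℝ} (hB : 0 ≤ B) (hγ : 0 < γ) (hγ1 : γ ≤ 1)
    (h : ∀ z : ℂ, ‖z‖ < 1 → ‖deriv g z‖ ≤ B * (1 - ‖z‖) ^ (γ - 1)) :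
    ∃ f : ℂ → F, DiffContOnCl ℂ f (ball 0 1) ∧ EqOn f g (ball 0 1) := by
  have hext : EqOn (extendFrom (ball (0:ℂ) 1) g) g (ball 0 1) := fun x hx =>
    extendFrom_eq (subset_closure hx) (hg.continuousOn x hx)
  refine ⟨extendFrom (ball (0:ℂ) 1) g, ⟨hg.congr hext, ?_⟩, hext⟩
  refine continuousOn_extendFrom subset_rfl fun x hx => ?_
  have hne : (𝓝[ball (0:ℂ) 1] x).NeBot := mem_closure_iff_nhdsWithin_neBot.1 hx
  rw [← cauchy_map_iff_exists_tendsto, Metric.cauchy_iff]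
  refine ⟨hne.map g, fun ε hε => ?_⟩
  have ht : Tendsto (fun d : ℝ => B * (2 / γ + 1) * d ^ γ) (𝓝[>] 0) (𝓝 0) := by
    have h1 : Continuous fun d : ℝ => B * (2 / γ + 1) * d ^ γ :=
      continuous_const.mul (Real.continuous_rpow_const hγ.le)
    have h2 := h1.tendsto 0
    rw [Real.zero_rpow hγ.ne', mul_zero] at h2
    exact h2.mono_left nhdsWithin_le_nhds
  obtain ⟨d, hd, hd0⟩ := ((ht.eventually (gt_mem_nhds hε)).and self_mem_nhdsWithin).exists
  refine ⟨g '' (ball 0 1 ∩ ball x (d / 2)), image_mem_map (inter_mem_nhdsWithin _ (ball_mem_nhds _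
    (half_pos hd0))), ?_⟩
  rintro _ ⟨a, ⟨ha, hax⟩, rfl⟩ _ ⟨b, ⟨hb, hbx⟩, rfl⟩
  rw [mem_ball_zero_iff] at ha hb
  rw [dist_eq_norm]
  refine (norm_sub_le_of_norm_deriv_le hg hB hγ hγ1 h ha hb).trans_lt (lt_of_le_of_lt ?_ hd)
  have : ‖a - b‖ ≤ d := by
    rw [← dist_eq_norm]
    refine (dist_triangle_right a b x).trans ?_
    rw [mem_ball] at hax hbx
    linarith
  gcongr

end

lemma subLap_norm_sq {f : ℂ → ℂ} {z : ℂ} (hf : AnalyticAt ℂ f z) :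
    SubLap (fun x => ‖f x‖ ^ 2) z := by
  have h := subLap_re (f := fun x => (‖f z‖ ^ 2 : ℝ) + 2 * (starRingEnd ℂ (f z) * (f x - f z)))
    (z := z) (by fun_prop)
  refine h.mono (fun x => ?_) (by simp [← Complex.ofReal_pow])
  simp only [Complex.sq_norm, Complex.normSq_apply, Complex.add_re, Complex.mul_re, Complex.sub_re,
    Complex.sub_im, Complex.conj_re, Complex.conj_im, Complex.ofReal_re, Complex.re_ofNat,
    Complex.im_ofNat]
  nlinarith [sq_nonneg ((f x).re - (f z).re), sq_nonneg ((f x).im - (f z).im)]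

namespace Geom
variable (G : Geom α Ω)

theorem u_eq_zero_of_centred {φ : ℂ → E N} (h : DiffContOnCl ℂ φ (ball 0 1)) (hφ : G.IsCentred φ)
    {ζ : ℂ} (hζ : ‖ζ‖ = 1) : G.u (φ ζ) = 0 := by
  obtain ⟨C, hC, H⟩ := G.exists_growth
  have hm := mapsTo_closedBall h hφ.1.2.1
  have hζc : ζ ∈ closedBall (0:ℂ) 1 := by simp [hζ]
  refine le_antisymm ?_ (G.u_nonneg (hm hζc))
  have hc : ContinuousOn (fun z => G.u (φ z)) (closedBall 0 1) :=
    G.continuousOn_u.comp h.continuousOn_ball hm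
  have hcl : ζ ∈ closure (ball (0:ℂ) 1) := by
    rw [closure_ball _ one_ne_zero]; exact hζc
  have := ContinuousWithinAt.closure_le hcl (f := fun z => G.u (φ z))
    (g := fun z => C * G.u (φ 0) * (1 - ‖z‖)) ((hc ζ hζc).mono ball_subset_closedBall)
    (by fun_prop) (fun y hy => (H φ hφ y (by simpa using hy)).1)
  simpa [hζ] using this

/-- A quantitative Hopf lemma along centred geodesics. -/
theorem exists_hopf : ∃ c : ℝ, 0 < c ∧ ∀ φ : ℂ → E N, DiffContOnCl ℂ φ (ball 0 1) →
    G.IsCentred φ → ∀ z : ℂ, ‖z‖ ≤ 1 → c * G.u (φ 0) * (1 - ‖z‖ ^ 2) ≤ G.u (φ z) := by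
  obtain ⟨A, hA, HA⟩ := G.exists_deriv_estimate
  obtain ⟨C, hC, HC⟩ := G.exists_growth
  obtain ⟨c₁, a, -, ha, -, hbar⟩ := G.exists_bar_le
  have hl := G.hlam
  set r := 1 / (2 * (A * C)) with hr
  have hAC : 1 ≤ A * C := one_le_mul_of_one_le_of_one_le hA hC
  have hr0 : 0 < r := by positivity
  have hr1 : r ≤ 1 / 2 := by
    rw [hr, div_le_div_iff₀ (by positivity) (by positivity)]; linarith
  have hrAC : A * C * r = 1 / 2 := by rw [hr]; field_simp
  refine ⟨min (1 / 2) (a * r ^ 2 / (2 * G.lam)), by positivity, fun φ hdc hφ => ?_⟩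
  have hd := hφ.1.1
  have hm := hφ.1.2.1
  have hmc := mapsTo_closedBall hdc hm
  set D := G.u (φ 0) with hD
  have hD0 : 0 < D := G.u_pos (hm (by simp))
  have inner : ∀ z : ℂ, ‖z‖ ≤ r → D / 2 ≤ G.u (φ z) := by
    intro z hz
    have hpt : ∀ x ∈ closedBall (0:ℂ) r, ‖x‖ < 1 := fun x hx => by
      have : ‖x‖ ≤ r := by simpa using hx
      linarith
    have h1 : ∀ x ∈ closedBall (0:ℂ) r, HasFDerivWithinAt (fun z => G.u (φ z))
        (-((fderiv ℝ G.ρ (φ x)).comp ((fderiv ℂ φ x).restrictScalars ℝ))) (closedBall 0 r) x := by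
      intro x hx
      have hx1 := hpt x hx
      have h2 : DifferentiableAt ℂ φ x := hd.differentiableAt (isOpen_ball.mem_nhds (by simpa using hx1))
      have h3 : φ x ∈ thickening G.δ (closure Ω) :=
        G.closure_sub (subset_closure (hm (by simpa using hx1)))
      have h4 := ((G.C2 _ h3).differentiableAt (by norm_num)).hasFDerivAt
      exact (h4.comp x (h2.hasFDerivAt.restrictScalars ℝ)).neg.hasFDerivWithinAt
    have h2 := (convex_closedBall (0:ℂ) r).norm_image_sub_le_of_norm_hasFDerivWithin_le
      (C := A * C * D) h1 (fun x hx => ?_) (mem_closedBall_self hr0.le)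
      (show z ∈ closedBall (0:ℂ) r by simpa using hz)
    · rw [sub_zero, Real.norm_eq_abs] at h2
      have h3 := (abs_le.1 h2).1
      have h4 : A * C * D * ‖z‖ ≤ A * C * D * r := by gcongr
      have h5 : A * C * D * r = D / 2 := by
        calc A * C * D * r = (A * C * r) * D := by ring
          _ = _ := by rw [hrAC]; ring
      linarith
    · have hx1 := hpt x hx
      have e1 := (HA φ hd hm x hx1).2
      have e2 := (HC φ hφ x hx1).1
      have ht : 0 < 1 - ‖x‖ := by linarith
      have e3 : ‖ell G.ρ (φ x) (deriv φ x)‖ ≤ A * C * D := by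
        refine le_of_mul_le_mul_left ?_ ht
        calc _ ≤ A * (C * D * (1 - ‖x‖)) := e1.trans (by gcongr)
          _ = _ := by ring
      refine ContinuousLinearMap.opNorm_le_bound _ (by positivity) fun v => ?_
      rw [neg_apply, norm_neg, ContinuousLinearMap.comp_apply,
        ContinuousLinearMap.coe_restrictScalars']
      have e4 : fderiv ℂ φ x v = v • deriv φ x := by
        rw [← fderiv_apply_one_eq_deriv, ← map_smul]; simp
      rw [e4, ← re_ell, map_smul, Real.norm_eq_abs]
      refine (Complex.abs_re_le_norm _).trans ?_
      rw [norm_smul, mul_comm]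
      gcongr
  set b := a * D * r ^ 2 / 2 with hb
  have hb0 : 0 < b := by positivity
  set K : Set ℂ := closedBall 0 1 \ ball 0 r with hK
  set O : Set ℂ := ball 0 1 \ closedBall 0 r with hO
  have hKne : ∀ z ∈ K, r ≤ ‖z‖ ∧ ‖z‖ ≤ 1 := fun z hz => by
    have h1 := hz.1; have h2 := hz.2
    rw [mem_closedBall_zero_iff] at h1
    rw [mem_ball_zero_iff, not_lt] at h2
    exact ⟨h2, h1⟩
  have outer : ∀ z ∈ K, G.bar 0 (φ z) + b * ‖z⁻¹‖ ^ 2 ≤ b := by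
    refine max_principle (O := O) ((isCompact_closedBall _ _).diff isOpen_ball)
      (isOpen_ball.sdiff isClosed_closedBall)
      (fun z hz => ⟨ball_subset_closedBall hz.1, fun h => hz.2 (ball_subset_closedBall h)⟩) ?_ ?_ ?_
    · refine ContinuousOn.add ?_ ?_
      · exact (G.continuousOn_bar 0).comp (hdc.continuousOn_ball.mono sdiff_subset)
          fun z hz => G.closure_sub (hmc hz.1)
      · refine ContinuousOn.mul continuousOn_const (ContinuousOn.pow (ContinuousOn.norm ?_) 2)
        refine continuousOn_id.inv₀ fun z hz => ?_
        have := (hKne z hz).1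
        exact norm_pos_iff.1 (by simp only [id]; linarith)
    · intro z hz
      have hz1 : z ∈ ball (0:ℂ) 1 := hz.1
      have hz0 : z ≠ 0 := by
        rintro rfl
        exact hz.2 (mem_closedBall_self hr0.le)
      refine (G.subLap_bar le_rfl G.c₀_pos.le (hd.analyticAt (isOpen_ball.mem_nhds hz1))
        (G.closure_sub (subset_closure (hm hz1)))).add ?_
      exact (subLap_norm_sq (f := fun x => x⁻¹) (analyticAt_id.inv hz0)).const_mul hb0.le
    · intro z hz
      obtain ⟨h1, h2⟩ := hKne z hz.1
      have hzc : φ z ∈ closure Ω := hmc hz.1.1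
      have h3 := (hbar _ hzc).2
      rw [norm_inv]
      rcases h2.lt_or_eq with h4 | h4
      · have h5 : ‖z‖ = r := by
          refine le_antisymm ?_ h1
          by_contra hcon
          exact hz.2 ⟨by simpa using h4, by simpa using hcon⟩
        have h6 := inner z h5.le
        have h7 : a * (D / 2) ≤ a * G.u (φ z) := by gcongr
        have h8 : b * r⁻¹ ^ 2 = a * (D / 2) := by rw [hb]; field_simp
        rw [h5, h8]
        linarith
      · rw [h4, inv_one, one_pow, mul_one]
        have := G.u_nonneg hzc
        have : 0 ≤ a * G.u (φ z) := by positivity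
        linarith
  intro z hz
  have hz2 : ‖z‖ ^ 2 ≤ 1 := pow_le_one₀ (norm_nonneg z) hz
  rcases le_or_gt ‖z‖ r with h | h
  · refine le_trans ?_ (inner z h)
    have h1 : min (1 / 2) (a * r ^ 2 / (2 * G.lam)) ≤ 1 / 2 := min_le_left _ _
    calc _ ≤ 1 / 2 * D * (1 - ‖z‖ ^ 2) := by gcongr
      _ ≤ 1 / 2 * D * 1 := by gcongr; linarith [sq_nonneg ‖z‖]
      _ = _ := by ring
  · have h1 := outer z ⟨by simpa using hz, by simpa using h.le⟩
    have h2 := G.bar_ge 0 (φ z)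
    rw [zero_mul, sub_zero] at h2
    have hz0 : 0 < ‖z‖ := hr0.trans h
    have h3 : 1 - ‖z‖ ^ 2 ≤ ‖z⁻¹‖ ^ 2 - 1 := by
      rw [norm_inv]
      have : ‖z‖⁻¹ ^ 2 * ‖z‖ ^ 2 = 1 := by field_simp
      nlinarith [sq_nonneg (1 - ‖z‖ ^ 2), sq_nonneg (‖z‖⁻¹), sq_nonneg (‖z‖⁻¹ ^ 2 - 1), mul_nonneg (sq_nonneg ‖z‖⁻¹) (sq_nonneg (1 - ‖z‖ ^ 2))]
    have h4 : b * (1 - ‖z‖ ^ 2) ≤ G.lam * G.u (φ z) := by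
      have : b * (1 - ‖z‖ ^ 2) ≤ b * (‖z⁻¹‖ ^ 2 - 1) := by gcongr
      linarith
    have h5 : min (1 / 2) (a * r ^ 2 / (2 * G.lam)) ≤ a * r ^ 2 / (2 * G.lam) := min_le_right _ _
    calc _ ≤ a * r ^ 2 / (2 * G.lam) * D * (1 - ‖z‖ ^ 2) := by gcongr
      _ = b * (1 - ‖z‖ ^ 2) / G.lam := by rw [hb]; field_simp
      _ ≤ _ := by rw [div_le_iff₀ hl]; linarith

end Geom


/-- A disc with a larger derivative at the centre shortens the Kobayashi distance. -/
lemma exists_kobayashi_lt {f ψ : ℂ → E N} (hΩ : IsOpen Ω) (hf : DifferentiableOn ℂ f (ball 0 1))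
    (hψ : DiffContOnCl ℂ ψ (ball 0 1))
    (hψm : MapsTo ψ (closedBall (0:ℂ) 1) Ω) (h0 : ψ 0 = f 0) {l : ℂ} (hl : 1 < ‖l‖)
    (hd : deriv ψ 0 = l • deriv f 0) :
    ∃ ξ : ℂ, ‖ξ‖ < 1 ∧ kobayashi Ω (f 0) (f ξ) < artanh ‖ξ‖ := by
  have hl0 : l ≠ 0 := norm_pos_iff.1 (one_pos.trans hl)
  obtain ⟨r, hr, hrΩ⟩ := ((isCompact_closedBall (0:ℂ) 1).image_of_continuousOn
    hψ.continuousOn_ball).exists_cthickening_subset_open hΩ hψm.image_subset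
  have hb0 : ball (0:ℂ) 1 ∈ 𝓝 (0:ℂ) := ball_mem_nhds _ one_pos
  have df : HasDerivAt f (deriv f 0) 0 := (hf.differentiableAt hb0).hasDerivAt
  have dψ : HasDerivAt ψ (l • deriv f 0) (0 / l) := by
    rw [zero_div, ← hd]; exact (hψ.differentiableOn.differentiableAt hb0).hasDerivAt
  have dh : HasDerivAt (fun ξ : ℂ => f ξ - ψ (ξ / l)) 0 0 := by
    refine (df.sub (dψ.scomp 0 ((hasDerivAt_id (0:ℂ)).div_const l))).congr_deriv ?_
    rw [smul_smul]
    simp [hl0]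
  have lo := dh.isLittleO
  have hrl : 0 < r / ‖l‖ := by positivity
  have ev := (lo.def hrl).filter_mono (nhdsWithin_le_nhds (s := {(0:ℂ)}ᶜ))
  have ev2 : ∀ᶠ ξ : ℂ in 𝓝[≠] 0, ξ ∈ ball (0:ℂ) 1 := nhdsWithin_le_nhds hb0
  have ev3 : ∀ᶠ ξ : ℂ in 𝓝[≠] 0, ξ ≠ 0 := eventually_mem_nhdsWithin
  obtain ⟨ξ, h1, h2, h3⟩ := (ev.and (ev2.and ev3)).exists
  simp only [smul_zero, sub_zero, zero_div, h0, sub_self] at h1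
  rw [mem_ball_zero_iff] at h2
  have hξ : 0 < ‖ξ‖ := norm_pos_iff.2 h3
  set b := ξ / l with hb
  have hbn : ‖b‖ < ‖ξ‖ := by
    rw [hb, norm_div, div_lt_iff₀ (one_pos.trans hl)]; nlinarith
  have hbne : b ≠ 0 := div_ne_zero h3 hl0
  set e := f ξ - ψ b with he
  have hχm : MapsTo (fun ζ : ℂ => ψ ζ + (ζ / b) • e) (ball (0:ℂ) 1) Ω := by
    intro ζ hζ
    refine hrΩ (mem_cthickening_of_dist_le _ (ψ ζ) _ _ (mem_image_of_mem ψ (ball_subset_closedBall hζ)) ?_)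
    rw [mem_ball_zero_iff] at hζ
    rw [dist_eq_norm, add_sub_cancel_left, norm_smul, norm_div, hb, norm_div]
    calc ‖ζ‖ / (‖ξ‖ / ‖l‖) * ‖e‖ ≤ 1 / (‖ξ‖ / ‖l‖) * (r / ‖l‖ * ‖ξ‖) := by gcongr
      _ = r := by field_simp
  have hχd : DifferentiableOn ℂ (fun ζ : ℂ => ψ ζ + (ζ / b) • e) (ball 0 1) := by
    refine hψ.differentiableOn.add (Differentiable.differentiableOn ?_)
    fun_prop
  have key := (Reach.disc hχd hχm (a := 0) (b := b) (by simp) (hbn.trans h2)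
    (le_of_eq (poincare_zero_left b))).kobayashi_le
  simp only [zero_div, zero_smul, add_zero, div_self hbne, one_smul, he, h0] at key
  rw [add_sub_cancel] at key
  exact ⟨ξ, h2, key.trans_lt (artanh_strictMono (norm_nonneg _) hbn h2)⟩

namespace Geom
variable (G : Geom α Ω)

lemma continuousOn_ell : ContinuousOn (ell G.ρ) (closure Ω) := by
  refine LipschitzOnWith.continuousOn (K := G.M.toNNReal) (LipschitzOnWith.of_dist_le_mul ?_)
  intro x hx y hy
  rw [dist_eq_norm, dist_eq_norm, ell_sub_norm, Real.coe_toNNReal _ G.M_pos.le]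
  exact G.lip y hy x hx

lemma mapsTo_of_sphere {ψ : ℂ → E N} (hψ : DiffContOnCl ℂ ψ (ball 0 1))
    (hn : MapsTo ψ (closedBall (0:ℂ) 1) (thickening G.δ (closure Ω)))
    (hs : ∀ ω : ℂ, ‖ω‖ = 1 → G.ρ (ψ ω) < 0) : MapsTo ψ (closedBall (0:ℂ) 1) Ω := by
  have hbar : ∀ x, (G.bar 0 x < 0 ↔ G.ρ x < 0) := by
    intro x
    have h1 : Real.exp (-(G.lam * G.κ)) - 1 < 0 := by
      have := Real.exp_lt_one_iff.2 (neg_lt_zero.2 (mul_pos G.hlam G.hκ)); linarith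
    rw [bar, max_lt_iff, zero_mul, sub_zero, sub_neg, Real.exp_lt_one_iff]
    exact ⟨fun h => neg_of_mul_neg_right h.1 G.hlam.le, fun h => ⟨mul_neg_of_pos_of_neg G.hlam h, h1⟩⟩
  have cb : ContinuousOn (fun ξ => G.bar 0 (ψ ξ)) (closedBall (0:ℂ) 1) :=
    (G.continuousOn_bar 0).comp hψ.continuousOn_ball hn
  obtain ⟨ω₀, hω₀, hmax⟩ := (isCompact_sphere (0:ℂ) 1).exists_isMaxOn
    (NormedSpace.sphere_nonempty.2 zero_le_one) (cb.mono sphere_subset_closedBall)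
  intro z hz
  refine G.inside _ (hn hz) ((hbar _).1 ?_)
  refine lt_of_le_of_lt ?_ ((hbar _).2 (hs ω₀ (by simpa using hω₀)))
  refine max_principle (isCompact_closedBall (0:ℂ) 1) isOpen_ball ball_subset_closedBall cb
    (fun w hw => G.subLap_bar le_rfl G.c₀_pos.le
      (hψ.differentiableOn.analyticAt (isOpen_ball.mem_nhds hw))
      (hn (ball_subset_closedBall hw))) ?_ z hz
  intro w hw
  rw [closedBall_sdiff_ball] at hw
  exact hmax hw

lemma re_pos_of_sphere {q : Polynomial ℂ} {η : ℝ}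
    (hq : ∀ ω : ℂ, ‖ω‖ = 1 → η ≤ (q.eval ω).re) : ∀ z : ℂ, ‖z‖ ≤ 1 → η ≤ (q.eval z).re := by
  intro z hz
  have := max_principle (isCompact_closedBall (0:ℂ) 1) isOpen_ball ball_subset_closedBall
    (w := fun x => (-q.eval x).re) (b := -η)
    (by have : Continuous fun x => (-q.eval x).re := by fun_prop
        exact this.continuousOn)
    (fun z _ => subLap_re (q.differentiable.analyticAt z).neg)
    (fun z hz => by
      rw [closedBall_sdiff_ball] at hz
      have := hq z (by simpa using hz)
      simp only [Complex.neg_re]; linarith) z (by simpa using hz)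
  simp only [Complex.neg_re] at this; linarith

lemma exists_perturb {f k : ℂ → E N} (hf : DiffContOnCl ℂ f (ball 0 1))
    (hm : MapsTo f (ball (0:ℂ) 1) Ω) (hk : DiffContOnCl ℂ k (ball 0 1)) {W : ℂ → ℝ}
    (hW : ContinuousOn W (closedBall 0 1)) (hW0 : ∀ ω : ℂ, ‖ω‖ ≤ 1 → 0 < W ω)
    (hu : ∀ ω : ℂ, ‖ω‖ ≤ 1 → W ω * (1 - ‖ω‖ ^ 2) ≤ G.u (f ω))
    {q : Polynomial ℂ} {η : ℝ} (hη : 0 < η) (hq : ∀ ω : ℂ, ‖ω‖ = 1 → η ≤ (q.eval ω).re)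
    (hqW : ∀ ω : ℂ, ‖ω‖ = 1 → (ell G.ρ (f ω) (ω • k ω)).re + η ≤ (q.eval ω).re * W ω) :
    ∃ ε₀ > 0, ∀ ε : ℝ, 0 < ε → ε < ε₀ →
      DiffContOnCl ℂ (fun ω => f (ω * Complex.exp (-(ε * q.eval ω))) + (ε * ω) • k ω) (ball 0 1) ∧
      MapsTo (fun ω => f (ω * Complex.exp (-(ε * q.eval ω))) + (ε * ω) • k ω)
        (closedBall (0:ℂ) 1) Ω := by
  have hmc := mapsTo_closedBall hf hm
  have hq' := re_pos_of_sphere hq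
  have hs : ∀ ε : ℝ, ∀ ω : ℂ, ‖ω * Complex.exp (-(ε * q.eval ω))‖ =
      ‖ω‖ * Real.exp (-(ε * (q.eval ω).re)) := by
    intro ε ω
    rw [norm_mul, Complex.norm_exp]
    simp
  have hs1 : ∀ ε : ℝ, 0 ≤ ε → ∀ ω : ℂ, ‖ω‖ ≤ 1 → ‖ω * Complex.exp (-(ε * q.eval ω))‖ ≤ 1 := by
    intro ε hε ω hω
    rw [hs]
    refine mul_le_one₀ hω (Real.exp_pos _).le (Real.exp_le_one_iff.2 ?_)
    have := mul_nonneg hε (hη.le.trans (hq' ω hω)); linarith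
  have hs2 : ∀ ε : ℝ, 0 < ε → ∀ ω : ℂ, ‖ω‖ ≤ 1 → ‖ω * Complex.exp (-(ε * q.eval ω))‖ < 1 := by
    intro ε hε ω hω
    rw [hs]
    have h1 := mul_pos hε (hη.trans_le (hq' ω hω))
    have h2 : Real.exp (-(ε * (q.eval ω).re)) < 1 := Real.exp_lt_one_iff.2 (by linarith)
    calc _ ≤ 1 * Real.exp (-(ε * (q.eval ω).re)) := by gcongr
      _ < 1 := by linarith
  obtain ⟨K, hK⟩ := (isCompact_closedBall (0:ℂ) 1).exists_bound_of_continuousOn hk.continuousOn_ball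
  have hK0 : 0 ≤ K := (norm_nonneg _).trans (hK 0 (by simp))
  obtain ⟨Q, hQ⟩ := (isCompact_closedBall (0:ℂ) 1).exists_bound_of_continuousOn
    (q.continuous.continuousOn (s := closedBall (0:ℂ) 1))
  set H : ℝ × ℂ → ℝ := fun p =>
    (ell G.ρ (f (p.2 * Complex.exp (-(p.1 * q.eval p.2)))) (p.2 • k p.2)).re
      - (q.eval p.2).re * W (p.2 * Complex.exp (-(p.1 * q.eval p.2))) + G.M * p.1 * K ^ 2 with hH
  set S : Set (ℝ × ℂ) := Icc (0:ℝ) 1 ×ˢ sphere (0:ℂ) 1 with hS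
  have hSc : IsCompact S := isCompact_Icc.prod (isCompact_sphere _ _)
  have cs : Continuous fun p : ℝ × ℂ => p.2 * Complex.exp (-(p.1 * q.eval p.2)) := by
    have : Continuous fun p : ℝ × ℂ => q.eval p.2 := q.continuous.comp continuous_snd
    fun_prop
  have hSm : MapsTo (fun p : ℝ × ℂ => p.2 * Complex.exp (-(p.1 * q.eval p.2))) S
      (closedBall (0:ℂ) 1) := by
    rintro ⟨ε, ω⟩ ⟨h1, h2⟩
    rw [mem_closedBall_zero_iff]
    exact hs1 ε h1.1 ω (by simpa using h2.le)
  have hS2 : MapsTo (Prod.snd : ℝ × ℂ → ℂ) S (closedBall (0:ℂ) 1) := fun p hp =>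
    sphere_subset_closedBall hp.2
  have cfs : ContinuousOn (fun p : ℝ × ℂ => f (p.2 * Complex.exp (-(p.1 * q.eval p.2)))) S :=
    hf.continuousOn_ball.comp cs.continuousOn hSm
  have cH : ContinuousOn H S := by
    have c1 : ContinuousOn (fun p : ℝ × ℂ =>
        ell G.ρ (f (p.2 * Complex.exp (-(p.1 * q.eval p.2))))) S :=
      G.continuousOn_ell.comp cfs fun p hp => hmc (hSm hp)
    have c2 : ContinuousOn (fun p : ℝ × ℂ => p.2 • k p.2) S :=
      continuousOn_snd.smul (hk.continuousOn_ball.comp continuousOn_snd hS2)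
    have c3 : ContinuousOn (fun p : ℝ × ℂ => W (p.2 * Complex.exp (-(p.1 * q.eval p.2)))) S :=
      hW.comp cs.continuousOn hSm
    have c4 : Continuous fun p : ℝ × ℂ => (q.eval p.2).re :=
      Complex.continuous_re.comp (q.continuous.comp continuous_snd)
    have c5 : Continuous fun p : ℝ × ℂ => G.M * p.1 * K ^ 2 := by fun_prop
    exact ((Complex.continuous_re.comp_continuousOn (c1.clm_apply c2)).sub
      (c4.continuousOn.mul c3)).add c5.continuousOn
  obtain ⟨d, hd, hdH⟩ := Metric.uniformContinuousOn_iff.1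
    (hSc.uniformContinuousOn_of_continuous cH) η hη
  have hHneg : ∀ ε : ℝ, 0 < ε → ε < min d 1 → ∀ ω : ℂ, ‖ω‖ = 1 → H (ε, ω) < 0 := by
    intro ε h0 h1 ω hω
    have hωs : ω ∈ sphere (0:ℂ) 1 := by simpa using hω
    have e1 := hdH (ε, ω) ⟨⟨h0.le, (h1.trans_le (min_le_right _ _)).le⟩, hωs⟩ (0, ω)
      ⟨⟨le_rfl, zero_le_one⟩, hωs⟩ (by
        rw [Prod.dist_eq, dist_self, Real.dist_eq, sub_zero, abs_of_pos h0]
        exact max_lt (h1.trans_le (min_le_left _ _)) hd)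
    rw [Real.dist_eq] at e1
    have e2 := (abs_lt.1 e1).2
    have e3 : H (0, ω) ≤ -η := by
      have := hqW ω hω
      simp only [hH, Complex.ofReal_zero, zero_mul, neg_zero, Complex.exp_zero, mul_one, mul_zero,
        add_zero]
      linarith
    linarith
  refine ⟨min (min d 1) (min (1 / (2 * (Q + 1))) (G.δ / (K + 1))), ?_, ?_⟩
  · have : 0 ≤ Q := (norm_nonneg _).trans (hQ 0 (by simp))
    have := G.hδ
    positivity
  intro ε h0 hε
  have hε1 : ε < min d 1 := hε.trans_le (min_le_left _ _)
  have hεQ : ε < 1 / (2 * (Q + 1)) := hε.trans_le ((min_le_right _ _).trans (min_le_left _ _))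
  have hεK : ε < G.δ / (K + 1) := hε.trans_le ((min_le_right _ _).trans (min_le_right _ _))
  have hQ0 : 0 ≤ Q := (norm_nonneg _).trans (hQ 0 (by simp))
  have hdψ : DiffContOnCl ℂ (fun ω => f (ω * Complex.exp (-(ε * q.eval ω))) + (ε * ω) • k ω)
      (ball 0 1) := by
    refine DiffContOnCl.add ?_ ?_
    · have e : Differentiable ℂ fun ω => ω * Complex.exp (-(ε * q.eval ω)) := by
        have := q.differentiable
        fun_prop
      refine DifferentiableOn.diffContOnCl ?_
      rw [closure_ball _ one_ne_zero]
      refine fun ω hω => DifferentiableAt.differentiableWithinAt ?_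
      have h1 := hs2 ε h0 ω (by simpa using hω)
      exact (hf.differentiableOn.differentiableAt
        (isOpen_ball.mem_nhds (by simpa using h1))).comp ω e.differentiableAt
    · have : Differentiable ℂ fun ω : ℂ => (ε:ℂ) * ω := by fun_prop
      exact this.diffContOnCl.smul hk
  have hsmall : ∀ ω : ℂ, ‖ω‖ ≤ 1 → ‖((ε:ℂ) * ω) • k ω‖ ≤ ε * K := by
    intro ω hω
    rw [norm_smul, norm_mul, Complex.norm_real, Real.norm_of_nonneg h0.le]
    have := hK ω (by simpa using hω)
    calc ε * ‖ω‖ * ‖k ω‖ ≤ ε * 1 * K := by gcongr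
      _ = _ := by ring
  have hεδ : ε * K < G.δ := by
    rw [lt_div_iff₀ (by linarith)] at hεK
    nlinarith
  refine ⟨hdψ, G.mapsTo_of_sphere hdψ ?_ ?_⟩
  · intro ω hω
    rw [mem_closedBall_zero_iff] at hω
    refine mem_thickening_iff.2 ⟨f (ω * Complex.exp (-(ε * q.eval ω))),
      hmc (by simpa using hs1 ε h0.le ω hω), ?_⟩
    rw [dist_eq_norm, add_sub_cancel_left]
    exact (hsmall ω hω).trans_lt hεδ
  · intro ω hω
    set x := f (ω * Complex.exp (-(ε * q.eval ω))) with hx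
    have hxc : x ∈ closure Ω := hmc (by simpa using hs1 ε h0.le ω hω.le)
    have t := G.taylor_near x hxc (x + ((ε:ℂ) * ω) • k ω) (by
      rw [add_sub_cancel_left]; exact (hsmall ω hω.le).trans_lt hεδ)
    rw [add_sub_cancel_left] at t
    have t1 := (abs_le.1 t).2
    have t2 : ‖((ε:ℂ) * ω) • k ω‖ ^ 2 ≤ (ε * K) ^ 2 := by
      have := hsmall ω hω.le; gcongr
    have t3 : fderiv ℝ G.ρ x (((ε:ℂ) * ω) • k ω) = ε * (ell G.ρ x (ω • k ω)).re := by
      rw [← re_ell, mul_smul, map_smul, smul_eq_mul, Complex.re_ofReal_mul]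
    have hre0 : 0 < (q.eval ω).re := hη.trans_le (hq ω hω)
    have t4 : ε * (q.eval ω).re * W (ω * Complex.exp (-(ε * q.eval ω))) ≤ G.u x := by
      refine le_trans ?_ (hu _ (hs1 ε h0.le ω hω.le))
      rw [mul_comm]
      have hWp := hW0 _ (hs1 ε h0.le ω hω.le)
      refine mul_le_mul_of_nonneg_left ?_ hWp.le
      rw [hs, hω, one_mul, ← Real.exp_nat_mul]
      set y := ε * (q.eval ω).re with hy
      have hy0 : 0 < y := mul_pos h0 hre0
      have hy1 : y ≤ 1 / 2 := by
        have h1 : (q.eval ω).re ≤ Q :=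
          (Complex.re_le_norm _).trans (hQ ω (by simpa using hω.le))
        rw [lt_div_iff₀ (by linarith)] at hεQ
        nlinarith
      have h2 : Real.exp (((2:ℕ):ℝ) * -y) * (1 + 2 * y) ≤ 1 := by
        have h3 := Real.add_one_le_exp (2 * y)
        calc _ ≤ Real.exp (((2:ℕ):ℝ) * -y) * Real.exp (2 * y) := by gcongr; linarith
          _ = 1 := by rw [← Real.exp_add]; simp
      have h4 : 1 ≤ (1 - y) * (1 + 2 * y) := by nlinarith
      have h5 : Real.exp (((2:ℕ):ℝ) * -y) ≤ 1 - y :=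
        le_of_mul_le_mul_right (h2.trans h4) (by linarith)
      linarith
    have t5 := hHneg ε h0 hε1 ω hω
    simp only [hH] at t5
    rw [← hx] at t5
    have t6 : ε * ((ell G.ρ x (ω • k ω)).re - (q.eval ω).re *
      W (ω * Complex.exp (-(ε * q.eval ω))) + G.M * ε * K ^ 2) < 0 := mul_neg_of_pos_of_neg h0 t5
    have t7 : G.M * ‖((ε:ℂ) * ω) • k ω‖ ^ 2 ≤ G.M * (ε * K) ^ 2 := by
      have := G.M_pos; gcongr
    rw [u] at t4
    rw [t3] at t1
    linarith

set_option maxHeartbeats 800000 in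
/-- First variation inequality at the centre of a length-minimizing disc. -/
theorem variation {f k : ℂ → E N} (hf : DiffContOnCl ℂ f (ball 0 1))
    (hm : MapsTo f (ball (0:ℂ) 1) Ω)
    (hext : ∀ ξ : ℂ, ‖ξ‖ < 1 → artanh ‖ξ‖ ≤ kobayashi Ω (f 0) (f ξ))
    (hk : DiffContOnCl ℂ k (ball 0 1)) {W : ℂ → ℝ}
    (hW : ContinuousOn W (closedBall 0 1)) (hW0 : ∀ ω : ℂ, ‖ω‖ ≤ 1 → 0 < W ω)
    (hu : ∀ ω : ℂ, ‖ω‖ ≤ 1 → W ω * (1 - ‖ω‖ ^ 2) ≤ G.u (f ω)) {β : ℂ}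
    (hβ : k 0 = β • deriv f 0) :
    β.re ≤ ∫ ω, max (ell G.ρ (f ω) (ω • k ω)).re 0 / W ω ∂circ := by
  have hmc := mapsTo_closedBall hf hm
  by_contra hcon
  push Not at hcon
  set g : ℂ → ℝ := fun ω => max (ell G.ρ (f ω) (ω • k ω)).re 0 / W ω with hg
  have cell : ContinuousOn (fun ω => ell G.ρ (f ω)) (sphere (0:ℂ) 1) :=
    G.continuousOn_ell.comp (DiffContOnCl.continuousOn_sphere hf)
      fun ω hω => hmc (sphere_subset_closedBall hω)
  have cg : ContinuousOn g (sphere (0:ℂ) 1) := by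
    refine ContinuousOn.div (ContinuousOn.sup ?_ continuousOn_const)
      (hW.mono sphere_subset_closedBall) fun ω hω => (hW0 ω (by simpa using hω.le)).ne'
    exact Complex.continuous_re.comp_continuousOn
      (cell.clm_apply (continuousOn_id.smul (DiffContOnCl.continuousOn_sphere hk)))
  set η := (β.re - ∫ ω, g ω ∂circ) / 4 with hη
  have hη0 : 0 < η := by rw [hη]; linarith
  obtain ⟨q, hq⟩ := exists_poly_approx (g := fun ω => g ω + 2 * η) (cg.add continuousOn_const) hη0
  have cq : ContinuousOn (fun ω => q.eval ω) (sphere (0:ℂ) 1) := q.continuous.continuousOn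
  have q0 : (q.eval 0).re < β.re := by
    have e1 : ∫ ω, q.eval ω ∂circ = q.eval 0 :=
      DiffContOnCl.integral_circ (q.differentiable.diffContOnCl)
    have e2 := integral_re (integrable_circ cq)
    rw [e1] at e2
    have e3 : ∫ ω, (q.eval ω).re ∂circ ≤ ∫ ω, (g ω + 3 * η) ∂circ :=
      integral_circ_mono (Complex.continuous_re.comp_continuousOn cq) (cg.add continuousOn_const)
        fun ω hω => by have := (abs_le.1 (hq ω hω)).1; linarith
    have i1 : Integrable (fun ω => g ω) circ := integrable_circ cg
    have i2 : Integrable (fun _ : ℂ => 3 * η) circ := integrable_const _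
    rw [integral_add i1 i2, integral_circ_const] at e3
    have e4 : ∫ ω, (q.eval ω).re ∂circ = (q.eval 0).re := e2
    rw [e4] at e3
    linarith
  have g0 : ∀ ω : ℂ, ‖ω‖ = 1 → 0 ≤ g ω := fun ω hω =>
    div_nonneg (le_max_right _ _) (hW0 ω hω.le).le
  obtain ⟨ω₀, hω₀, hmin⟩ := (isCompact_sphere (0:ℂ) 1).exists_isMinOn
    (NormedSpace.sphere_nonempty.2 zero_le_one) (hW.mono sphere_subset_closedBall)
  have hw0 := hW0 ω₀ (by simpa using hω₀.le)
  obtain ⟨ε₀, hε₀, hP⟩ := G.exists_perturb hf hm hk hW hW0 hu (q := q)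
    (η := min η (η * W ω₀)) (lt_min hη0 (mul_pos hη0 hw0))
    (fun ω hω => by
      have := (abs_le.1 (hq ω hω)).2
      have := g0 ω hω
      exact (min_le_left _ _).trans (by linarith))
    (fun ω hω => by
      have h1 := (abs_le.1 (hq ω hω)).2
      have h2 : W ω₀ ≤ W ω := hmin (by simpa using hω)
      have h3 : (ell G.ρ (f ω) (ω • k ω)).re ≤ g ω * W ω := by
        rw [hg]
        simp only
        rw [div_mul_cancel₀ _ (hW0 ω hω.le).ne']
        exact le_max_left _ _
      have h4 : (g ω + η) * W ω ≤ (q.eval ω).re * W ω :=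
        mul_le_mul_of_nonneg_right (by linarith) (hW0 ω hω.le).le
      have h5 : η * W ω₀ ≤ η * W ω := mul_le_mul_of_nonneg_left h2 hη0.le
      have h6 := min_le_right η (η * W ω₀)
      linarith)
  have hder : HasDerivAt (fun ε : ℝ => (Complex.exp (-(ε * q.eval 0)) + ε * β).re)
      (-q.eval 0 + β).re 0 := by
    have h1 : HasDerivAt (fun ε : ℂ => Complex.exp (-(ε * q.eval 0)) + ε * β)
        (-q.eval 0 + β) ((0:ℝ):ℂ) := by
      refine ((((hasDerivAt_id _).mul_const (q.eval 0)).neg.cexp).add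
        ((hasDerivAt_id _).mul_const β)).congr_deriv ?_
      simp
    exact h1.real_of_complex
  have hpos : 0 < (-q.eval 0 + β).re := by simp only [Complex.add_re, Complex.neg_re]; linarith
  have hev := (hder.tendsto_slope.eventually (lt_mem_nhds hpos)).filter_mono
    (nhdsWithin_mono 0 (fun x (hx : 0 < x) => hx.ne') : 𝓝[>] (0:ℝ) ≤ 𝓝[≠] 0)
  obtain ⟨ε, h1, h2⟩ := (hev.and (Ioo_mem_nhdsGT hε₀)).exists
  obtain ⟨hdψ, hmψ⟩ := hP ε h2.1 h2.2
  rw [slope_def_field] at h1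
  have hl : 1 < (Complex.exp (-(ε * q.eval 0)) + ε * β).re := by
    rw [sub_zero] at h1
    have := (div_pos_iff_of_pos_right h2.1).1 h1
    simp at this ⊢
    linarith
  obtain ⟨ξ, hξ, hlt⟩ := exists_kobayashi_lt G.isOpen hf.differentiableOn hdψ hmψ (by simp)
    (hl.trans_le (Complex.re_le_norm _)) (by
      have hb0 : ball (0:ℂ) 1 ∈ 𝓝 (0:ℂ) := ball_mem_nhds _ one_pos
      have d1 : HasDerivAt f (deriv f 0) (0 * Complex.exp (-(ε * q.eval 0))) := by
        rw [zero_mul]; exact (hf.differentiableOn.differentiableAt hb0).hasDerivAt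
      have d2 : HasDerivAt k (deriv k 0) 0 := (hk.differentiableOn.differentiableAt hb0).hasDerivAt
      have d3 : HasDerivAt (fun ω => Complex.exp (-(ε * q.eval ω)))
          (deriv (fun ω => Complex.exp (-(ε * q.eval ω))) 0) 0 := by
        have := q.differentiable
        exact DifferentiableAt.hasDerivAt (by fun_prop)
      have d4 := (d1.scomp 0 ((hasDerivAt_id (0:ℂ)).mul d3)).add
        (((hasDerivAt_id (0:ℂ)).const_mul (ε:ℂ)).smul d2)
      refine d4.deriv.trans ?_
      simp only [id, hβ, mul_zero, zero_mul, one_mul, mul_one, add_zero, zero_smul,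
        zero_add, add_smul, mul_smul])
  exact absurd (hext ξ hξ) (not_le.2 hlt)

end Geom

end

lemma integral_abs_le_norm {X : Type*} [MeasurableSpace X] {μ : Measure X} [IsProbabilityMeasure μ]
    (h : Lp ℝ 2 μ) : ∫ x, ‖h x‖ ∂μ ≤ ‖h‖ := by
  rw [integral_norm_eq_lintegral_enorm (Lp.aestronglyMeasurable h), ← eLpNorm_one_eq_lintegral_enorm,
    Lp.norm_def]
  exact ENNReal.toReal_mono (Lp.eLpNorm_ne_top h)
    (eLpNorm_le_eLpNorm_of_exponent_le (by norm_num) (Lp.aestronglyMeasurable h))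

/-- A linear functional dominated by an asymmetric weighted `L¹` seminorm is represented by a
density between zero and the weight. -/
theorem exists_density {X V : Type*} [MeasurableSpace X] {μ : Measure X} [IsProbabilityMeasure μ]
    [AddCommGroup V] [Module ℝ V] (L : V →ₗ[ℝ] ℝ) (T : V →ₗ[ℝ] Lp ℝ 2 μ) {w : X → ℝ} {B : ℝ}
    (hwm : AEStronglyMeasurable w μ) (hw0 : ∀ᵐ x ∂μ, 0 ≤ w x) (hwB : ∀ᵐ x ∂μ, w x ≤ B)
    (hL : ∀ v, L v ≤ ∫ x, max (T v x) 0 * w x ∂μ) :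
    ∃ p : X → ℝ, AEStronglyMeasurable p μ ∧ (∀ᵐ x ∂μ, 0 ≤ p x) ∧ (∀ᵐ x ∂μ, p x ≤ w x) ∧
      ∀ v, L v = ∫ x, p x * T v x ∂μ := by
  have hwn : ∀ᵐ x ∂μ, ‖w x‖ ≤ B := by
    filter_upwards [hw0, hwB] with x h1 h2
    rwa [Real.norm_of_nonneg h1]
  have hint : ∀ h : Lp ℝ 2 μ, Integrable (fun x => max (h x) 0 * w x) μ := fun h =>
    ((((Lp.memLp h).integrable one_le_two).sup (integrable_const 0)).bdd_mul hwm hwn).congr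
      (ae_of_all _ fun x => mul_comm _ _)
  set S : Lp ℝ 2 μ → ℝ := fun h => ∫ x, max (h x) 0 * w x ∂μ with hS
  have hSadd : ∀ g h, S (g + h) ≤ S g + S h := by
    intro g h
    simp only [hS]
    rw [← integral_add (hint g) (hint h)]
    refine integral_mono_ae (hint _) ((hint g).add (hint h)) ?_
    filter_upwards [Lp.coeFn_add g h, hw0] with x h1 h2
    simp only [h1, Pi.add_apply, ← add_mul]
    refine mul_le_mul_of_nonneg_right (max_le ?_ ?_) h2
    · exact add_le_add (le_max_left _ _) (le_max_left _ _)
    · exact add_nonneg (le_max_right _ _) (le_max_right _ _)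
  have hSsmul : ∀ c : ℝ, 0 < c → ∀ h, S (c • h) = c * S h := by
    intro c hc h
    simp only [hS]
    rw [← integral_const_mul]
    refine integral_congr_ae ?_
    filter_upwards [Lp.coeFn_smul c h] with x h1
    simp only [h1, Pi.smul_apply, smul_eq_mul]
    rw [← mul_assoc, mul_max_of_nonneg _ _ hc.le, mul_zero]
  have hSB : ∀ h, S h ≤ |B| * ‖h‖ := by
    intro h
    have h1 : S h ≤ ∫ x, |B| * ‖h x‖ ∂μ := by
      refine integral_mono_ae (hint h) (((Lp.memLp h).integrable one_le_two).norm.const_mul _) ?_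
      filter_upwards [hw0, hwB] with x e1 e2
      rw [mul_comm]
      refine mul_le_mul (e2.trans (le_abs_self _)) (max_le (le_abs_self _) (norm_nonneg _))
        (le_max_right _ _) (abs_nonneg _)
    rw [integral_const_mul] at h1
    exact h1.trans (mul_le_mul_of_nonneg_left (integral_abs_le_norm h) (abs_nonneg _))
  obtain ⟨F, hF1, hF2⟩ := exists_extension_of_le_sublinear
    (E := V × Lp ℝ 2 μ)
    ⟨LinearMap.range (LinearMap.inl ℝ V (Lp ℝ 2 μ)),
      (L ∘ₗ LinearMap.fst ℝ V (Lp ℝ 2 μ)).domRestrict _⟩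
    (fun x => S (x.2 + T x.1))
    (fun c hc x => by
      change S (c • x.2 + T (c • x.1)) = c * S (x.2 + T x.1)
      rw [map_smul, ← smul_add]
      exact hSsmul c hc _)
    (fun x y => by
      change S (x.2 + y.2 + T (x.1 + y.1)) ≤ S (x.2 + T x.1) + S (y.2 + T y.1)
      rw [map_add, add_add_add_comm]
      exact hSadd _ _)
    (by
      rintro ⟨_, v, rfl⟩
      simpa [hS, LinearPMap.mk_apply] using hL v)
  have hFL : ∀ v, F (v, 0) = L v := fun v => hF1 ⟨(v, 0), v, rfl⟩
  have hS0 : S 0 = 0 := le_antisymm (by simpa using hSB 0) (by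
    have := hSadd 0 0; simp only [add_zero] at this; linarith)
  have hFT : ∀ v, F (v, 0) = F (0, T v) := by
    intro v
    have h1 : F (v, -T v) ≤ 0 := by
      have := hF2 (v, -T v); simpa [hS0] using this
    have h2 : F (-v, T v) ≤ 0 := by
      have := hF2 (-v, T v); simpa [hS0] using this
    have e1 : F (v, -T v) = F (v, 0) - F (0, T v) := by rw [← map_sub]; simp
    have e2 : F (-v, T v) = F (0, T v) - F (v, 0) := by rw [← map_sub]; simp
    linarith
  have hFS : ∀ h, F (0, h) ≤ S h := fun h => by simpa using hF2 (0, h)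
  set Φ : Lp ℝ 2 μ →L[ℝ] ℝ := (F ∘ₗ LinearMap.inr ℝ V (Lp ℝ 2 μ)).mkContinuous |B| (fun h => by
    rw [Real.norm_eq_abs, abs_le]
    have h1 := (hFS h).trans (hSB h)
    have h2 := (hFS (-h)).trans (hSB (-h))
    have h3 : F (0, -h) = -F (0, h) := by rw [← map_neg]; simp
    rw [norm_neg, h3] at h2
    exact ⟨by simpa using by linarith, h1⟩) with hΦ
  set p : Lp ℝ 2 μ := (InnerProductSpace.toDual ℝ (Lp ℝ 2 μ)).symm Φ with hp
  have hpF : ∀ h, F (0, h) = ∫ x, p x * h x ∂μ := by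
    intro h
    have h1 : inner ℝ p h = Φ h := InnerProductSpace.toDual_symm_apply
    rw [L2.inner_def] at h1
    have h2 : Φ h = F (0, h) := rfl
    rw [← h2, ← h1]
    refine integral_congr_ae (ae_of_all _ fun x => ?_)
    simp [mul_comm]
  have hpi : Integrable (fun x => p x) μ := (Lp.memLp p).integrable one_le_two
  have hwi : Integrable w μ := Integrable.of_bound hwm B hwn
  have hset : ∀ (A : Set X) (hA : MeasurableSet A),
      F (0, indicatorConstLp 2 hA (measure_ne_top μ A) (1:ℝ)) = ∫ x in A, p x ∂μ := by
    intro A hA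
    rw [hpF, ← integral_indicator hA]
    refine integral_congr_ae ?_
    filter_upwards [indicatorConstLp_coeFn (p := 2) (hs := hA) (hμs := measure_ne_top μ A)
      (c := (1:ℝ))] with x hx
    rw [hx]
    by_cases h : x ∈ A <;> simp [h]
  refine ⟨p, Lp.aestronglyMeasurable p, ?_, ?_, fun v => by rw [← hFL, hFT, hpF]⟩
  · refine ae_nonneg_of_forall_setIntegral_nonneg hpi fun A hA _ => ?_
    rw [← hset A hA]
    have h1 := hFS (-indicatorConstLp 2 hA (measure_ne_top μ A) (1:ℝ))
    have h3 : ∀ h, F (0, -h) = -F (0, h) := fun h => by rw [← map_neg]; simp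
    rw [h3] at h1
    have h4 : S (-indicatorConstLp 2 hA (measure_ne_top μ A) (1:ℝ)) = 0 := by
      simp only [hS]
      rw [← integral_zero X ℝ (μ := μ)]
      refine integral_congr_ae ?_
      filter_upwards [indicatorConstLp_coeFn (p := 2) (hs := hA) (hμs := measure_ne_top μ A)
        (c := (1:ℝ)), Lp.coeFn_neg (indicatorConstLp 2 hA (measure_ne_top μ A) (1:ℝ))] with x hx hx'
      rw [hx', Pi.neg_apply, hx]
      by_cases h : x ∈ A <;> simp [h]
    linarith
  · refine ae_le_of_forall_setIntegral_le hpi hwi fun A hA _ => ?_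
    rw [← hset A hA]
    refine (hFS _).trans (le_of_eq ?_)
    simp only [hS]
    rw [← integral_indicator hA]
    refine integral_congr_ae ?_
    filter_upwards [indicatorConstLp_coeFn (p := 2) (hs := hA) (hμs := measure_ne_top μ A)
      (c := (1:ℝ))] with x hx
    rw [hx]
    by_cases h : x ∈ A <;> simp [h]

section
variable {α : ℝ} {Ω : Set (E N)}

lemma memLp_circ {f : ℂ → ℝ} (hf : ContinuousOn f (sphere (0:ℂ) 1)) : MemLp f 2 circ := by
  obtain ⟨C, hC⟩ := (isCompact_sphere (0:ℂ) 1).exists_bound_of_continuousOn hf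
  refine MemLp.of_bound (aesm_circ hf) C ?_
  filter_upwards [ae_circ_sphere] with ω h using hC ω h

/-- Discs with prescribed direction at the centre, paired with the multiplier. -/
def directedDiscs (v : E N) : Submodule ℝ ((ℂ → E N) × ℂ) where
  carrier := {x | DiffContOnCl ℂ x.1 (ball 0 1) ∧ x.1 0 = x.2 • v}
  add_mem' := fun {x y} hx hy => ⟨hx.1.add hy.1, by
    simp only [Prod.fst_add, Prod.snd_add, Pi.add_apply, hx.2, hy.2, add_smul]⟩
  zero_mem' := ⟨diffContOnCl_const, by simp⟩
  smul_mem' := fun c x hx => ⟨hx.1.const_smul c, by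
    simp only [Prod.smul_fst, Prod.smul_snd, Pi.smul_apply, hx.2, smul_assoc]⟩

namespace Geom
variable (G : Geom α Ω)

lemma continuousOn_ell_comp {f k : ℂ → E N} (hf : DiffContOnCl ℂ f (ball 0 1))
    (hm : MapsTo f (ball (0:ℂ) 1) Ω) (hk : ContinuousOn k (sphere (0:ℂ) 1)) :
    ContinuousOn (fun ω => ell G.ρ (f ω) (k ω)) (sphere (0:ℂ) 1) :=
  ContinuousOn.clm_apply (G.continuousOn_ell.comp (DiffContOnCl.continuousOn_sphere hf)
    fun _ hω => mapsTo_closedBall hf hm (sphere_subset_closedBall hω)) hk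

/-- The dual density of a length-minimizing disc. -/
theorem exists_dual_density {f : ℂ → E N} (hf : DiffContOnCl ℂ f (ball 0 1))
    (hm : MapsTo f (ball (0:ℂ) 1) Ω)
    (hext : ∀ ξ : ℂ, ‖ξ‖ < 1 → artanh ‖ξ‖ ≤ kobayashi Ω (f 0) (f ξ)) {W : ℂ → ℝ}
    (hW : ContinuousOn W (closedBall 0 1)) (hW0 : ∀ ω : ℂ, ‖ω‖ ≤ 1 → 0 < W ω)
    (hu : ∀ ω : ℂ, ‖ω‖ ≤ 1 → W ω * (1 - ‖ω‖ ^ 2) ≤ G.u (f ω)) :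
    ∃ p : ℂ → ℝ, AEStronglyMeasurable p circ ∧ (∀ᵐ ω ∂circ, 0 ≤ p ω) ∧
      (∀ᵐ ω ∂circ, p ω ≤ (W ω)⁻¹) ∧ ∀ (k : ℂ → E N) (β : ℂ), DiffContOnCl ℂ k (ball 0 1) →
      k 0 = β • deriv f 0 → ∫ ω, (p ω : ℂ) * (ω * ell G.ρ (f ω) (k ω)) ∂circ = β := by
  have hc : ∀ k : ℂ → E N, DiffContOnCl ℂ k (ball 0 1) →
      ContinuousOn (fun ω => ell G.ρ (f ω) (ω • k ω)) (sphere (0:ℂ) 1) := fun k hk =>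
    G.continuousOn_ell_comp hf hm (continuousOn_id.smul (DiffContOnCl.continuousOn_sphere hk))
  have hcr : ∀ k : ℂ → E N, DiffContOnCl ℂ k (ball 0 1) →
      ContinuousOn (fun ω => (ell G.ρ (f ω) (ω • k ω)).re) (sphere (0:ℂ) 1) := fun k hk =>
    Complex.continuous_re.comp_continuousOn (hc k hk)
  set V := directedDiscs (deriv f 0)
  set T : V →ₗ[ℝ] Lp ℝ 2 circ :=
    { toFun := fun v => (memLp_circ (hcr v.1.1 v.2.1)).toLp _
      map_add' := fun v w => by
        rw [← MemLp.toLp_add]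
        refine MemLp.toLp_congr _ _ (ae_of_all _ fun ω => ?_)
        simp
      map_smul' := fun c v => by
        rw [RingHom.id_apply, ← MemLp.toLp_const_smul]
        refine MemLp.toLp_congr _ _ (ae_of_all _ fun ω => ?_)
        simp only [Submodule.coe_smul, Prod.smul_fst, Pi.smul_apply]
        rw [smul_comm ω c, ← Complex.coe_smul c, map_smul]
        simp }
  set L : V →ₗ[ℝ] ℝ := Complex.reLm ∘ₗ LinearMap.snd ℝ _ _ ∘ₗ V.subtype
  have cW : ContinuousOn (fun ω => (W ω)⁻¹) (sphere (0:ℂ) 1) :=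
    (hW.mono sphere_subset_closedBall).inv₀ fun ω hω => (hW0 ω (by simpa using hω.le)).ne'
  obtain ⟨B, hB⟩ := (isCompact_sphere (0:ℂ) 1).exists_bound_of_continuousOn cW
  have hT : ∀ v : V, (T v : ℂ → ℝ) =ᵐ[circ] fun ω => (ell G.ρ (f ω) (ω • v.1.1 ω)).re := fun v =>
    (memLp_circ (hcr v.1.1 v.2.1)).coeFn_toLp
  obtain ⟨p, hp, hp0, hp1, hpL⟩ := exists_density L T (w := fun ω => (W ω)⁻¹) (B := B)
    (aesm_circ cW)
    (by filter_upwards [ae_circ_norm] with ω hω using inv_nonneg.2 (hW0 ω hω.le).le)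
    (by filter_upwards [ae_circ_sphere] with ω hω using (le_abs_self _).trans (hB ω hω))
    (fun v => by
      refine (G.variation hf hm hext v.2.1 hW hW0 hu v.2.2).trans (le_of_eq ?_)
      refine integral_congr_ae ?_
      filter_upwards [hT v] with ω hω
      rw [hω, div_eq_mul_inv])
  have hpb : ∀ᵐ ω ∂circ, ‖p ω‖ ≤ B := by
    filter_upwards [hp0, hp1, ae_circ_sphere] with ω h0 h1 h2
    rw [Real.norm_of_nonneg h0]
    exact h1.trans ((le_abs_self _).trans (hB ω h2))
  refine ⟨p, hp, hp0, hp1, ?_⟩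
  have re : ∀ (k : ℂ → E N) (β : ℂ), DiffContOnCl ℂ k (ball 0 1) → k 0 = β • deriv f 0 →
      (∫ ω, (p ω : ℂ) * (ω * ell G.ρ (f ω) (k ω)) ∂circ).re = β.re := by
    intro k β hk hβ
    have h1 := hpL ⟨(k, β), hk, hβ⟩
    have hi : Integrable (fun ω => (p ω : ℂ) * (ω * ell G.ρ (f ω) (k ω))) circ := by
      refine (integrable_circ ?_).bdd_mul (c := B)
        (Complex.continuous_ofReal.comp_aestronglyMeasurable hp) ?_
      · exact (hc k hk).congr fun ω _ => by simp only [map_smul, smul_eq_mul]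
      · filter_upwards [hpb] with ω h
        rwa [Complex.norm_real]
    have h2 := integral_re hi
    have h3 : L ⟨(k, β), hk, hβ⟩ = β.re := rfl
    rw [← h3, h1]
    refine h2.symm.trans (integral_congr_ae ?_)
    filter_upwards [hT ⟨(k, β), hk, hβ⟩] with ω hω
    rw [hω]
    simp
  intro k β hk hβ
  refine Complex.ext (re k β hk hβ) ?_
  have h := re (Complex.I • k) (Complex.I * β) (hk.const_smul _) (by
    rw [Pi.smul_apply, hβ, mul_smul])
  have e : ∫ ω, (p ω : ℂ) * (ω * ell G.ρ (f ω) ((Complex.I • k) ω)) ∂circ =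
      Complex.I * ∫ ω, (p ω : ℂ) * (ω * ell G.ρ (f ω) (k ω)) ∂circ := by
    rw [← integral_const_mul]
    refine integral_congr_ae (ae_of_all _ fun ω => ?_)
    simp only [Pi.smul_apply, map_smul, smul_eq_mul]
    ring
  rw [e, Complex.I_mul_re, Complex.I_mul_re] at h
  linarith

/-- The dual density of a centred geodesic, seen from an arbitrary point of the disc. -/
theorem exists_dual : ∃ C : ℝ, 1 ≤ C ∧ ∀ φ : ℂ → E N, DiffContOnCl ℂ φ (ball 0 1) →
    G.IsCentred φ → ∀ z : ℂ, ‖z‖ < 1 → ∃ P : ℂ → ℝ, AEStronglyMeasurable P circ ∧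
    (∀ᵐ ω ∂circ, 0 ≤ P ω) ∧ (∀ᵐ ω ∂circ, P ω ≤ C) ∧
    ∀ (k : ℂ → E N) (β : ℂ), DiffContOnCl ℂ k (ball 0 1) →
      k 0 = β • ((1 - ‖z‖ ^ 2 : ℝ) : ℂ) • deriv φ z →
      ∫ ω, (P ω : ℂ) * (mob z ω * ell G.ρ (φ (mob z ω)) (k ω)) ∂circ =
        (G.u (φ 0) * (1 - ‖z‖ ^ 2) : ℝ) * β := by
  obtain ⟨c, hc, Hc⟩ := G.exists_hopf
  refine ⟨max 1 c⁻¹, le_max_left _ _, fun φ hφ hcen z hz => ?_⟩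
  obtain ⟨hdφ, hmφ, hiso⟩ := hcen.1
  have hz0 : z ∈ ball (0:ℂ) 1 := by simpa using hz
  have hD : 0 < G.u (φ 0) := G.u_pos (hmφ (by simp))
  set t := 1 - ‖z‖ ^ 2 with ht
  have ht0 : 0 < t := by rw [ht]; nlinarith [norm_nonneg z]
  have hmobc : ContinuousOn (mob z) (closedBall 0 1) := fun ω hω =>
    (differentiableAt_mob hz (by simpa using hω)).continuousAt.continuousWithinAt
  have hmobm : MapsTo (mob z) (closedBall (0:ℂ) 1) (closedBall 0 1) := fun ω hω => by
    simpa using norm_mob_le hz (by simpa using hω)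
  have hmobb : MapsTo (mob z) (ball (0:ℂ) 1) (ball 0 1) := fun ω hω => by
    simpa using norm_mob_lt hz (by simpa using hω)
  have hf : DiffContOnCl ℂ (fun ω => φ (mob z ω)) (ball 0 1) := by
    refine ⟨hdφ.comp (fun ω hω => (differentiableAt_mob hz
      (by simpa using (ball_subset_closedBall hω))).differentiableWithinAt) hmobb, ?_⟩
    rw [closure_ball _ one_ne_zero]
    exact hφ.continuousOn_ball.comp hmobc hmobm
  have hm : MapsTo (fun ω => φ (mob z ω)) (ball (0:ℂ) 1) Ω := fun ω hω => hmφ (hmobb hω)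
  have hder : deriv (fun ω => φ (mob z ω)) 0 = ((1 - ‖z‖ ^ 2 : ℝ) : ℂ) • deriv φ z := by
    have h1 : HasDerivAt φ (deriv φ z) (mob z 0) := by
      rw [mob_zero]; exact (hdφ.differentiableAt (isOpen_ball.mem_nhds hz0)).hasDerivAt
    exact (h1.scomp 0 (hasDerivAt_mob_zero z)).deriv
  have hden : ∀ ω : ℂ, ‖ω‖ ≤ 1 → 1 + starRingEnd ℂ z * ω ≠ 0 := fun ω hω => mob_den_ne hz hω
  have hdenc : Continuous fun ω : ℂ => 1 + starRingEnd ℂ z * ω := by fun_prop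
  set W : ℂ → ℝ := fun ω => c * G.u (φ 0) * (t / ‖1 + starRingEnd ℂ z * ω‖ ^ 2) with hW
  have hWp : ∀ ω : ℂ, ‖ω‖ ≤ 1 → 0 < W ω := fun ω hω => by
    have := norm_pos_iff.2 (hden ω hω)
    positivity
  have hext : ∀ ξ : ℂ, ‖ξ‖ < 1 → artanh ‖ξ‖ ≤ kobayashi Ω (φ (mob z 0)) (φ (mob z ξ)) := by
    intro ξ hξ
    have e := hiso (mob z 0) (hmobb (by simp)) (mob z ξ) (hmobb (by simpa using hξ))
    rw [e, mob_zero, poincare]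
    have h1 := mob_neg_mob (z := -z) (by rwa [norm_neg]) hξ
    refine le_of_eq (congrArg artanh ?_)
    rw [neg_neg, mob.eq_def (-z)] at h1
    conv_lhs => rw [← h1, ← norm_neg]
    rw [map_neg, ← neg_div]
    congr 2 <;> ring
  have hWc : ContinuousOn W (closedBall 0 1) := continuousOn_const.mul (continuousOn_const.div (hdenc.norm.pow 2).continuousOn
      fun ω hω => pow_ne_zero 2 (norm_ne_zero_iff.2 (hden ω (by simpa using hω))))
  have hu : ∀ ω : ℂ, ‖ω‖ ≤ 1 → W ω * (1 - ‖ω‖ ^ 2) ≤ G.u (φ (mob z ω)) := by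
    intro ω hω
    have h1 := Hc φ hφ hcen (mob z ω) (norm_mob_le hz hω)
    rw [one_sub_mob hz hω] at h1
    refine le_trans (le_of_eq ?_) h1
    rw [hW]; ring
  obtain ⟨p, hp, hp0, hp1, hpk⟩ := G.exists_dual_density hf hm (W := W) hext hWc hWp hu
  refine ⟨fun ω => p ω * (G.u (φ 0) * t / ‖1 + starRingEnd ℂ z * ω‖ ^ 2), ?_, ?_, ?_, ?_⟩
  · refine hp.mul (aesm_circ ?_)
    refine continuousOn_const.div (hdenc.norm.pow 2).continuousOn fun ω hω => ?_
    exact pow_ne_zero 2 (norm_ne_zero_iff.2 (hden ω (by simpa using hω.le)))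
  · filter_upwards [hp0] with ω h
    positivity
  · filter_upwards [hp1, ae_circ_norm] with ω h hω
    have h1 := norm_pos_iff.2 (hden ω hω.le)
    refine le_trans ?_ (le_max_right _ _)
    calc _ ≤ (W ω)⁻¹ * (G.u (φ 0) * t / ‖1 + starRingEnd ℂ z * ω‖ ^ 2) := by gcongr
      _ = c⁻¹ := by rw [hW]; field_simp
  · intro k β hk hβ
    have hk' : DiffContOnCl ℂ (fun ω => ((1 + starRingEnd ℂ z * ω) ^ 2)⁻¹ • k ω) (ball 0 1) := by
      refine DiffContOnCl.smul ?_ hk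
      refine DiffContOnCl.inv ?_ ?_
      · exact Differentiable.diffContOnCl (by fun_prop)
      · intro ω hω
        rw [closure_ball _ one_ne_zero] at hω
        exact pow_ne_zero 2 (hden ω (by simpa using hω))
    have h1 := hpk _ β hk' (by simp only [mul_zero, add_zero, one_pow, inv_one, one_smul]; rw [hder, hβ])
    rw [← h1, ← integral_const_mul]
    refine integral_circ_congr fun ω hω => ?_
    have h2 := hden ω hω.le
    have h3 : mob z ω = ω * (‖1 + starRingEnd ℂ z * ω‖ ^ 2 : ℝ) / (1 + starRingEnd ℂ z * ω) ^ 2 := by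
      rw [mob, Complex.sq_norm, Complex.normSq_eq_conj_mul_self]
      have h4 : starRingEnd ℂ ω * ω = 1 := by
        rw [← Complex.normSq_eq_conj_mul_self, Complex.normSq_eq_norm_sq, hω]; simp
      simp only [map_add, map_mul, map_one, Complex.conj_conj]
      rw [div_eq_div_iff h2 (pow_ne_zero 2 h2)]
      linear_combination (-z * (1 + starRingEnd ℂ z * ω) ^ 2) * h4
    have h5 : ((‖1 + starRingEnd ℂ z * ω‖ : ℝ) : ℂ) ≠ 0 := by
      exact_mod_cast norm_ne_zero_iff.2 h2
    rw [map_smul, smul_eq_mul]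
    generalize ell G.ρ (φ (mob z ω)) (k ω) = y
    rw [h3]
    push_cast at h5 ⊢
    field_simp

end Geom


lemma norm_extend_le {A : E N →L[ℝ] ℝ} {B : ℝ} (hB : 0 ≤ B) (h : ∀ v, |A v| ≤ B * ‖v‖) (v : E N) :
    ‖StrongDual.extendRCLike (𝕜 := ℂ) A v‖ ≤ B * ‖v‖ := by
  have h1 : ‖StrongDual.extendRCLike (𝕜 := ℂ) A‖ ≤ B := by
    rw [StrongDual.norm_extendRCLike]
    exact A.opNorm_le_bound hB h
  exact (ContinuousLinearMap.le_opNorm _ v).trans (by gcongr)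

lemma re_extend (A : E N →L[ℝ] ℝ) (v : E N) :
    (StrongDual.extendRCLike (𝕜 := ℂ) A v).re = A v :=
  StrongDual.re_extendRCLike_apply (𝕜 := ℂ) A v

lemma im_extend (A : E N →L[ℝ] ℝ) (v : E N) :
    (StrongDual.extendRCLike (𝕜 := ℂ) A v).im = -A (Complex.I • v) := by
  have h := re_extend A (Complex.I • v)
  rw [map_smul, smul_eq_mul, Complex.mul_re, Complex.I_re, Complex.I_im] at h
  linarith

lemma I_smul_I_smul (v : E N) : Complex.I • Complex.I • v = -v := by
  rw [smul_smul, Complex.I_mul_I, neg_one_smul]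

lemma norm_I_smul (v : E N) : ‖Complex.I • v‖ = ‖v‖ := by
  rw [norm_smul, Complex.norm_I, one_mul]

namespace Geom
variable (G : Geom α Ω)

/-- The holomorphic and antiholomorphic parts of the first variation of `ℓ(T)` for `T` complex
tangential. -/
lemma exists_split {x T : E N} (hx : x ∈ closure Ω) (hT : ell G.ρ x T = 0) :
    ∃ S A : E N →L[ℂ] ℂ, (∀ v, ‖S v‖ ≤ G.M * ‖T‖ * ‖v‖) ∧ (∀ v, ‖A v‖ ≤ G.M * ‖T‖ * ‖v‖) ∧
      A T = (2 * levi G.ρ x T : ℝ) ∧ ∀ y ∈ closure Ω,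
      ‖ell G.ρ y T - S (y - x) - starRingEnd ℂ (A (y - x))‖ ≤
        2 * G.M * ‖T‖ * ‖y - x‖ ^ (1 + α) := by
  set H := hess G.ρ x
  set J : E N →L[ℝ] E N := (Complex.I • ContinuousLinearMap.id ℂ (E N)).restrictScalars ℝ
  set R₁ : E N →L[ℝ] ℝ := H.flip T
  set R₂ : E N →L[ℝ] ℝ := (H.flip (Complex.I • T)).comp J
  have e1 : ∀ v, R₁ v = H v T := fun v => rfl
  have e2 : ∀ v, R₂ v = H (Complex.I • v) (Complex.I • T) := fun v => rfl
  have hM : 0 ≤ G.M := G.M_pos.le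
  have bH : ∀ v w, |H v w| ≤ G.M * ‖v‖ * ‖w‖ := fun v w => by
    refine (H.le_opNorm₂ v w).trans ?_
    gcongr
    exact G.hess_le x hx
  have b1 : ∀ v, |R₁ v| ≤ G.M * ‖T‖ * ‖v‖ := fun v => by
    rw [e1]; exact (bH v T).trans_eq (by ring)
  have b2 : ∀ v, |R₂ v| ≤ G.M * ‖T‖ * ‖v‖ := fun v => by
    rw [e2]; refine (bH _ _).trans_eq ?_
    rw [norm_I_smul, norm_I_smul]; ring
  set rS : E N →L[ℝ] ℝ := (1/2:ℝ) • (R₁ - R₂)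
  set rA : E N →L[ℝ] ℝ := (1/2:ℝ) • (R₁ + R₂)
  have eS : ∀ v, rS v = 1/2 * (R₁ v - R₂ v) := fun v => rfl
  have eA : ∀ v, rA v = 1/2 * (R₁ v + R₂ v) := fun v => rfl
  have hT1 : fderiv ℝ G.ρ x T = 0 := by rw [← re_ell, hT]; rfl
  have hT2 : fderiv ℝ G.ρ x (Complex.I • T) = 0 := by
    have := im_ell G.ρ x T
    rw [hT, Complex.zero_im] at this
    linarith
  refine ⟨StrongDual.extendRCLike rS, StrongDual.extendRCLike rA,
    norm_extend_le (by positivity) fun v => ?_, norm_extend_le (by positivity) fun v => ?_, ?_, ?_⟩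
  · rw [eS, abs_mul, abs_of_pos (by norm_num : (0:ℝ) < 1/2)]
    have := abs_sub (R₁ v) (R₂ v)
    linarith [b1 v, b2 v]
  · rw [eA, abs_mul, abs_of_pos (by norm_num : (0:ℝ) < 1/2)]
    have := abs_add_le (R₁ v) (R₂ v)
    linarith [b1 v, b2 v]
  · refine Complex.ext ?_ ?_
    · rw [re_extend, Complex.ofReal_re, levi_eq, eA, e1, e2]; ring
    · rw [im_extend, Complex.ofReal_im, eA, e1, e2, I_smul_I_smul, map_neg,
        neg_apply]
      have h : H (Complex.I • T) T = H T (Complex.I • T) :=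
        hess_symm (G.C2 x (G.closure_sub hx)) _ _
      linarith
  · intro y hy
    set X := y - x
    have hol : ∀ w, |fderiv ℝ G.ρ y w - fderiv ℝ G.ρ x w - H X w| ≤
        G.M * ‖X‖ ^ (1 + α) * ‖w‖ := fun w => by
      have := (fderiv ℝ G.ρ y - fderiv ℝ G.ρ x - H X).le_opNorm w
      refine this.trans ?_
      gcongr
      exact G.holder x hx y hy
    refine (Complex.norm_le_abs_re_add_abs_im _).trans ?_
    have hr : (ell G.ρ y T - StrongDual.extendRCLike (𝕜 := ℂ) rS X -
        starRingEnd ℂ (StrongDual.extendRCLike (𝕜 := ℂ) rA X)).re =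
        fderiv ℝ G.ρ y T - fderiv ℝ G.ρ x T - H X T := by
      rw [Complex.sub_re, Complex.sub_re, Complex.conj_re, re_extend, re_extend, re_ell, eS, eA, hT1,
        e1, e2]; ring
    have hi : (ell G.ρ y T - StrongDual.extendRCLike (𝕜 := ℂ) rS X -
        starRingEnd ℂ (StrongDual.extendRCLike (𝕜 := ℂ) rA X)).im =
        -(fderiv ℝ G.ρ y (Complex.I • T) - fderiv ℝ G.ρ x (Complex.I • T) -
          H X (Complex.I • T)) := by
      rw [Complex.sub_im, Complex.sub_im, Complex.conj_im, im_extend, im_extend, im_ell, eS, eA, hT2,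
        e1, e2, I_smul_I_smul]
      simp only [map_neg, neg_apply]
      ring
    rw [hr, hi, abs_neg]
    have h1 := hol T
    have h2 := hol (Complex.I • T)
    rw [norm_I_smul] at h2
    linarith

end Geom

/-- A disc in `Ω`, seen from its centre, with a dual density of mass comparable to one. -/
structure Dual (G : Geom α Ω) (f : ℂ → E N) (z : ℂ) (P : ℂ → ℝ) (C τ : ℝ) : Prop where
  hz : ‖z‖ < 1
  dc : DiffContOnCl ℂ f (ball 0 1)
  maps : MapsTo f (ball (0:ℂ) 1) Ω
  meas : AEStronglyMeasurable P circ
  nonneg : ∀ᵐ ω ∂circ, 0 ≤ P ω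
  le : ∀ᵐ ω ∂circ, P ω ≤ C
  hC : 1 ≤ C
  hMC : G.M ≤ C
  hτ : 0 < τ
  dual : ∀ (k : ℂ → E N) (β : ℂ), DiffContOnCl ℂ k (ball 0 1) → k 0 = β • deriv f 0 →
    ∫ ω, (P ω : ℂ) * (mob z ω * ell G.ρ (f ω) (k ω)) ∂circ = (τ : ℂ) * β
  deriv_le : ‖deriv f 0‖ ≤ C * √τ
  ell_deriv_le : ‖ell G.ρ (f 0) (deriv f 0)‖ ≤ C * τ
  sq_le : ∫ ω, ‖f ω - f 0‖ ^ 2 ∂circ ≤ C * τ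

namespace Dual
variable {G : Geom α Ω} {f : ℂ → E N} {z : ℂ} {P : ℂ → ℝ} {C τ : ℝ}

lemma integrable (H : Dual G f z P C τ) {g : ℂ → ℂ} (hg : ContinuousOn g (sphere (0:ℂ) 1)) :
    Integrable (fun ω => (P ω : ℂ) * g ω) circ := by
  refine (integrable_circ hg).bdd_mul (c := C)
    (Complex.continuous_ofReal.comp_aestronglyMeasurable H.meas) ?_
  filter_upwards [H.nonneg, H.le] with ω h0 h1
  rwa [Complex.norm_real, Real.norm_of_nonneg h0]

lemma integrable_real (H : Dual G f z P C τ) {g : ℂ → ℝ} (hg : ContinuousOn g (sphere (0:ℂ) 1)) :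
    Integrable (fun ω => P ω * g ω) circ := by
  refine (integrable_circ hg).bdd_mul (c := C) H.meas ?_
  filter_upwards [H.nonneg, H.le] with ω h0 h1
  rwa [Real.norm_of_nonneg h0]

lemma norm_integral_le_mul (H : Dual G f z P C τ) {g : ℂ → ℂ} {b : ℂ → ℝ}
    (hb : ContinuousOn b (sphere (0:ℂ) 1)) (h : ∀ ω, ‖ω‖ = 1 → ‖g ω‖ ≤ b ω) :
    ‖∫ ω, (P ω : ℂ) * g ω ∂circ‖ ≤ ∫ ω, P ω * b ω ∂circ := by
  refine norm_integral_le_of_norm_le (H.integrable_real hb) ?_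
  filter_upwards [H.nonneg, ae_circ_norm] with ω h0 h2
  rw [norm_mul, Complex.norm_real, Real.norm_of_nonneg h0]
  exact mul_le_mul_of_nonneg_left (h ω h2) h0

lemma norm_integral_le (H : Dual G f z P C τ) {g : ℂ → ℂ} {b : ℂ → ℝ}
    (hb : ContinuousOn b (sphere (0:ℂ) 1)) (h : ∀ ω, ‖ω‖ = 1 → ‖g ω‖ ≤ b ω) :
    ‖∫ ω, (P ω : ℂ) * g ω ∂circ‖ ≤ C * ∫ ω, b ω ∂circ := by
  refine (H.norm_integral_le_mul hb h).trans ?_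
  rw [← integral_const_mul]
  refine integral_mono_ae (H.integrable_real hb) ((integrable_circ hb).const_mul C) ?_
  filter_upwards [H.le, ae_circ_norm] with ω h1 h2
  exact mul_le_mul_of_nonneg_right h1 ((norm_nonneg _).trans (h ω h2))

lemma continuousOn_mob (H : Dual G f z P C τ) : ContinuousOn (mob z) (sphere (0:ℂ) 1) :=
  fun ω hω => (differentiableAt_mob H.hz (by simpa using (mem_sphere_zero_iff_norm.1 hω).le))
    |>.continuousAt.continuousWithinAt

lemma continuousOn_X (H : Dual G f z P C τ) : ContinuousOn (fun ω => f ω - f 0) (sphere (0:ℂ) 1) :=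
  (DiffContOnCl.continuousOn_sphere H.dc).sub continuousOn_const

lemma mem (H : Dual G f z P C τ) {ω : ℂ} (hω : ‖ω‖ ≤ 1) : f ω ∈ closure Ω :=
  mapsTo_closedBall H.dc H.maps (by simpa using hω)

lemma norm_ell_sub (H : Dual G f z P C τ) {ω : ℂ} (hω : ‖ω‖ ≤ 1) (v : E N) :
    ‖ell G.ρ (f ω) v - ell G.ρ (f 0) v‖ ≤ C * ‖f ω - f 0‖ * ‖v‖ := by
  have h := G.lip _ (H.mem (ω := 0) (by simp)) _ (H.mem hω)
  rw [← ell_sub_norm] at h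
  have h2 := (ell G.ρ (f ω) - ell G.ρ (f 0)).le_opNorm v
  rw [sub_apply] at h2
  have := H.hMC
  refine h2.trans ?_
  gcongr
  exact h.trans (by gcongr)

/-- The dual density has mass bounded below. -/
lemma mass_ge (H : Dual G f z P C τ) : 1 ≤ 3 * C ^ 6 * ∫ ω, P ω ∂circ := by
  have hC := H.hC
  have hτ := H.hτ
  have hC0 : 0 < C := by linarith
  set e := deriv f 0
  set s := √τ with hs
  have hs2 : s ^ 2 = τ := Real.sq_sqrt hτ.le
  have hs0 : 0 < s := Real.sqrt_pos.2 hτ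
  have h1 := H.dual (fun _ => e) 1 diffContOnCl_const (by simp [e])
  have cX := H.continuousOn_X.norm
  have b1 : ∀ ω : ℂ, ‖ω‖ = 1 → ‖mob z ω * ell G.ρ (f ω) e‖ ≤
      C * τ + C ^ 6 / 2 * τ + ‖f ω - f 0‖ ^ 2 / (2 * C ^ 2) := by
    intro ω hω
    rw [norm_mul, norm_mob_eq H.hz hω, one_mul]
    have h2 : ‖ell G.ρ (f ω) e‖ ≤ ‖ell G.ρ (f 0) e‖ + ‖ell G.ρ (f ω) e - ell G.ρ (f 0) e‖ :=
      norm_le_norm_add_norm_sub' _ _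
    have h3 := H.norm_ell_sub hω.le e
    have h4 := H.ell_deriv_le
    have h5 : C * ‖f ω - f 0‖ * ‖e‖ ≤ C * ‖f ω - f 0‖ * (C * s) := by
      gcongr; exact H.deriv_le
    have h6 : C * ‖f ω - f 0‖ * (C * s) = (C ^ 3 * s) * (‖f ω - f 0‖ / C) := by field_simp
    have h7 : (C ^ 3 * s) * (‖f ω - f 0‖ / C) ≤
        C ^ 6 / 2 * τ + ‖f ω - f 0‖ ^ 2 / (2 * C ^ 2) := by
      have := two_mul_le_add_sq (C ^ 3 * s) (‖f ω - f 0‖ / C)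
      have e1 : (C ^ 3 * s) ^ 2 = C ^ 6 * τ := by rw [← hs2]; ring
      have e2 : (‖f ω - f 0‖ / C) ^ 2 / 2 = ‖f ω - f 0‖ ^ 2 / (2 * C ^ 2) := by
        field_simp
      rw [← e2]
      linarith
    linarith
  have h2 := H.norm_integral_le_mul (b := fun ω => C * τ + C ^ 6 / 2 * τ +
    ‖f ω - f 0‖ ^ 2 / (2 * C ^ 2)) (continuousOn_const.add ((cX.pow 2).div_const _)) b1
  rw [h1, mul_one, Complex.norm_real, Real.norm_of_nonneg hτ.le] at h2
  have i1 : Integrable (fun ω => P ω * (C * τ + C ^ 6 / 2 * τ)) circ :=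
    H.integrable_real continuousOn_const
  have i2 : Integrable (fun ω => P ω * (‖f ω - f 0‖ ^ 2 / (2 * C ^ 2))) circ :=
    H.integrable_real ((cX.pow 2).div_const _)
  have i3 : Integrable (fun ω => ‖f ω - f 0‖ ^ 2) circ := integrable_circ (cX.pow 2)
  simp only [mul_add (P _) (C * τ + C ^ 6 / 2 * τ)] at h2
  rw [integral_add i1 i2, integral_mul_const] at h2
  have h3 : ∫ ω, P ω * (‖f ω - f 0‖ ^ 2 / (2 * C ^ 2)) ∂circ ≤ τ / 2 := by
    calc ∫ ω, P ω * (‖f ω - f 0‖ ^ 2 / (2 * C ^ 2)) ∂circ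
        ≤ ∫ ω, (1 / (2 * C)) * ‖f ω - f 0‖ ^ 2 ∂circ := by
          refine integral_mono_ae i2 (i3.const_mul _) ?_
          filter_upwards [H.le] with ω h
          calc P ω * (‖f ω - f 0‖ ^ 2 / (2 * C ^ 2)) ≤ C * (‖f ω - f 0‖ ^ 2 / (2 * C ^ 2)) := by
                gcongr
            _ = (1 / (2 * C)) * ‖f ω - f 0‖ ^ 2 := by field_simp
      _ = (1 / (2 * C)) * ∫ ω, ‖f ω - f 0‖ ^ 2 ∂circ := integral_const_mul _ _
      _ ≤ (1 / (2 * C)) * (C * τ) := by gcongr; exact H.sq_le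
      _ = τ / 2 := by field_simp
  set m := ∫ ω, P ω ∂circ
  have hm : 0 ≤ m := integral_nonneg_of_ae H.nonneg
  have h4 : τ * 1 ≤ τ * (2 * C * m + C ^ 6 * m) := by linarith
  have h5 := le_of_mul_le_mul_left h4 hτ
  have h6 : C ≤ C ^ 6 := le_self_pow₀ hC (by norm_num)
  have : 2 * C * m ≤ 2 * C ^ 6 * m := by gcongr
  linarith

end Dual


lemma diffContOnCl_mob {z : ℂ} (hz : ‖z‖ < 1) : DiffContOnCl ℂ (mob z) (ball 0 1) := by
  refine DifferentiableOn.diffContOnCl fun ω hω => ?_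
  rw [closure_ball _ one_ne_zero] at hω
  exact (differentiableAt_mob hz (by simpa using hω)).differentiableWithinAt

lemma integral_circ_mob_sub_sq {z : ℂ} (hz : ‖z‖ < 1) :
    ∫ ω, ‖mob z ω - z‖ ^ 2 ∂circ = 1 - ‖z‖ ^ 2 := by
  have hd : DiffContOnCl ℂ (fun ω => starRingEnd ℂ z * mob z ω) (ball 0 1) :=
    (diffContOnCl_mob hz).const_smul (starRingEnd ℂ z)
  have h0 := hd.integral_circ
  have hc := integrable_circ (hd.continuousOn_ball.mono sphere_subset_closedBall)
  have h1 : ∫ ω, (starRingEnd ℂ z * mob z ω).re ∂circ = ‖z‖ ^ 2 := by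
    have h2 : ∫ ω, (starRingEnd ℂ z * mob z ω).re ∂circ =
      (∫ ω, starRingEnd ℂ z * mob z ω ∂circ).re := integral_re hc
    rw [h2, h0, mob_zero, ← Complex.normSq_eq_conj_mul_self, Complex.ofReal_re,
      Complex.normSq_eq_norm_sq]
  have h2 : ∀ ω : ℂ, ‖ω‖ = 1 → ‖mob z ω - z‖ ^ 2 =
      1 + ‖z‖ ^ 2 - 2 * (starRingEnd ℂ z * mob z ω).re := fun ω hω => by
    have h3 : ‖mob z ω‖ ^ 2 = 1 := by rw [norm_mob_eq hz hω]; norm_num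
    rw [Complex.sq_norm, Complex.normSq_apply] at h3 ⊢
    rw [Complex.sq_norm, Complex.normSq_apply]
    simp only [Complex.sub_re, Complex.sub_im, Complex.mul_re, Complex.conj_re, Complex.conj_im]
    linear_combination h3
  rw [integral_circ_congr h2]
  have hi : Integrable (fun ω => 2 * (starRingEnd ℂ z * mob z ω).re) circ := hc.re.const_mul 2
  rw [integral_sub (integrable_const _) hi, integral_circ_const, integral_const_mul, h1]
  ring

namespace Dual
variable {G : Geom α Ω} {f : ℂ → E N} {z : ℂ} {P : ℂ → ℝ} {C τ : ℝ}

lemma sq_le_rpow (H : Dual G f z P C τ) {ω : ℂ} (hω : ‖ω‖ ≤ 1) :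
    ‖f ω - f 0‖ ^ 2 ≤ 2 * C * ‖f ω - f 0‖ ^ (1 + α) := by
  have hC := H.hC
  have h1 : ‖f ω - f 0‖ ≤ 2 * C :=
    (G.dist_le (H.mem hω) (H.mem (ω := 0) (by simp))).trans (by linarith [H.hMC])
  rcases (norm_nonneg (f ω - f 0)).eq_or_lt with h | h
  · rw [← h, Real.zero_rpow (by linarith [G.hα])]; simp
  · have e : ‖f ω - f 0‖ ^ 2 = ‖f ω - f 0‖ ^ (1 - α) * ‖f ω - f 0‖ ^ (1 + α) := by
      rw [← Real.rpow_add h, ← Real.rpow_natCast]; congr 1; push_cast; ring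
    rw [e]
    gcongr
    calc ‖f ω - f 0‖ ^ (1 - α) ≤ (2 * C) ^ (1 - α) :=
          Real.rpow_le_rpow h.le h1 (by linarith [G.hα1])
      _ ≤ (2 * C) ^ (1:ℝ) := Real.rpow_le_rpow_of_exponent_le (by linarith) (by linarith [G.hα])
      _ = 2 * C := Real.rpow_one _

set_option maxHeartbeats 1600000 in
/-- Comparison of the holomorphic and antiholomorphic parts of `ℓ(T)` under the dual density. -/
lemma core (H : Dual G f z P C τ) {ν₀ T : E N} (hν : ell G.ρ (f 0) ν₀ = 1) (hν' : ‖ν₀‖ ≤ C)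
    {S A : E N →L[ℂ] ℂ} (hS : ∀ v, ‖S v‖ ≤ G.M * ‖T‖ * ‖v‖)
    (hA : ∀ v, ‖A v‖ ≤ G.M * ‖T‖ * ‖v‖)
    (hSA : ∀ y ∈ closure Ω, ‖ell G.ρ y T - S (y - f 0) - starRingEnd ℂ (A (y - f 0))‖ ≤
        2 * G.M * ‖T‖ * ‖y - f 0‖ ^ (1 + α)) :
    ‖z‖ * ‖∫ ω, (P ω : ℂ) * (mob z ω * ell G.ρ (f ω) ν₀) ∂circ‖ * ‖A (deriv f 0)‖ ≤
      ‖T‖ * (10 * C ^ 5 * ∫ ω, ‖f ω - f 0‖ ^ (1 + α) ∂circ +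
        2 * C ^ 2 * ∫ ω, ‖mob z ω - z‖ * ‖f ω - f 0‖ ∂circ) := by
  have hC := H.hC
  have hMC := H.hMC
  have hM := G.M_pos
  have hα := G.hα
  set X : ℂ → E N := fun ω => f ω - f 0 with hX
  have dX : DiffContOnCl ℂ X (ball 0 1) := H.dc.sub_const _
  have dS : DiffContOnCl ℂ (fun ω => S (X ω)) (ball 0 1) :=
    S.differentiable.comp_diffContOnCl dX
  have dA : DiffContOnCl ℂ (fun ω => A (X ω)) (ball 0 1) :=
    A.differentiable.comp_diffContOnCl dX
  have did : DiffContOnCl ℂ (fun ω : ℂ => ω) (ball 0 1) := differentiable_id.diffContOnCl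
  have sph : ∀ {F : Type} [NormedAddCommGroup F] [NormedSpace ℂ F] {g : ℂ → F},
      DiffContOnCl ℂ g (ball 0 1) → ContinuousOn g (sphere (0:ℂ) 1) := fun hg =>
    hg.continuousOn_ball.mono sphere_subset_closedBall
  set q : ℂ → ℂ := fun ω => mob z ω * ell G.ρ (f ω) ν₀ with hq
  have cmob := H.continuousOn_mob
  have cq : ContinuousOn q (sphere (0:ℂ) 1) :=
    cmob.mul (G.continuousOn_ell_comp H.dc H.maps continuousOn_const)
  have cS : ContinuousOn (fun ω => S (X ω)) (sphere (0:ℂ) 1) := sph dS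
  have cA : ContinuousOn (fun ω => A (X ω)) (sphere (0:ℂ) 1) := sph dA
  have cX : ContinuousOn (fun ω => ‖X ω‖) (sphere (0:ℂ) 1) := H.continuousOn_X.norm
  have cXp : ContinuousOn (fun ω => ‖X ω‖ ^ (1 + α)) (sphere (0:ℂ) 1) :=
    cX.rpow_const fun ω _ => Or.inr (by linarith)
  have cW : ContinuousOn (fun ω => ‖mob z ω - z‖ * ‖X ω‖) (sphere (0:ℂ) 1) :=
    (cmob.sub continuousOn_const).norm.mul cX
  have cid : ContinuousOn (fun ω : ℂ => ω) (sphere (0:ℂ) 1) := continuousOn_id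
  have conjc : ∀ {g : ℂ → ℂ}, ContinuousOn g (sphere (0:ℂ) 1) →
      ContinuousOn (fun ω => starRingEnd ℂ (g ω)) (sphere (0:ℂ) 1) := fun hg =>
    Complex.continuous_conj.comp_continuousOn hg
  have cT : ContinuousOn (fun ω => mob z ω * ell G.ρ (f ω) (ω • T)) (sphere (0:ℂ) 1) :=
    cmob.mul (G.continuousOn_ell_comp H.dc H.maps (cid.smul continuousOn_const))
  have hq1 : ∀ ω : ℂ, ‖ω‖ = 1 → ‖q ω - mob z ω‖ ≤ C ^ 2 * ‖X ω‖ := by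
    intro ω hω
    have e : q ω - mob z ω = mob z ω * (ell G.ρ (f ω) ν₀ - ell G.ρ (f 0) ν₀) := by
      rw [hν, hq]; ring
    rw [e, norm_mul, norm_mob_eq H.hz hω, one_mul]
    refine (H.norm_ell_sub hω.le ν₀).trans ?_
    calc C * ‖f ω - f 0‖ * ‖ν₀‖ ≤ C * ‖f ω - f 0‖ * C := by gcongr
      _ = C ^ 2 * ‖X ω‖ := by ring
  have v1 : ∫ ω, (P ω : ℂ) * (mob z ω * ell G.ρ (f ω) (ω • T)) ∂circ = 0 := by
    rw [H.dual (fun ω => ω • T) 0 (did.smul diffContOnCl_const) (by simp), mul_zero]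
  have v2 : ∫ ω, (P ω : ℂ) * (q ω * (ω * S (X ω))) ∂circ = 0 := by
    have := H.dual (fun ω => (ω * S (X ω)) • ν₀) 0
      ((did.smul dS).smul diffContOnCl_const) (by simp)
    rw [mul_zero] at this
    rw [← this]
    refine integral_congr_ae (ae_of_all _ fun ω => ?_)
    simp only [map_smul, smul_eq_mul, hq]
    ring
  set a := ∫ ω, (P ω : ℂ) * q ω ∂circ with ha
  have v3 : ∫ ω, (P ω : ℂ) * (q ω * (starRingEnd ℂ ω * A (X ω))) ∂circ = a * A (deriv f 0) := by
    set h : ℂ → ℂ := dslope (fun ω => A (X ω)) 0 with hh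
    have hb : ball (0:ℂ) 1 ∈ 𝓝 (0:ℂ) := isOpen_ball.mem_nhds (by simp)
    have hb' : closedBall (0:ℂ) 1 ∈ 𝓝 (0:ℂ) := mem_of_superset hb ball_subset_closedBall
    have dh : DiffContOnCl ℂ h (ball 0 1) := by
      refine ⟨(Complex.differentiableOn_dslope hb).2 dA.differentiableOn, ?_⟩
      rw [closure_ball _ one_ne_zero]
      exact (continuousOn_dslope hb').2 ⟨dA.continuousOn_ball,
        dA.differentiableOn.differentiableAt hb⟩
    have h0 : h 0 = A (deriv f 0) := by
      rw [hh, dslope_same]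
      have h1 : HasDerivAt f (deriv f 0) 0 :=
        (H.dc.differentiableOn.differentiableAt hb).hasDerivAt
      exact (A.hasFDerivAt.comp_hasDerivAt 0 (h1.sub_const (f 0))).deriv
    have h1 := H.dual (fun ω => (h ω - h 0) • ν₀) 0
      ((dh.sub_const _).smul diffContOnCl_const) (by simp)
    rw [mul_zero] at h1
    have h2 : ∫ ω, (P ω : ℂ) * (q ω * (starRingEnd ℂ ω * A (X ω))) ∂circ =
        ∫ ω, ((P ω : ℂ) * (mob z ω * ell G.ρ (f ω) ((h ω - h 0) • ν₀)) +
          ((P ω : ℂ) * q ω) * h 0) ∂circ := by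
      refine integral_circ_congr fun ω hω => ?_
      have hne : ω ≠ 0 := by rintro rfl; simp at hω
      have e1 : h ω = starRingEnd ℂ ω * A (X ω) := by
        have e2 : starRingEnd ℂ ω = ω⁻¹ := by
          rw [Complex.inv_def, Complex.normSq_eq_norm_sq, hω]; simp
        rw [hh, dslope_of_ne _ hne, slope_def_field, e2]
        simp [hX, div_eq_inv_mul]
      rw [← e1, map_smul, smul_eq_mul, hq]
      ring
    have i1 : Integrable (fun ω => (P ω : ℂ) * (mob z ω * ell G.ρ (f ω) ((h ω - h 0) • ν₀)))
        circ := H.integrable (cmob.mul (G.continuousOn_ell_comp H.dc H.maps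
          (((sph dh).sub continuousOn_const).smul continuousOn_const)))
    have i2 : Integrable (fun ω => (P ω : ℂ) * q ω * h 0) circ := (H.integrable cq).mul_const _
    rw [h2, integral_add i1 i2, h1, zero_add, integral_mul_const, h0]
  set I := ∫ ω, (P ω : ℂ) * (q ω * (ω * starRingEnd ℂ (A (X ω)))) ∂circ with hI
  set J := ∫ ω, ‖X ω‖ ^ (1 + α) ∂circ with hJ
  set W := ∫ ω, ‖mob z ω - z‖ * ‖X ω‖ ∂circ with hW
  have gS : ∀ ω, ‖S (X ω)‖ ≤ C * ‖T‖ * ‖X ω‖ := fun ω => (hS _).trans (by gcongr)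
  have gA : ∀ ω, ‖A (X ω)‖ ≤ C * ‖T‖ * ‖X ω‖ := fun ω => (hA _).trans (by gcongr)
  have c1 : ContinuousOn (fun ω => q ω * (ω * starRingEnd ℂ (A (X ω)))) (sphere (0:ℂ) 1) :=
    cq.mul (cid.mul (conjc cA))
  have c2 : ContinuousOn (fun ω => q ω * (ω * S (X ω))) (sphere (0:ℂ) 1) := cq.mul (cid.mul cS)
  have bI : ‖I‖ ≤ C * (6 * C ^ 4 * ‖T‖ * J) := by
    have e : I = ∫ ω, (P ω : ℂ) * (q ω * (ω * starRingEnd ℂ (A (X ω))) + q ω * (ω * S (X ω)) -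
        mob z ω * ell G.ρ (f ω) (ω • T)) ∂circ := by
      have i12 := (H.integrable c1).add (H.integrable c2)
      simp only [mul_sub, mul_add]
      have j12 : Integrable (fun ω => (P ω : ℂ) * (q ω * (ω * starRingEnd ℂ (A (X ω)))) +
        (P ω : ℂ) * (q ω * (ω * S (X ω)))) circ := i12
      rw [integral_sub j12 (H.integrable cT),
        integral_add (H.integrable c1) (H.integrable c2), v1, v2]
      ring
    rw [e, ← integral_const_mul]
    refine H.norm_integral_le (continuousOn_const.mul cXp) fun ω hω => ?_
    have e2 : q ω * (ω * starRingEnd ℂ (A (X ω))) + q ω * (ω * S (X ω)) -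
        mob z ω * ell G.ρ (f ω) (ω • T) = ω * ((q ω - mob z ω) * (S (X ω) +
          starRingEnd ℂ (A (X ω))) - mob z ω * (ell G.ρ (f ω) T - S (X ω) -
          starRingEnd ℂ (A (X ω)))) := by
      rw [map_smul, smul_eq_mul]; ring
    rw [e2, norm_mul, hω, one_mul]
    refine (norm_sub_le _ _).trans ?_
    rw [norm_mul, norm_mul, norm_mob_eq H.hz hω, one_mul]
    have r1 : ‖S (X ω) + starRingEnd ℂ (A (X ω))‖ ≤ 2 * (C * ‖T‖ * ‖X ω‖) := by
      refine (norm_add_le _ _).trans ?_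
      rw [RCLike.norm_conj]
      linarith [gS ω, gA ω]
    have r2 := hSA (f ω) (H.mem hω.le)
    have r3 := H.sq_le_rpow hω.le
    have p0 : 0 ≤ ‖X ω‖ ^ (1 + α) := by positivity
    calc ‖q ω - mob z ω‖ * ‖S (X ω) + starRingEnd ℂ (A (X ω))‖ +
          ‖ell G.ρ (f ω) T - S (X ω) - starRingEnd ℂ (A (X ω))‖
        ≤ (C ^ 2 * ‖X ω‖) * (2 * (C * ‖T‖ * ‖X ω‖)) + 2 * C * ‖T‖ * ‖X ω‖ ^ (1 + α) := by
          refine add_le_add (mul_le_mul (hq1 ω hω) r1 (norm_nonneg _) (by positivity))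
            (r2.trans ?_)
          simp only [hX]
          gcongr
      _ = 2 * C ^ 3 * ‖T‖ * ‖X ω‖ ^ 2 + 2 * C * ‖T‖ * ‖X ω‖ ^ (1 + α) := by ring
      _ ≤ 2 * C ^ 3 * ‖T‖ * (2 * C * ‖X ω‖ ^ (1 + α)) +
          2 * C ^ 4 * ‖T‖ * ‖X ω‖ ^ (1 + α) := by
          have : C ≤ C ^ 4 := le_self_pow₀ hC (by norm_num)
          gcongr
      _ = 6 * C ^ 4 * ‖T‖ * ‖X ω‖ ^ (1 + α) := by ring
  have c3 : ContinuousOn (fun ω => q ω * (starRingEnd ℂ ω * A (X ω))) (sphere (0:ℂ) 1) :=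
    cq.mul ((conjc cid).mul cA)
  have c4 : ContinuousOn (fun ω => starRingEnd ℂ (q ω) * (starRingEnd ℂ ω * A (X ω)))
    (sphere (0:ℂ) 1) := (conjc cq).mul ((conjc cid).mul cA)
  have v4 : ∫ ω, (P ω : ℂ) * (starRingEnd ℂ (q ω) * (starRingEnd ℂ ω * A (X ω))) ∂circ =
      starRingEnd ℂ I := by
    rw [hI, ← integral_conj]
    refine integral_congr_ae (ae_of_all _ fun ω => ?_)
    simp only [map_mul, Complex.conj_ofReal, Complex.conj_conj]
  have e5 : starRingEnd ℂ z * (a * A (deriv f 0)) = z * starRingEnd ℂ I +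
      ∫ ω, (P ω : ℂ) * ((starRingEnd ℂ z * q ω - z * starRingEnd ℂ (q ω)) *
        (starRingEnd ℂ ω * A (X ω))) ∂circ := by
    have h1 : ∫ ω, (P ω : ℂ) * ((starRingEnd ℂ z * q ω - z * starRingEnd ℂ (q ω)) *
        (starRingEnd ℂ ω * A (X ω))) ∂circ =
        ∫ ω, (starRingEnd ℂ z * ((P ω : ℂ) * (q ω * (starRingEnd ℂ ω * A (X ω)))) -
          z * ((P ω : ℂ) * (starRingEnd ℂ (q ω) * (starRingEnd ℂ ω * A (X ω))))) ∂circ := by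
      refine integral_congr_ae (ae_of_all _ fun ω => ?_)
      simp only
      ring
    rw [h1, integral_sub ((H.integrable c3).const_mul _) ((H.integrable c4).const_mul _),
      integral_const_mul, integral_const_mul, v3, v4]
    ring
  have b5 : ‖∫ ω, (P ω : ℂ) * ((starRingEnd ℂ z * q ω - z * starRingEnd ℂ (q ω)) *
        (starRingEnd ℂ ω * A (X ω))) ∂circ‖ ≤
      C * (4 * C ^ 4 * ‖T‖ * J + 2 * C * ‖T‖ * W) := by
    have iJ := (integrable_circ cXp).const_mul (4 * C ^ 4 * ‖T‖)
    have iW := (integrable_circ cW).const_mul (2 * C * ‖T‖)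
    rw [← integral_const_mul, ← integral_const_mul (2 * C * ‖T‖), ← integral_add iJ iW]
    refine H.norm_integral_le ((continuousOn_const.mul cXp).add (continuousOn_const.mul cW))
      fun ω hω => ?_
    have hz1 := H.hz.le
    have r1 : ‖starRingEnd ℂ z * q ω - z * starRingEnd ℂ (q ω)‖ ≤
        2 * (C ^ 2 * ‖X ω‖) + 2 * ‖mob z ω - z‖ := by
      have e : starRingEnd ℂ z * q ω - z * starRingEnd ℂ (q ω) =
          (starRingEnd ℂ z * (q ω - mob z ω + (mob z ω - z))) -
          starRingEnd ℂ (starRingEnd ℂ z * (q ω - mob z ω + (mob z ω - z))) := by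
        simp only [map_mul, map_add, map_sub, Complex.conj_conj]; ring
      rw [e]
      refine (norm_sub_le _ _).trans ?_
      rw [RCLike.norm_conj, norm_mul, RCLike.norm_conj]
      have h1 : ‖q ω - mob z ω + (mob z ω - z)‖ ≤ C ^ 2 * ‖X ω‖ + ‖mob z ω - z‖ :=
        (norm_add_le _ _).trans (by linarith [hq1 ω hω])
      have h2 : ‖z‖ * ‖q ω - mob z ω + (mob z ω - z)‖ ≤ 1 * (C ^ 2 * ‖X ω‖ + ‖mob z ω - z‖) := by
        gcongr
      linarith
    have r3 := H.sq_le_rpow hω.le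
    rw [norm_mul, norm_mul, RCLike.norm_conj, hω, one_mul]
    calc ‖starRingEnd ℂ z * q ω - z * starRingEnd ℂ (q ω)‖ * ‖A (X ω)‖
        ≤ (2 * (C ^ 2 * ‖X ω‖) + 2 * ‖mob z ω - z‖) * (C * ‖T‖ * ‖X ω‖) :=
          mul_le_mul r1 (gA ω) (norm_nonneg _) (by positivity)
      _ = 2 * C ^ 3 * ‖T‖ * ‖X ω‖ ^ 2 + 2 * C * ‖T‖ * (‖mob z ω - z‖ * ‖X ω‖) := by ring
      _ ≤ 2 * C ^ 3 * ‖T‖ * (2 * C * ‖X ω‖ ^ (1 + α)) +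
          2 * C * ‖T‖ * (‖mob z ω - z‖ * ‖X ω‖) := by
          gcongr
      _ = 4 * C ^ 4 * ‖T‖ * ‖X ω‖ ^ (1 + α) + 2 * C * ‖T‖ * (‖mob z ω - z‖ * ‖X ω‖) := by ring
  have e6 : ‖z‖ * ‖a‖ * ‖A (deriv f 0)‖ = ‖starRingEnd ℂ z * (a * A (deriv f 0))‖ := by
    rw [norm_mul, norm_mul, RCLike.norm_conj, mul_assoc]
  rw [e6, e5]
  refine (norm_add_le _ _).trans ?_
  have b6 : ‖z * starRingEnd ℂ I‖ ≤ C * (6 * C ^ 4 * ‖T‖ * J) := by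
    rw [norm_mul, RCLike.norm_conj]
    calc ‖z‖ * ‖I‖ ≤ 1 * ‖I‖ := by gcongr; exact H.hz.le
      _ = ‖I‖ := one_mul _
      _ ≤ _ := bI
  refine (add_le_add b6 b5).trans_eq ?_
  ring

end Dual


lemma step_aux {C m x J p : ℝ} (hC : 1 ≤ C) (hx : 0 ≤ x) (hJ : 0 ≤ J) (hp : 0 ≤ p)
    (h : 2 * m * x ^ 2 ≤ x * (24 * C ^ 6 * (10 * C ^ 5 * J + 2 * C ^ 2 * (C * p))) +
      x * (C ^ 4 * p)) : 2 * m * x ≤ (240 * C ^ 11 + 49 * C ^ 9) * (p + J) := by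
  rcases hx.eq_or_lt with h0 | h0
  · rw [← h0, mul_zero]; positivity
  · refine le_of_mul_le_mul_left ?_ h0
    have h1 : C ^ 4 * p ≤ C ^ 9 * p := by
      gcongr
      norm_num
    calc x * (2 * m * x) = 2 * m * x ^ 2 := by ring
      _ ≤ x * (24 * C ^ 6 * (10 * C ^ 5 * J + 2 * C ^ 2 * (C * p))) + x * (C ^ 4 * p) := h
      _ = x * (240 * C ^ 11 * J + 48 * C ^ 9 * p + C ^ 4 * p) := by ring
      _ ≤ x * ((240 * C ^ 11 + 49 * C ^ 9) * (p + J)) := by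
          refine mul_le_mul_of_nonneg_left ?_ hx
          have h2 : 0 ≤ 240 * C ^ 11 * p := by positivity
          have h3 : 0 ≤ 49 * C ^ 9 * J := by positivity
          linarith

namespace Dual
variable {G : Geom α Ω} {f : ℂ → E N} {z : ℂ} {P : ℂ → ℝ} {C τ : ℝ}

lemma integral_norm_X_le (H : Dual G f z P C τ) : ∫ ω, ‖f ω - f 0‖ ∂circ ≤ C * √τ := by
  have h := integral_circ_norm_le H.continuousOn_X (s := √τ) (A := C) (Real.sqrt_pos.2 H.hτ)
    (by rw [Real.sq_sqrt H.hτ.le]; exact H.sq_le)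
  refine h.trans ?_
  have := H.hC
  gcongr
  linarith

lemma integral_mob_le (H : Dual G f z P C τ) : ∫ ω, ‖mob z ω - z‖ ∂circ ≤ √(1 - ‖z‖ ^ 2) := by
  have hz := H.hz
  have ht : 0 < 1 - ‖z‖ ^ 2 := by nlinarith [norm_nonneg z]
  have h := integral_circ_norm_le (H.continuousOn_mob.sub (continuousOn_const (c := z)))
    (s := √(1 - ‖z‖ ^ 2)) (A := 1) (Real.sqrt_pos.2 ht)
    (by rw [Real.sq_sqrt ht.le, one_mul]; exact (integral_circ_mob_sub_sq hz).le)
  refine h.trans_eq ?_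
  ring

lemma centre_ge (H : Dual G f z P C τ) {ν₀ : E N} (hν : ell G.ρ (f 0) ν₀ = 1) (hν' : ‖ν₀‖ ≤ C)
    (hτ : τ ≤ C * (1 - ‖z‖ ^ 2)) (ht : √(1 - ‖z‖ ^ 2) * (24 * C ^ 11) ≤ 1) :
    1 / 2 ≤ ‖z‖ ∧
    1 ≤ 12 * C ^ 6 * ‖∫ ω, (P ω : ℂ) * (mob z ω * ell G.ρ (f ω) ν₀) ∂circ‖ := by
  have hC := H.hC
  have hz := H.hz
  have ht0 : 0 ≤ 1 - ‖z‖ ^ 2 := by nlinarith [norm_nonneg z]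
  set s := √(1 - ‖z‖ ^ 2) with hs
  have hs0 : 0 ≤ s := Real.sqrt_nonneg _
  have hs2 : s ^ 2 = 1 - ‖z‖ ^ 2 := Real.sq_sqrt ht0
  have hzh : 1 / 2 ≤ ‖z‖ := by
    have h1 : (1:ℝ) ≤ C ^ 11 := one_le_pow₀ hC
    have h2 : s * 24 ≤ s * (24 * C ^ 11) := by gcongr; linarith
    have h3 : s ≤ 1 / 24 := by linarith
    have h4 : s ^ 2 ≤ (1 / 24) ^ 2 := by gcongr
    by_contra hcon
    push Not at hcon
    have : ‖z‖ ^ 2 ≤ (1 / 2) ^ 2 := by gcongr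
    norm_num at h4 this
    linarith
  refine ⟨hzh, ?_⟩
  set a := ∫ ω, (P ω : ℂ) * (mob z ω * ell G.ρ (f ω) ν₀) ∂circ
  set m := ∫ ω, P ω ∂circ with hm
  have hmass := H.mass_ge
  have cq : ContinuousOn (fun ω => mob z ω * ell G.ρ (f ω) ν₀) (sphere (0:ℂ) 1) :=
    H.continuousOn_mob.mul (G.continuousOn_ell_comp H.dc H.maps continuousOn_const)
  have c1 := H.continuousOn_X.norm
  have c2 := (H.continuousOn_mob.sub (continuousOn_const (c := z))).norm
  have e1 : a - z * m = ∫ ω, (P ω : ℂ) * (mob z ω * ell G.ρ (f ω) ν₀ - z) ∂circ := by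
    simp only [mul_sub]
    have i2 : Integrable (fun ω => (P ω : ℂ) * z) circ := H.integrable continuousOn_const
    rw [integral_sub (H.integrable cq) i2, integral_mul_const, integral_complex_ofReal]
    ring
  have b1 : ‖a - z * m‖ ≤ C * (C ^ 2 * (C * √τ) + s) := by
    rw [e1]
    refine (H.norm_integral_le (b := fun ω => C ^ 2 * ‖f ω - f 0‖ + ‖mob z ω - z‖)
      ((continuousOn_const.mul c1).add c2) fun ω hω => ?_).trans ?_
    · have e : mob z ω * ell G.ρ (f ω) ν₀ - z =
          mob z ω * (ell G.ρ (f ω) ν₀ - ell G.ρ (f 0) ν₀) + (mob z ω - z) := by rw [hν]; ring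
      rw [e]
      refine (norm_add_le _ _).trans ?_
      rw [norm_mul, norm_mob_eq hz hω, one_mul]
      gcongr
      refine (H.norm_ell_sub hω.le ν₀).trans ?_
      calc C * ‖f ω - f 0‖ * ‖ν₀‖ ≤ C * ‖f ω - f 0‖ * C := by gcongr
        _ = C ^ 2 * ‖f ω - f 0‖ := by ring
    · have i1 : Integrable (fun ω => C ^ 2 * ‖f ω - f 0‖) circ := (integrable_circ c1).const_mul _
      have i2 : Integrable (fun ω => ‖mob z ω - z‖) circ := integrable_circ c2
      rw [integral_add i1 i2, integral_const_mul]
      have := H.integral_norm_X_le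
      have := H.integral_mob_le
      gcongr
  have h2 : √τ ≤ C * s := by
    rw [Real.sqrt_le_left (by positivity), mul_pow, hs2]
    refine hτ.trans ?_
    gcongr
    exact le_self_pow₀ hC (by norm_num)
  have h3 : C * (C ^ 2 * (C * √τ) + s) ≤ 2 * C ^ 5 * s := by
    calc C * (C ^ 2 * (C * √τ) + s) ≤ C * (C ^ 2 * (C * (C * s)) + s) := by gcongr
      _ = C ^ 5 * s + C * s := by ring
      _ ≤ C ^ 5 * s + C ^ 5 * s := by
        gcongr
        exact le_self_pow₀ hC (by norm_num)
      _ = _ := by ring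
  have hm0 : 0 ≤ m := integral_nonneg_of_ae H.nonneg
  have h4 : ‖z‖ * m ≤ ‖a‖ + ‖a - z * m‖ := by
    have : ‖z * (m:ℂ)‖ = ‖z‖ * m := by rw [norm_mul, Complex.norm_real, Real.norm_of_nonneg hm0]
    rw [← this]
    exact norm_le_norm_add_norm_sub _ _
  have h5 : 1 / 2 * m ≤ ‖z‖ * m := by gcongr
  have h6 : 12 * C ^ 6 * (1 / 2 * m) ≤ 12 * C ^ 6 * (‖a‖ + 2 * C ^ 5 * s) := by
    gcongr; linarith
  have e7 : 12 * C ^ 6 * (‖a‖ + 2 * C ^ 5 * s) = 12 * C ^ 6 * ‖a‖ + s * (24 * C ^ 11) := by ring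
  linarith

set_option maxHeartbeats 1600000 in
/-- The derivative at the centre of a disc with dual density. -/
lemma step (H : Dual G f z P C τ) {D : ℝ} (hD : 0 < D) (hDC : D ≤ C)
    (hτ : τ = D * (1 - ‖z‖ ^ 2)) (ht : √(1 - ‖z‖ ^ 2) * (24 * C ^ 11) ≤ 1)
    (hκ : -G.κ ≤ G.ρ (f 0)) :
    ‖deriv f 0‖ ≤ ((240 * C ^ 11 + 49 * C ^ 9) / (2 * G.m) + C ^ 3) *
      ((1 - ‖z‖ ^ 2) * √D + ∫ ω, ‖f ω - f 0‖ ^ (1 + α) ∂circ) := by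
  have hC := H.hC
  have hz := H.hz
  have hm := G.hm
  have hf0 : f 0 ∈ closure Ω := H.mem (by simp)
  have hf0' : f 0 ∈ Ω := H.maps (by simp)
  set t := 1 - ‖z‖ ^ 2 with ht'
  have ht0 : 0 ≤ t := by rw [ht']; nlinarith [norm_nonneg z]
  have hν := G.ell_nu (f 0) hf0 hκ
  have hν' : ‖G.ν (f 0)‖ ≤ C := (G.nu_le _ hf0).trans H.hMC
  obtain ⟨hzh, ha⟩ := H.centre_ge hν hν' (by rw [hτ]; gcongr) ht
  set ν₀ := G.ν (f 0)
  set e := deriv f 0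
  set b := ell G.ρ (f 0) e with hb
  set T := e - b • ν₀ with hTdef
  have hT : ell G.ρ (f 0) T = 0 := by
    rw [hTdef, map_sub, map_smul, hν, ← hb, smul_eq_mul, mul_one, sub_self]
  obtain ⟨S, A, hS, hA, hAT, hSA⟩ := G.exists_split hf0 hT
  have hcore := H.core hν hν' hS hA hSA
  set a := ∫ ω, (P ω : ℂ) * (mob z ω * ell G.ρ (f ω) ν₀) ∂circ
  set J := ∫ ω, ‖f ω - f 0‖ ^ (1 + α) ∂circ with hJ
  set W := ∫ ω, ‖mob z ω - z‖ * ‖f ω - f 0‖ ∂circ with hW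
  have hJ0 : 0 ≤ J := integral_nonneg fun ω => by positivity
  set r := √D with hr
  have hr0 : 0 < r := Real.sqrt_pos.2 hD
  have hr2 : r ^ 2 = D := Real.sq_sqrt hD.le
  have hrC : r ≤ C := by
    rw [hr, Real.sqrt_le_left (by linarith)]
    exact hDC.trans (le_self_pow₀ hC (by norm_num))
  have c1 := H.continuousOn_X.norm
  have c2 := (H.continuousOn_mob.sub (continuousOn_const (c := z))).norm
  have hW1 : W ≤ C * (t * r) := by
    have i1 : Integrable (fun ω => r / 2 * ‖mob z ω - z‖ ^ 2) circ :=
      (integrable_circ (c2.pow 2)).const_mul _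
    have i2 : Integrable (fun ω => 1 / (2 * r) * ‖f ω - f 0‖ ^ 2) circ :=
      (integrable_circ (c1.pow 2)).const_mul _
    calc W ≤ ∫ ω, (r / 2 * ‖mob z ω - z‖ ^ 2 + 1 / (2 * r) * ‖f ω - f 0‖ ^ 2) ∂circ := by
          refine integral_mono (integrable_circ (c2.mul c1)) (i1.add i2) fun ω => ?_
          have h := two_mul_le_add_sq (r * ‖mob z ω - z‖) (‖f ω - f 0‖)
          have e1 : r / 2 * ‖mob z ω - z‖ ^ 2 + 1 / (2 * r) * ‖f ω - f 0‖ ^ 2 =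
            ((r * ‖mob z ω - z‖) ^ 2 + ‖f ω - f 0‖ ^ 2) / (2 * r) := by field_simp
          simp only
          rw [e1, le_div_iff₀ (by positivity)]
          linarith
      _ = r / 2 * t + 1 / (2 * r) * ∫ ω, ‖f ω - f 0‖ ^ 2 ∂circ := by
          rw [integral_add i1 i2, integral_const_mul, integral_const_mul,
            integral_circ_mob_sub_sq hz]
      _ ≤ r / 2 * t + 1 / (2 * r) * (C * τ) := by gcongr; exact H.sq_le
      _ = (1 / 2 + C / 2) * (t * r) := by rw [hτ, ← hr2]; field_simp
      _ ≤ C * (t * r) := by gcongr; linarith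
  have hτ1 : τ ≤ C * (t * r) := by
    rw [hτ, ← hr2]
    calc r ^ 2 * t = r * (t * r) := by ring
      _ ≤ C * (t * r) := by gcongr
  have hbτ : ‖b‖ ≤ C * τ := H.ell_deriv_le
  have hbν : ‖b • ν₀‖ ≤ C ^ 3 * (t * r) := by
    rw [norm_smul]
    calc ‖b‖ * ‖ν₀‖ ≤ (C * (C * (t * r))) * C := by
          gcongr
          exact hbτ.trans (by gcongr)
      _ = _ := by ring
  have heT : ‖e‖ ≤ ‖T‖ + C ^ 3 * (t * r) := by
    have : e = T + b • ν₀ := by rw [hTdef]; abel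
    calc ‖e‖ = ‖T + b • ν₀‖ := by rw [← this]
      _ ≤ _ := (norm_add_le _ _).trans (by linarith)
  have hAe : ‖A e‖ ≤ ‖T‖ * (24 * C ^ 6 * (10 * C ^ 5 * J + 2 * C ^ 2 * (C * (t * r)))) := by
    have h1 : 1 ≤ 24 * C ^ 6 * (‖z‖ * ‖a‖) := by
      have : 24 * C ^ 6 * (1 / 2 * ‖a‖) ≤ 24 * C ^ 6 * (‖z‖ * ‖a‖) := by gcongr
      linarith
    calc ‖A e‖ ≤ (24 * C ^ 6 * (‖z‖ * ‖a‖)) * ‖A e‖ := le_mul_of_one_le_left (norm_nonneg _) h1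
      _ = 24 * C ^ 6 * (‖z‖ * ‖a‖ * ‖A e‖) := by ring
      _ ≤ 24 * C ^ 6 * (‖T‖ * (10 * C ^ 5 * J + 2 * C ^ 2 * W)) := by gcongr
      _ ≤ 24 * C ^ 6 * (‖T‖ * (10 * C ^ 5 * J + 2 * C ^ 2 * (C * (t * r)))) := by gcongr
      _ = _ := by ring
  have hAT' : 2 * G.m * ‖T‖ ^ 2 ≤ ‖A T‖ := by
    have h1 := G.levi_ge (f 0) (G.closure_sub hf0) hκ T
    rw [hT] at h1
    simp only [norm_zero, ne_eq, OfNat.ofNat_ne_zero, not_false_eq_true, zero_pow, mul_zero,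
      add_zero] at h1
    rw [hAT, Complex.norm_real]
    refine le_trans ?_ (le_abs_self _)
    linarith
  have hATe : ‖A T‖ ≤ ‖A e‖ + ‖T‖ * (C ^ 4 * (t * r)) := by
    have : A T = A e - A (b • ν₀) := by rw [hTdef, map_sub]
    rw [this]
    refine (norm_sub_le _ _).trans ?_
    gcongr
    refine (hA _).trans ?_
    calc G.M * ‖T‖ * ‖b • ν₀‖ ≤ C * ‖T‖ * (C ^ 3 * (t * r)) := by
          have := H.hMC
          gcongr
      _ = _ := by ring
  have hp : 0 ≤ t * r := mul_nonneg ht0 hr0.le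
  have hTY := step_aux hC (norm_nonneg T) hJ0 hp (hAT'.trans (hATe.trans (by gcongr)))
  have hT2 : ‖T‖ ≤ (240 * C ^ 11 + 49 * C ^ 9) / (2 * G.m) * (t * r + J) := by
    rw [div_mul_eq_mul_div, le_div_iff₀ (mul_pos two_pos hm)]
    linarith
  have h3 : C ^ 3 * (t * r) ≤ C ^ 3 * (t * r + J) :=
    mul_le_mul_of_nonneg_left (le_add_of_nonneg_right hJ0) (by positivity)
  rw [add_mul]
  linarith

end Dual

namespace Geom
variable (G : Geom α Ω)

lemma comp_mob {φ : ℂ → E N} (hφ : DiffContOnCl ℂ φ (ball 0 1))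
    (hm : MapsTo φ (ball (0:ℂ) 1) Ω) {z : ℂ} (hz : ‖z‖ < 1) :
    DiffContOnCl ℂ (fun ω => φ (mob z ω)) (ball 0 1) ∧
    MapsTo (fun ω => φ (mob z ω)) (ball (0:ℂ) 1) Ω ∧
    deriv (fun ω => φ (mob z ω)) 0 = ((1 - ‖z‖ ^ 2 : ℝ) : ℂ) • deriv φ z := by
  have hmobb : MapsTo (mob z) (ball (0:ℂ) 1) (ball 0 1) := fun ω hω => by
    simpa using norm_mob_lt hz (by simpa using hω)
  refine ⟨⟨hφ.differentiableOn.comp (diffContOnCl_mob hz).differentiableOn hmobb, ?_⟩,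
    fun ω hω => hm (hmobb hω), ?_⟩
  · rw [closure_ball _ one_ne_zero]
    exact hφ.continuousOn_ball.comp (diffContOnCl_mob hz).continuousOn_ball fun ω hω => by
      simpa using norm_mob_le hz (by simpa using hω)
  · have h1 : HasDerivAt φ (deriv φ z) (mob z 0) := by
      rw [mob_zero]
      exact (hφ.differentiableOn.differentiableAt
        (isOpen_ball.mem_nhds (by simpa using hz))).hasDerivAt
    exact (h1.scomp 0 (hasDerivAt_mob_zero z)).deriv

theorem exists_dual_disc : ∃ C : ℝ, 1 ≤ C ∧ ∀ φ : ℂ → E N, DiffContOnCl ℂ φ (ball 0 1) →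
    G.IsCentred φ → ∀ z : ℂ, ‖z‖ < 1 → ∃ P : ℂ → ℝ,
      Dual G (fun ω => φ (mob z ω)) z P C (G.u (φ 0) * (1 - ‖z‖ ^ 2)) ∧
      G.u (φ z) ≤ C * (1 - ‖z‖ ^ 2) := by
  obtain ⟨C₁, h₁, H₁⟩ := G.exists_mean_estimate
  obtain ⟨C₂, h₂, H₂⟩ := G.exists_deriv_estimate
  obtain ⟨C₃, h₃, H₃⟩ := G.exists_growth
  obtain ⟨C₄, h₄, H₄⟩ := G.exists_dual
  have hM := G.hM
  set C := C₁ * (2 * C₂) * C₃ * C₄ * G.M with hCdef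
  have m1 : 1 ≤ C₁ * (2 * C₂) := one_le_mul_of_one_le_of_one_le h₁ (by linarith)
  have m2 : 1 ≤ C₁ * (2 * C₂) * C₃ := one_le_mul_of_one_le_of_one_le m1 h₃
  have m3 : 1 ≤ C₁ * (2 * C₂) * C₃ * C₄ := one_le_mul_of_one_le_of_one_le m2 h₄
  have hC : 1 ≤ C := one_le_mul_of_one_le_of_one_le m3 hM
  have l3 : C₁ * (2 * C₂) * C₃ * C₄ ≤ C := le_mul_of_one_le_right (by linarith) hM
  have l2 : C₁ * (2 * C₂) * C₃ ≤ C := (le_mul_of_one_le_right (by linarith) h₄).trans l3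
  have lM : G.M ≤ C := le_mul_of_one_le_left (by linarith) m3
  have l4 : C₄ ≤ C := (le_mul_of_one_le_left (by linarith) m2).trans l3
  have l13 : C₁ * C₃ ≤ C := by
    refine le_trans ?_ l2
    have : C₁ ≤ C₁ * (2 * C₂) := le_mul_of_one_le_right (by linarith) (by linarith)
    gcongr
  have l23 : 2 * C₂ * C₃ ≤ C := by
    refine le_trans ?_ l2
    have : 2 * C₂ ≤ C₁ * (2 * C₂) := le_mul_of_one_le_left (by linarith) h₁
    gcongr
  have l3M : C₃ * G.M ≤ C := by
    have : C₃ ≤ C₁ * (2 * C₂) * C₃ * C₄ :=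
      (le_mul_of_one_le_left (by linarith) m1).trans (le_mul_of_one_le_right (by linarith) h₄)
    rw [hCdef]
    gcongr
  refine ⟨C, hC, fun φ hφ hcen z hz => ?_⟩
  obtain ⟨hdφ, hmφ, hiso⟩ := hcen.1
  obtain ⟨P, hP, hP0, hP1, hPd⟩ := H₄ φ hφ hcen z hz
  obtain ⟨d1, d2, d3⟩ := comp_mob hφ hmφ hz
  have hD : 0 < G.u (φ 0) := G.u_pos (hmφ (by simp))
  have hDM : G.u (φ 0) ≤ G.M := G.u_le (subset_closure (hmφ (by simp)))
  set t := 1 - ‖z‖ ^ 2 with ht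
  have hz0 := norm_nonneg z
  have ht1 : 1 - ‖z‖ ≤ t := by rw [ht]; nlinarith
  have ht2 : t ≤ 2 * (1 - ‖z‖) := by rw [ht]; nlinarith
  have ht0 : 0 < t := by linarith
  have hu : G.u (φ z) ≤ C₃ * (G.u (φ 0) * t) := by
    refine (H₃ φ hcen z hz).1.trans ?_
    rw [mul_assoc]
    gcongr
  obtain ⟨g1, g2⟩ := H₂ φ hdφ hmφ z hz
  have hτ : 0 < G.u (φ 0) * t := by positivity
  refine ⟨P, ⟨hz, d1, d2, hP, hP0, hP1.mono fun ω h => h.trans l4, hC, lM, hτ, ?_, ?_, ?_, ?_⟩, ?_⟩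
  · intro k β hk hβ
    rw [d3] at hβ
    exact hPd k β hk hβ
  · rw [d3, norm_smul, Complex.norm_real, Real.norm_of_nonneg ht0.le]
    have hs : √(G.u (φ z)) ≤ C₃ * √(G.u (φ 0) * t) := by
      rw [Real.sqrt_le_left (by positivity), mul_pow, Real.sq_sqrt hτ.le]
      refine hu.trans ?_
      gcongr
      exact le_self_pow₀ h₃ (by norm_num)
    calc t * ‖deriv φ z‖ ≤ 2 * (1 - ‖z‖) * ‖deriv φ z‖ := by gcongr
      _ = 2 * ((1 - ‖z‖) * ‖deriv φ z‖) := by ring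
      _ ≤ 2 * (C₂ * (C₃ * √(G.u (φ 0) * t))) := by
          refine mul_le_mul_of_nonneg_left (g1.trans ?_) zero_le_two
          gcongr
      _ = (2 * C₂ * C₃) * √(G.u (φ 0) * t) := by ring
      _ ≤ C * √(G.u (φ 0) * t) := by gcongr
  · rw [d3, mob_zero, map_smul, norm_smul, Complex.norm_real, Real.norm_of_nonneg ht0.le]
    calc t * ‖ell G.ρ (φ z) (deriv φ z)‖ ≤ 2 * (1 - ‖z‖) * ‖ell G.ρ (φ z) (deriv φ z)‖ := by
          gcongr
      _ = 2 * ((1 - ‖z‖) * ‖ell G.ρ (φ z) (deriv φ z)‖) := by ring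
      _ ≤ 2 * (C₂ * (C₃ * (G.u (φ 0) * t))) := by
          refine mul_le_mul_of_nonneg_left (g2.trans ?_) zero_le_two
          gcongr
      _ = (2 * C₂ * C₃) * (G.u (φ 0) * t) := by ring
      _ ≤ C * (G.u (φ 0) * t) := by gcongr
  · refine (H₁ _ d1 d2).2.trans ?_
    simp only [mob_zero]
    calc C₁ * G.u (φ z) ≤ C₁ * (C₃ * (G.u (φ 0) * t)) := by gcongr
      _ = C₁ * C₃ * (G.u (φ 0) * t) := by ring
      _ ≤ _ := by gcongr
  · calc G.u (φ z) ≤ C₃ * (G.u (φ 0) * t) := hu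
      _ ≤ C₃ * (G.M * t) := by gcongr
      _ = C₃ * G.M * t := by ring
      _ ≤ C * t := by gcongr

/-- The derivative of a centred geodesic is controlled by its mean oscillation. -/
theorem exists_step : ∃ C : ℝ, 1 ≤ C ∧ ∀ φ : ℂ → E N, DiffContOnCl ℂ φ (ball 0 1) →
    G.IsCentred φ → ∀ z : ℂ, ‖z‖ < 1 →
    (1 - ‖z‖ ^ 2) * ‖deriv φ z‖ ≤ C * ((1 - ‖z‖ ^ 2) * √(G.u (φ 0)) +
      ∫ ω, ‖φ (mob z ω) - φ z‖ ^ (1 + α) ∂circ) := by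
  obtain ⟨C, hC, H⟩ := G.exists_dual_disc
  have hm := G.hm
  have hκ := G.hκ
  obtain ⟨K, hK⟩ : ∃ K, K = (240 * C ^ 11 + 49 * C ^ 9) / (2 * G.m) + C ^ 3 := ⟨_, rfl⟩
  have hK0 : 0 < K := by rw [hK]; positivity
  set t₀ := min ((1 / (24 * C ^ 11)) ^ 2) (G.κ / C) with ht₀
  have ht₀0 : 0 < t₀ := lt_min (by positivity) (by positivity)
  refine ⟨max 1 (max K (C / t₀)), le_max_left _ _, fun φ hφ hcen z hz => ?_⟩
  obtain ⟨P, hP, hu⟩ := H φ hφ hcen z hz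
  obtain ⟨-, hmφ, -⟩ := hcen.1
  obtain ⟨-, -, d3⟩ := comp_mob hφ hmφ hz
  have hD : 0 < G.u (φ 0) := G.u_pos (hmφ (by simp))
  have hDM : G.u (φ 0) ≤ G.M := G.u_le (subset_closure (hmφ (by simp)))
  set D := G.u (φ 0) with hDdef
  set t := 1 - ‖z‖ ^ 2 with ht
  have ht0 : 0 < t := by rw [ht]; nlinarith [norm_nonneg z]
  have ht1 : t ≤ 1 := by rw [ht]; nlinarith [norm_nonneg z]
  set J := ∫ ω, ‖φ (mob z ω) - φ z‖ ^ (1 + α) ∂circ with hJ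
  have hJ0 : 0 ≤ J := integral_nonneg fun ω => by positivity
  have hY : 0 ≤ t * √D + J := by positivity
  have e1 : ‖deriv (fun ω => φ (mob z ω)) 0‖ = t * ‖deriv φ z‖ := by
    rw [d3, norm_smul, Complex.norm_real, Real.norm_of_nonneg ht0.le]
  by_cases hc : t ≤ t₀
  · have h1 : √t * (24 * C ^ 11) ≤ 1 := by
      have : √t ≤ 1 / (24 * C ^ 11) := by
        rw [Real.sqrt_le_left (by positivity)]
        exact hc.trans (min_le_left _ _)
      rwa [le_div_iff₀ (by positivity)] at this
    have h2 : -G.κ ≤ G.ρ (φ (mob z 0)) := by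
      rw [mob_zero]
      have h3 : t * C ≤ G.κ := by
        have := hc.trans (min_le_right _ _)
        rwa [le_div_iff₀ (by positivity)] at this
      have h4 : -G.ρ (φ z) ≤ C * t := hu
      linarith
    have h := hP.step hD (hDM.trans hP.hMC) rfl h1 h2
    rw [e1, ← hK] at h
    simp only [mob_zero] at h
    have h' : t * ‖deriv φ z‖ ≤ K * (t * √D + J) := h
    refine h'.trans (mul_le_mul_of_nonneg_right ?_ hY)
    exact (le_max_left _ _).trans (le_max_right _ _)
  · push Not at hc
    have h := hP.deriv_le
    rw [e1] at h
    calc t * ‖deriv φ z‖ ≤ C * √(D * t) := h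
      _ ≤ C * √D := by
          gcongr
          exact mul_le_of_le_one_right hD.le ht1
      _ = C / t₀ * (t₀ * √D) := by field_simp
      _ ≤ C / t₀ * (t * √D + J) := by
          gcongr
          have : t₀ * √D ≤ t * √D := by gcongr
          linarith
      _ ≤ _ := mul_le_mul_of_nonneg_right ((le_max_right _ _).trans (le_max_right _ _)) hY

end Geom


lemma re_one_add_pos {z ω : ℂ} (hz : ‖z‖ < 1) (hω : ‖ω‖ ≤ 1) :
    0 < (1 + (starRingEnd ℂ) z * ω).re := by
  have h : ‖(starRingEnd ℂ) z * ω‖ < 1 := by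
    rw [norm_mul, RCLike.norm_conj]
    nlinarith [norm_nonneg z, norm_nonneg ω]
  have h2 := Complex.abs_re_le_norm ((starRingEnd ℂ) z * ω)
  rw [Complex.add_re, Complex.one_re]
  linarith [neg_abs_le ((starRingEnd ℂ) z * ω).re]

lemma cos_mul_rpow_norm_le_re_cpow {w : ℂ} (hw : 0 < w.re) {p : ℝ} (hp : |p| ≤ 1) :
    Real.cos (p * Real.pi / 2) * ‖w‖ ^ p ≤ (w ^ (p : ℂ)).re := by
  rw [Complex.cpow_ofReal_re, mul_comm]
  refine mul_le_mul_of_nonneg_left ?_ (by positivity)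
  have h1 : |w.arg| < Real.pi / 2 := Complex.abs_arg_lt_pi_div_two_iff.2 (Or.inl hw)
  have hpi := Real.pi_pos
  rw [← Real.cos_abs (p * Real.pi / 2), ← Real.cos_abs (w.arg * p)]
  have e : |p * Real.pi / 2| = |p| * (Real.pi / 2) := by
    rw [mul_div_assoc, abs_mul, abs_of_pos (by positivity : 0 < Real.pi / 2)]
  rw [e, abs_mul]
  have h0 := abs_nonneg p
  apply Real.cos_le_cos_of_nonneg_of_le_pi (by positivity)
  · nlinarith
  · rw [mul_comm]; gcongr

lemma diffContOnCl_one_add_cpow {z : ℂ} (hz : ‖z‖ < 1) (p : ℂ) :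
    DiffContOnCl ℂ (fun ω : ℂ => (1 + (starRingEnd ℂ) z * ω) ^ p) (ball 0 1) := by
  apply DifferentiableOn.diffContOnCl
  rw [closure_ball _ one_ne_zero]
  intro ω hω
  have hω' : ‖ω‖ ≤ 1 := by simpa using hω
  apply DifferentiableAt.differentiableWithinAt
  refine DifferentiableAt.cpow (by fun_prop) (by fun_prop) ?_
  exact Or.inl (re_one_add_pos hz hω')

lemma continuousOn_norm_one_add_rpow {z : ℂ} (hz : ‖z‖ < 1) (p : ℝ) :
    ContinuousOn (fun ω : ℂ => ‖1 + (starRingEnd ℂ) z * ω‖ ^ p) (sphere 0 1) := by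
  intro ω hω
  have hω' : ‖ω‖ = 1 := by simpa using hω
  refine ContinuousAt.continuousWithinAt ?_
  refine ContinuousAt.rpow_const (by fun_prop) (Or.inl ?_)
  exact norm_ne_zero_iff.2 (mob_den_ne hz hω'.le)

lemma cos_mul_integral_rpow_le_one {z : ℂ} (hz : ‖z‖ < 1) {s : ℝ} (hs : |s| ≤ 1) :
    Real.cos (s * Real.pi / 2) * ∫ ω, ‖1 + (starRingEnd ℂ) z * ω‖ ^ (-s) ∂circ ≤ 1 := by
  have hd := diffContOnCl_one_add_cpow hz ((-s : ℝ) : ℂ)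
  have h1 := hd.integral_circ
  have hc := DiffContOnCl.continuousOn_sphere hd
  have h2 := congrArg Complex.re h1
  rw [← RCLike.re_eq_complex_re, ← integral_re (integrable_circ hc)] at h2
  simp only [mul_zero, add_zero, Complex.one_cpow, RCLike.re_eq_complex_re, Complex.one_re] at h2
  rw [← integral_const_mul, ← h2]
  refine integral_circ_mono (continuousOn_const.mul (continuousOn_norm_one_add_rpow hz _))
    (Complex.continuous_re.comp_continuousOn hc) fun ω hω => ?_
  have := cos_mul_rpow_norm_le_re_cpow (re_one_add_pos hz hω.le) (p := -s) (by rwa [abs_neg])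
  rwa [neg_mul, neg_div, Real.cos_neg] at this

lemma norm_add_eq_norm_one_add {z ω : ℂ} (hω : ‖ω‖ = 1) :
    ‖ω + z‖ = ‖1 + (starRingEnd ℂ) z * ω‖ := by
  have h : (starRingEnd ℂ) ω * ω = 1 := by
    rw [← Complex.normSq_eq_conj_mul_self, Complex.normSq_eq_norm_sq, hω]; simp
  have : 1 + (starRingEnd ℂ) z * ω = (starRingEnd ℂ) (ω + z) * ω := by
    rw [map_add, add_mul, h]
  rw [this, norm_mul, hω, mul_one, RCLike.norm_conj]

lemma cos_mul_integral_rpow_le {z : ℂ} (hz : ‖z‖ < 1) {p : ℝ} (hp : |p| ≤ 1) :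
    Real.cos (p * Real.pi / 2) *
      ∫ ω, (1 - ‖z‖ ^ 2) * ‖1 + (starRingEnd ℂ) z * ω‖ ^ (p - 2) ∂circ ≤ (1 - ‖z‖ ^ 2) ^ p := by
  have ht : 0 < 1 - ‖z‖ ^ 2 := by nlinarith [norm_nonneg z]
  have hd := diffContOnCl_one_add_cpow hz (p : ℂ)
  have hz' : -z ∈ ball (0:ℂ) 1 := by simpa using hz
  have h1 := _root_.DiffContOnCl.circleAverage_poissonKernel_smul hd hz'
  have hc := DiffContOnCl.continuousOn_sphere hd
  have hk : ∀ ω : ℂ, ‖ω‖ = 1 → poissonKernel 0 (-z) ω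
      = (1 - ‖z‖ ^ 2) * ‖1 + (starRingEnd ℂ) z * ω‖ ^ (-2 : ℝ) := by
    intro ω hω
    rw [poissonKernel_def]
    simp only [sub_zero, sub_neg_eq_add, norm_neg]
    rw [norm_add_eq_norm_one_add hω, hω, one_pow, Real.rpow_neg (norm_nonneg _), div_eq_mul_inv]
    norm_num
  have hkc : ContinuousOn (poissonKernel 0 (-z)) (sphere (0:ℂ) 1) := by
    refine ContinuousOn.congr ((continuousOn_norm_one_add_rpow hz (-2)).const_smul (1 - ‖z‖ ^ 2))
      fun ω hω => ?_
    rw [hk ω (by simpa using hω)]; rfl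
  have hc2 := hkc.smul hc
  rw [← integral_circ_eq hc2] at h1
  have h2 := congrArg Complex.re h1
  rw [← RCLike.re_eq_complex_re, ← integral_re (integrable_circ hc2)] at h2
  have e : (1 + (starRingEnd ℂ) z * -z : ℂ) = ((1 - ‖z‖ ^ 2 : ℝ) : ℂ) := by
    rw [mul_neg, ← Complex.normSq_eq_conj_mul_self, Complex.normSq_eq_norm_sq]
    push_cast; ring
  rw [e, ← Complex.ofReal_cpow ht.le, RCLike.re_eq_complex_re, Complex.ofReal_re] at h2
  rw [← integral_const_mul, ← h2]
  refine integral_circ_mono (continuousOn_const.mul (continuousOn_const.mul (continuousOn_norm_one_add_rpow hz _)))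
    (Complex.continuous_re.comp_continuousOn hc2) fun ω hω => ?_
  have h3 := cos_mul_rpow_norm_le_re_cpow (re_one_add_pos hz hω.le) hp
  have hw : 0 < ‖1 + (starRingEnd ℂ) z * ω‖ := norm_pos_iff.2 (mob_den_ne hz hω.le)
  simp only [Pi.smul_apply', hk ω hω, Complex.real_smul, Complex.re_ofReal_mul]
  rw [sub_eq_add_neg p, Real.rpow_add hw]
  have h4 : 0 ≤ (1 - ‖z‖ ^ 2) * ‖1 + (starRingEnd ℂ) z * ω‖ ^ (-2 : ℝ) := by positivity
  nlinarith [mul_le_mul_of_nonneg_left h3 h4]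

lemma norm_mob_sub {z ω : ℂ} (hz : ‖z‖ < 1) (hω : ‖ω‖ = 1) :
    ‖mob z ω - z‖ = (1 - ‖z‖ ^ 2) * ‖1 + (starRingEnd ℂ) z * ω‖⁻¹ := by
  have ht : 0 < 1 - ‖z‖ ^ 2 := by nlinarith [norm_nonneg z]
  rw [mob_sub hz hω.le, norm_div, norm_mul, hω, mul_one, Complex.norm_real,
    Real.norm_of_nonneg ht.le, div_eq_mul_inv]

lemma norm_mob_sub_rpow {z ω : ℂ} (hz : ‖z‖ < 1) (hω : ‖ω‖ = 1) (s : ℝ) :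
    ‖mob z ω - z‖ ^ s = (1 - ‖z‖ ^ 2) ^ s * ‖1 + (starRingEnd ℂ) z * ω‖ ^ (-s) := by
  have ht : 0 < 1 - ‖z‖ ^ 2 := by nlinarith [norm_nonneg z]
  rw [norm_mob_sub hz hω, Real.mul_rpow ht.le (by positivity), Real.inv_rpow (norm_nonneg _),
    Real.rpow_neg (norm_nonneg _)]

lemma cos_mul_integral_mob_sub_rpow_le {z : ℂ} (hz : ‖z‖ < 1) {s : ℝ} (hs : |s| ≤ 1) :
    Real.cos (s * Real.pi / 2) * ∫ ω, ‖mob z ω - z‖ ^ s ∂circ ≤ (1 - ‖z‖ ^ 2) ^ s := by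
  have ht : 0 < 1 - ‖z‖ ^ 2 := by nlinarith [norm_nonneg z]
  rw [integral_circ_congr fun ω hω => norm_mob_sub_rpow hz hω s, integral_const_mul,
    mul_left_comm]
  exact mul_le_of_le_one_right (by positivity) (cos_mul_integral_rpow_le_one hz hs)

lemma cos_mul_integral_mob_sub_rpow_le' {z : ℂ} (hz : ‖z‖ < 1) {s : ℝ} (hs : |2 - s| ≤ 1) :
    Real.cos ((2 - s) * Real.pi / 2) * ∫ ω, ‖mob z ω - z‖ ^ s ∂circ ≤ 1 - ‖z‖ ^ 2 := by
  have ht : 0 < 1 - ‖z‖ ^ 2 := by nlinarith [norm_nonneg z]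
  have h := cos_mul_integral_rpow_le hz hs
  rw [integral_const_mul] at h
  rw [integral_circ_congr fun ω hω => norm_mob_sub_rpow hz hω s, integral_const_mul]
  have e : 2 - s - 2 = -s := by ring
  rw [e] at h
  calc _ = (1 - ‖z‖ ^ 2) ^ (s - 1) * (Real.cos ((2 - s) * Real.pi / 2) *
        ((1 - ‖z‖ ^ 2) * ∫ ω, ‖1 + (starRingEnd ℂ) z * ω‖ ^ (-s) ∂circ)) := by
        rw [Real.rpow_sub_one ht.ne']; field_simp
    _ ≤ (1 - ‖z‖ ^ 2) ^ (s - 1) * (1 - ‖z‖ ^ 2) ^ (2 - s) := by gcongr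
    _ = _ := by rw [← Real.rpow_add ht]; norm_num


namespace Geom
variable (G : Geom α Ω)

lemma u_centre_pos {φ : ℂ → E N} (h : G.IsCentred φ) : 0 < G.u (φ 0) :=
  G.u_pos (h.1.2.1 (mem_ball_self one_pos))

/-- Uniform Hölder control, with exponent `γ`, of the centred complex geodesics. -/
def HolderControl (γ : ℝ) : Prop :=
  ∃ B : ℝ, 0 ≤ B ∧ ∀ φ : ℂ → E N, DiffContOnCl ℂ φ (ball 0 1) → G.IsCentred φ →
    ∀ z : ℂ, ‖z‖ < 1 → ‖deriv φ z‖ ≤ B * √(G.u (φ 0)) * (1 - ‖z‖) ^ (γ - 1)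

/-- Control of the derivatives of all centred geodesics, without boundary regularity. -/
theorem exists_deriv_le_rpow : ∃ B : ℝ, 0 ≤ B ∧ ∀ φ : ℂ → E N, G.IsCentred φ →
    ∀ z : ℂ, ‖z‖ < 1 → ‖deriv φ z‖ ≤ B * √(G.u (φ 0)) * (1 - ‖z‖) ^ ((1/2 : ℝ) - 1) := by
  obtain ⟨C, hC, H⟩ := G.exists_growth
  obtain ⟨A, hA, HA⟩ := G.exists_deriv_estimate
  refine ⟨A * √C, by positivity, fun φ hφ z hz => ?_⟩
  have h1 := (HA φ hφ.1.1 hφ.1.2.1 z hz).1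
  have h2 := (H φ hφ z hz).1
  have hD := G.u_centre_pos hφ
  have hr : 0 < 1 - ‖z‖ := by linarith
  have h3 : (1 - ‖z‖) * ‖deriv φ z‖ ≤ A * (√C * √(G.u (φ 0)) * √(1 - ‖z‖)) := by
    refine h1.trans ?_
    rw [← Real.sqrt_mul (by linarith), ← Real.sqrt_mul (by positivity)]
    gcongr
  rw [Real.rpow_sub_one hr.ne', ← Real.sqrt_eq_rpow, mul_div_assoc', le_div_iff₀ hr]
  linarith

variable {G}

lemma holderControl_half : G.HolderControl (1/2) := by
  obtain ⟨B, hB, H⟩ := G.exists_deriv_le_rpow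
  exact ⟨B, hB, fun φ _ hφ z hz => H φ hφ z hz⟩

lemma HolderControl.mono {γ γ' : ℝ} (h : G.HolderControl γ) (hγ : γ' ≤ γ) :
    G.HolderControl γ' := by
  obtain ⟨B, hB, H⟩ := h
  refine ⟨B, hB, fun φ hd hφ z hz => (H φ hd hφ z hz).trans ?_⟩
  refine mul_le_mul_of_nonneg_left ?_ (by positivity)
  exact Real.rpow_le_rpow_of_exponent_ge (by linarith) (by linarith [norm_nonneg z]) (by linarith)

lemma HolderControl.exists_step {γ : ℝ} (h : G.HolderControl γ) (hγ : 0 < γ) (hγ1 : γ ≤ 1) :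
    ∃ K : ℝ, 0 ≤ K ∧ ∀ φ : ℂ → E N, DiffContOnCl ℂ φ (ball 0 1) → G.IsCentred φ →
      ∀ z : ℂ, ‖z‖ < 1 → (1 - ‖z‖ ^ 2) * ‖deriv φ z‖ ≤
        K * √(G.u (φ 0)) * ((1 - ‖z‖ ^ 2) + ∫ ω, ‖mob z ω - z‖ ^ (γ * (1 + α)) ∂circ) := by
  obtain ⟨B, hB, H⟩ := h
  obtain ⟨C, hC, HC⟩ := G.exists_step
  have hα := G.hα
  have hM := G.M_pos
  obtain ⟨B', hB'⟩ : ∃ B', B' = B * (2 / γ + 1) := ⟨_, rfl⟩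
  have hB'0 : 0 ≤ B' := by rw [hB']; positivity
  obtain ⟨L, hL⟩ : ∃ L, L = B' ^ (1 + α) * √G.M ^ α := ⟨_, rfl⟩
  have hL0 : 0 ≤ L := by rw [hL]; positivity
  refine ⟨C * (1 + L), by positivity, fun φ hd hφ z hz => ?_⟩
  have hD := G.u_centre_pos hφ
  have hDM : G.u (φ 0) ≤ G.M := G.u_le (subset_closure (hφ.1.2.1 (mem_ball_self one_pos)))
  have ht : 0 < 1 - ‖z‖ ^ 2 := by nlinarith [norm_nonneg z]
  set S := √(G.u (φ 0)) with hS
  have hS0 : 0 < S := Real.sqrt_pos.2 hD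
  have hcm : ContinuousOn (mob z) (sphere 0 1) :=
    DiffContOnCl.continuousOn_sphere (diffContOnCl_mob hz)
  have hJ0 : 0 ≤ ∫ ω, ‖mob z ω - z‖ ^ (γ * (1 + α)) ∂circ :=
    integral_nonneg fun ω => by positivity
  have hJ : ∫ ω, ‖φ (mob z ω) - φ z‖ ^ (1 + α) ∂circ ≤
      L * S * ∫ ω, ‖mob z ω - z‖ ^ (γ * (1 + α)) ∂circ := by
    rw [← integral_const_mul]
    refine integral_circ_mono ?_ ?_ fun ω hω => ?_
    · have := DiffContOnCl.continuousOn_sphere (Geom.comp_mob hd hφ.1.2.1 hz).1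
      exact ((this.sub continuousOn_const).norm).rpow_const fun _ _ => Or.inr (by linarith)
    · exact continuousOn_const.mul (((hcm.sub continuousOn_const).norm).rpow_const
        fun _ _ => Or.inr (by positivity))
    · have h1 := DiffContOnCl.norm_sub_le_of_norm_deriv_le hd (B := B * S) (by positivity) hγ hγ1
        (fun z hz => H φ hd hφ z hz) hz (norm_mob_le hz hω.le)
      have h2 : B * S * (2 / γ + 1) = B' * S := by rw [hB']; ring
      rw [h2] at h1
      calc ‖φ (mob z ω) - φ z‖ ^ (1 + α) ≤ (B' * S * ‖mob z ω - z‖ ^ γ) ^ (1 + α) := by gcongr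
        _ = B' ^ (1 + α) * S ^ (1 + α) * ‖mob z ω - z‖ ^ (γ * (1 + α)) := by
          rw [Real.mul_rpow (by positivity) (by positivity), Real.mul_rpow hB'0 hS0.le,
            ← Real.rpow_mul (norm_nonneg _)]
        _ ≤ L * S * ‖mob z ω - z‖ ^ (γ * (1 + α)) := by
          refine mul_le_mul_of_nonneg_right ?_ (by positivity)
          rw [add_comm 1 α, Real.rpow_add_one hS0.ne', hL, add_comm 1 α, ← mul_assoc]
          have : S ^ α ≤ √G.M ^ α :=
            Real.rpow_le_rpow hS0.le (Real.sqrt_le_sqrt hDM) hα.le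
          gcongr
  refine (HC φ hd hφ z hz).trans ?_
  rw [mul_assoc, mul_assoc]
  refine mul_le_mul_of_nonneg_left ?_ (by linarith)
  have e1 : 0 ≤ S * ∫ ω, ‖mob z ω - z‖ ^ (γ * (1 + α)) ∂circ := by positivity
  have e2 : 0 ≤ L * (S * (1 - ‖z‖ ^ 2)) := by positivity
  nlinarith

lemma HolderControl.mul_one_add {γ : ℝ} (h : G.HolderControl γ) (hγ : 0 < γ) (hγ1 : γ ≤ 1)
    (hs : γ * (1 + α) < 1) : G.HolderControl (γ * (1 + α)) := by
  obtain ⟨K, hK, H⟩ := h.exists_step hγ hγ1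
  have hα := G.hα
  set s := γ * (1 + α) with hs'
  have hs0 : 0 < s := by positivity
  have hcos : 0 < Real.cos (s * Real.pi / 2) := by
    apply Real.cos_pos_of_mem_Ioo
    constructor <;> nlinarith [Real.pi_pos]
  refine ⟨K * (1 + 1 / Real.cos (s * Real.pi / 2)), by positivity, fun φ hd hφ z hz => ?_⟩
  have ht : 0 < 1 - ‖z‖ ^ 2 := by nlinarith [norm_nonneg z]
  have hr : 0 < 1 - ‖z‖ := by linarith
  have hrt : 1 - ‖z‖ ≤ 1 - ‖z‖ ^ 2 := by nlinarith [norm_nonneg z]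
  have h1 := H φ hd hφ z hz
  have h2 := cos_mul_integral_mob_sub_rpow_le hz (s := s) (by rw [abs_of_pos hs0]; exact hs.le)
  have h3 : ∫ ω, ‖mob z ω - z‖ ^ s ∂circ ≤
      1 / Real.cos (s * Real.pi / 2) * (1 - ‖z‖ ^ 2) ^ s := by
    rw [one_div, inv_mul_eq_div, le_div_iff₀' hcos]; exact h2
  have h4 : 1 - ‖z‖ ^ 2 ≤ (1 - ‖z‖ ^ 2) ^ s := by
    conv_lhs => rw [← Real.rpow_one (1 - ‖z‖ ^ 2)]
    exact Real.rpow_le_rpow_of_exponent_ge ht (by nlinarith [norm_nonneg z]) hs.le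
  have hS : 0 ≤ K * √(G.u (φ 0)) := by positivity
  have h5 : (1 - ‖z‖ ^ 2) * ‖deriv φ z‖ ≤
      K * √(G.u (φ 0)) * ((1 + 1 / Real.cos (s * Real.pi / 2)) * (1 - ‖z‖ ^ 2) ^ s) := by
    refine h1.trans (mul_le_mul_of_nonneg_left ?_ hS)
    linarith
  have h6 : ‖deriv φ z‖ ≤ K * (1 + 1 / Real.cos (s * Real.pi / 2)) * √(G.u (φ 0)) *
      (1 - ‖z‖ ^ 2) ^ (s - 1) := by
    rw [Real.rpow_sub_one ht.ne', mul_div_assoc', le_div_iff₀ ht]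
    linarith
  refine h6.trans (mul_le_mul_of_nonneg_left ?_ (by positivity))
  exact Real.rpow_le_rpow_of_nonpos hr hrt (by linarith)

lemma HolderControl.one_of_one_lt {γ : ℝ} (h : G.HolderControl γ) (hγ : 0 < γ) (hγ1 : γ ≤ 1)
    (hs : 1 < γ * (1 + α)) : G.HolderControl 1 := by
  obtain ⟨K, hK, H⟩ := h.exists_step hγ hγ1
  have hα := G.hα
  have hα1 := G.hα1
  set s := γ * (1 + α) with hs'
  have hs2 : s ≤ 2 := by nlinarith
  have hcos : 0 < Real.cos ((2 - s) * Real.pi / 2) := by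
    apply Real.cos_pos_of_mem_Ioo
    constructor <;> nlinarith [Real.pi_pos]
  refine ⟨K * (1 + 1 / Real.cos ((2 - s) * Real.pi / 2)), by positivity, fun φ hd hφ z hz => ?_⟩
  have ht : 0 < 1 - ‖z‖ ^ 2 := by nlinarith [norm_nonneg z]
  have h1 := H φ hd hφ z hz
  have h2 := cos_mul_integral_mob_sub_rpow_le' hz (s := s)
    (by rw [abs_of_nonneg (by linarith)]; linarith)
  have h3 : ∫ ω, ‖mob z ω - z‖ ^ s ∂circ ≤
      1 / Real.cos ((2 - s) * Real.pi / 2) * (1 - ‖z‖ ^ 2) := by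
    rw [one_div, inv_mul_eq_div, le_div_iff₀' hcos]; exact h2
  have hS : 0 ≤ K * √(G.u (φ 0)) := by positivity
  have h5 : (1 - ‖z‖ ^ 2) * ‖deriv φ z‖ ≤ (1 - ‖z‖ ^ 2) *
      (K * (1 + 1 / Real.cos ((2 - s) * Real.pi / 2)) * √(G.u (φ 0))) := by
    refine h1.trans ((mul_le_mul_of_nonneg_left (add_le_add_right h3 _) hS).trans (le_of_eq ?_))
    ring
  simpa using le_of_mul_le_mul_left h5 ht

theorem holderControl_one : G.HolderControl 1 := by
  have hα := G.hα
  have hα1 := G.hα1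
  obtain ⟨θ, hθ⟩ : ∃ θ, θ = 1 / (1 + α / 2) := ⟨_, rfl⟩
  have hθ0 : 0 < θ := by rw [hθ]; positivity
  have hθ1 : θ < 1 := by rw [hθ, div_lt_one (by positivity)]; linarith
  have hθ2 : 1 < θ * (1 + α) := by
    rw [hθ, one_div_mul_eq_div, one_lt_div (by positivity)]; linarith
  have key : ∀ n : ℕ, G.HolderControl (min ((1 + α) ^ n / 2) θ) := by
    intro n
    induction n with
    | zero => exact holderControl_half.mono (by simp)
    | succ n ih =>
      have hp : 0 < (1 + α) ^ n / 2 := by positivity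
      have h1 : 0 < min (min ((1 + α) ^ n / 2) θ) (θ / (1 + α)) := by positivity
      have h2 := (ih.mono (min_le_left _ (θ / (1 + α)))).mul_one_add h1
        ((min_le_left _ _).trans ((min_le_right _ _).trans hθ1.le)) (by
          refine lt_of_le_of_lt (mul_le_mul_of_nonneg_right (min_le_right _ _) (by linarith)) ?_
          rwa [div_mul_cancel₀ _ (by linarith)])
      refine h2.mono ?_
      rw [min_mul_of_nonneg _ _ (by linarith), min_mul_of_nonneg _ _ (by linarith),
        div_mul_cancel₀ _ (by linarith)]
      refine le_min (le_min ?_ ?_) (min_le_right _ _)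
      · refine (min_le_left _ _).trans (le_of_eq ?_)
        rw [pow_succ]; ring
      · refine (min_le_right _ _).trans ?_
        nlinarith
  obtain ⟨n, hn⟩ := pow_unbounded_of_one_lt 2 (by linarith : 1 < 1 + α)
  have h := key n
  rw [min_eq_right (by linarith)] at h
  exact h.one_of_one_lt hθ0 hθ1.le hθ2

end Geom


lemma IsComplexGeodesic.frontier_nonempty {φ : ℂ → E N} (hφ : IsComplexGeodesic Ω φ)
    (hb : Bornology.IsBounded Ω) : (frontier Ω).Nonempty := by
  have h0 : (0:ℂ) ∈ ball (0:ℂ) 1 := mem_ball_self one_pos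
  have h1 : (1/2:ℂ) ∈ ball (0:ℂ) 1 := by simp; norm_num
  rcases subsingleton_or_nontrivial (E N) with h | h
  · exfalso
    have e0 := hφ.2.2 0 h0 0 h0
    have e1 := hφ.2.2 0 h0 (1/2) h1
    rw [Subsingleton.elim (φ (1/2)) (φ 0), e0, poincare_zero_left, poincare_zero_left] at e1
    have := artanh_strictMono (x := ‖(0:ℂ)‖) (y := ‖(1/2:ℂ)‖) (by simp) (by simp)
      (by simpa using h1)
    exact this.ne e1
  · rw [nonempty_iff_ne_empty]
    intro he
    have hc : IsClopen Ω := isClopen_iff_frontier_eq_empty.2 he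
    have hu : Ω = univ := hc.eq_univ ⟨_, hφ.2.1 h0⟩
    rw [hu] at hb
    exact NormedSpace.unbounded_univ ℝ (E N) hb

namespace Geom
variable (G : Geom α Ω)

lemma isCentred_of_bdist_le {φ : ℂ → E N} (hφ : IsComplexGeodesic Ω φ)
    (h : ∀ ζ ∈ ball (0:ℂ) 1, bdist Ω (φ ζ) ≤ bdist Ω (φ 0)) : G.IsCentred φ := by
  refine ⟨hφ, fun z hz => ?_⟩
  have hz' : z ∈ ball (0:ℂ) 1 := by simpa using hz
  have hM := G.M_pos
  calc G.u (φ z) ≤ G.M * bdist Ω (φ z) := G.le_bdist _ (hφ.2.1 hz')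
    _ ≤ G.M * (G.M * G.u (φ 0)) := by
      refine mul_le_mul_of_nonneg_left ?_ hM.le
      exact (h z hz').trans (G.bdist_le _ (hφ.2.1 (mem_ball_self one_pos)))
    _ = G.M ^ 2 * G.u (φ 0) := by ring

lemma IsCentred.congr {G : Geom α Ω} {φ f : ℂ → E N} (hφ : G.IsCentred φ)
    (h : EqOn f φ (ball 0 1)) : G.IsCentred f := by
  have h0 := h (mem_ball_self one_pos)
  refine ⟨⟨hφ.1.1.congr h, fun z hz => ?_, fun z hz w hw => ?_⟩, fun z hz => ?_⟩
  · rw [h hz]; exact hφ.1.2.1 hz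
  · rw [h hz, h hw]; exact hφ.1.2.2 z hz w hw
  · rw [h (by simpa using hz), h0]; exact hφ.2 z hz

/-- The depth of a centred geodesic is at most quadratic in its size. -/
lemma u_le_of_norm_sub_le {f : ℂ → E N} (hf : DiffContOnCl ℂ f (ball 0 1)) (hφ : G.IsCentred f)
    {d : ℝ} (h : ∀ z ∈ ball (0:ℂ) 1, ‖f z - f 0‖ ≤ d) : G.u (f 0) ≤ G.M * d ^ 2 := by
  have hm := mapsTo_closedBall hf hφ.1.2.1
  have hM := G.M_pos
  have hx0 : f 0 ∈ closure Ω := subset_closure (hφ.1.2.1 (mem_ball_self one_pos))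
  have hd : ∀ z ∈ closedBall (0:ℂ) 1, ‖f z - f 0‖ ≤ d := by
    intro z hz
    have hcl : z ∈ closure (ball (0:ℂ) 1) := by rwa [closure_ball _ one_ne_zero]
    refine ContinuousWithinAt.closure_le hcl (f := fun z => ‖f z - f 0‖) (g := fun _ => d)
      ?_ continuousWithinAt_const h
    exact (((hf.continuousOn_ball z hz).mono ball_subset_closedBall).sub
      continuousWithinAt_const).norm
  have hg : DiffContOnCl ℂ (fun z => ell G.ρ (f 0) (f z - f 0)) (ball 0 1) :=
    (ell G.ρ (f 0)).differentiable.comp_diffContOnCl (hf.sub_const (f 0))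
  have hgc := DiffContOnCl.continuousOn_sphere hg
  have h1 := congrArg Complex.re hg.integral_circ
  rw [← RCLike.re_eq_complex_re, ← integral_re (integrable_circ hgc)] at h1
  simp only [sub_self, map_zero, RCLike.re_eq_complex_re, re_ell] at h1
  have h2 := integral_circ_mono (f := fun _ => G.u (f 0) - G.M * d ^ 2)
    (g := fun ω => fderiv ℝ G.ρ (f 0) (f ω - f 0)) continuousOn_const
    (by
      have := Complex.continuous_re.comp_continuousOn hgc
      simpa only [Function.comp_def, re_ell] using this) (fun ω hω => ?_)
  · rw [integral_circ_const, h1] at h2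
    linarith
  · have hωc : ω ∈ closedBall (0:ℂ) 1 := by simp [hω]
    have h3 := G.taylor _ hx0 _ (hm hωc)
    have h4 := G.u_eq_zero_of_centred hf hφ hω
    rw [u, neg_eq_zero] at h4
    rw [h4] at h3
    have h5 : G.M * ‖f ω - f 0‖ ^ 2 ≤ G.M * d ^ 2 := by
      gcongr
      exact hd ω hωc
    have h6 := (abs_le.1 h3).2
    rw [u]
    linarith

/-- Boundary distance, diameter and maximal speed of a geodesic centred at its deepest point are
comparable. -/
theorem exists_comparison (G : Geom α Ω) : ∃ L : ℝ, 1 ≤ L ∧ ∀ φ : ℂ → E N, IsComplexGeodesic Ω φ →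
    (∀ ζ ∈ ball (0:ℂ) 1, bdist Ω (φ ζ) ≤ bdist Ω (φ 0)) →
      (Metric.diam (φ '' ball (0:ℂ) 1) ≤ L * √(bdist Ω (φ 0)) ∧
       √(bdist Ω (φ 0)) ≤ L * Metric.diam (φ '' ball (0:ℂ) 1) ∧
       sSup ((fun ζ : ℂ => ‖deriv φ ζ‖) '' ball (0:ℂ) 1) ≤
          L * Metric.diam (φ '' ball (0:ℂ) 1) ∧
       Metric.diam (φ '' ball (0:ℂ) 1) ≤
          L * sSup ((fun ζ : ℂ => ‖deriv φ ζ‖) '' ball (0:ℂ) 1)) := by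
  obtain ⟨C, hC, HC⟩ := G.exists_growth
  obtain ⟨B₀, hB₀, H₀⟩ := G.exists_deriv_le_rpow
  obtain ⟨B, hB, HB⟩ := G.holderControl_one
  have hM := G.hM
  have hL1 : 2 * C * G.M ≤ (2 * C + B + 2) * G.M := by nlinarith
  have hL2 : G.M ≤ (2 * C + B + 2) * G.M := by nlinarith
  have hL3 : B * G.M ≤ (2 * C + B + 2) * G.M := by nlinarith
  have hL4 : 2 ≤ (2 * C + B + 2) * G.M := by nlinarith
  obtain ⟨L, hL⟩ : ∃ L, L = (2 * C + B + 2) * G.M := ⟨_, rfl⟩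
  rw [← hL] at hL1 hL2 hL3 hL4
  refine ⟨L, by linarith, fun φ hφ hb => ?_⟩
  have h0 : (0:ℂ) ∈ ball (0:ℂ) 1 := mem_ball_self one_pos
  have hcen := G.isCentred_of_bdist_le hφ hb
  have hD := G.u_centre_pos hcen
  obtain ⟨f, hf, hfe⟩ := exists_diffContOnCl_extension hφ.1 (B := B₀ * √(G.u (φ 0)))
    (γ := 1/2) (by positivity) (by norm_num) (by norm_num) (H₀ φ hcen)
  have hfc : G.IsCentred f := hcen.congr hfe
  have hder : ∀ z ∈ ball (0:ℂ) 1, ‖deriv φ z‖ ≤ B * √(G.u (φ 0)) := by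
    intro z hz
    have e : deriv f z = deriv φ z := (hfe.eventuallyEq_of_mem (isOpen_ball.mem_nhds hz)).deriv_eq
    have := HB f hf hfc z (by simpa using hz)
    rw [e, hfe h0] at this
    simpa using this
  have hbd : Bornology.IsBounded (φ '' ball (0:ℂ) 1) :=
    G.bdd.subset (image_subset_iff.2 hφ.2.1)
  set d := Metric.diam (φ '' ball (0:ℂ) 1) with hd
  have hd0 : 0 ≤ d := Metric.diam_nonneg
  set b := bdist Ω (φ 0) with hbdef
  have hDb : G.u (φ 0) ≤ G.M * b := G.le_bdist _ (hφ.2.1 h0)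
  have hbD : b ≤ G.M * G.u (φ 0) := G.bdist_le _ (hφ.2.1 h0)
  have hb0 : 0 ≤ b := Metric.infDist_nonneg
  have hDd : G.u (φ 0) ≤ G.M * d ^ 2 := by
    have := G.u_le_of_norm_sub_le hf hfc (d := d) fun z hz => by
      rw [hfe hz, hfe h0, ← dist_eq_norm]
      exact dist_le_diam_of_mem hbd (mem_image_of_mem _ hz) (mem_image_of_mem _ h0)
    rwa [hfe h0] at this
  have r1 : √(G.u (φ 0)) ≤ G.M * √b := by
    refine Real.sqrt_le_iff.2 ⟨by positivity, ?_⟩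
    rw [mul_pow, Real.sq_sqrt hb0]
    nlinarith
  have r2 : √b ≤ G.M * d := by
    refine Real.sqrt_le_iff.2 ⟨by positivity, ?_⟩
    nlinarith
  have r3 : √(G.u (φ 0)) ≤ G.M * d := by
    refine Real.sqrt_le_iff.2 ⟨by positivity, ?_⟩
    nlinarith [sq_nonneg d]
  have hba : BddAbove ((fun ζ : ℂ => ‖deriv φ ζ‖) '' ball (0:ℂ) 1) := by
    refine ⟨B * √(G.u (φ 0)), ?_⟩
    rintro _ ⟨z, hz, rfl⟩
    exact hder z hz
  set s := sSup ((fun ζ : ℂ => ‖deriv φ ζ‖) '' ball (0:ℂ) 1) with hs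
  have hs0 : 0 ≤ s := (norm_nonneg _).trans (le_csSup hba (mem_image_of_mem _ h0))
  refine ⟨?_, ?_, ?_, ?_⟩
  · calc d ≤ 2 * C * √(G.u (φ 0)) := by
          refine Metric.diam_le_of_forall_dist_le (by positivity) ?_
          rintro _ ⟨z, hz, rfl⟩ _ ⟨w, hw, rfl⟩
          have e1 := (HC φ hcen z (by simpa using hz)).2.1
          have e2 := (HC φ hcen w (by simpa using hw)).2.1
          have e3 := dist_triangle_right (φ z) (φ w) (φ 0)
          rw [dist_eq_norm (φ z) (φ 0), dist_eq_norm (φ w) (φ 0)] at e3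
          linarith
      _ ≤ 2 * C * (G.M * √b) := by gcongr
      _ = 2 * C * G.M * √b := by ring
      _ ≤ L * √b := by gcongr
  · exact r2.trans (by gcongr)
  · refine csSup_le ((nonempty_ball.2 one_pos).image _) ?_
    rintro _ ⟨z, hz, rfl⟩
    calc ‖deriv φ z‖ ≤ B * √(G.u (φ 0)) := hder z hz
      _ ≤ B * (G.M * d) := by gcongr
      _ = B * G.M * d := by ring
      _ ≤ L * d := by gcongr
  · refine Metric.diam_le_of_forall_dist_le (by positivity) ?_
    rintro _ ⟨z, hz, rfl⟩ _ ⟨w, hw, rfl⟩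
    have e1 := (convex_ball (0:ℂ) 1).norm_image_sub_le_of_norm_deriv_le (𝕜 := ℂ) (f := φ) (C := s)
      (fun x hx => hφ.1.differentiableAt (isOpen_ball.mem_nhds hx))
      (fun x hx => le_csSup hba (mem_image_of_mem _ hx)) hw hz
    rw [dist_eq_norm]
    have e2 : ‖z - w‖ ≤ 2 := by
      have hz' : ‖z‖ < 1 := by simpa using hz
      have hw' : ‖w‖ < 1 := by simpa using hw
      linarith [norm_sub_le z w]
    calc _ ≤ s * ‖z - w‖ := e1
      _ ≤ s * 2 := by gcongr
      _ = 2 * s := mul_comm _ _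
      _ ≤ L * s := by gcongr

end Geom

end

/-- For complex geodesics parametrized so that the maximal boundary
distance is attained at the origin: `D_Ω(φ)^{1/2} ∼ d_e(φ(Δ)) ∼ sup ‖φ'‖`. -/
theorem stmt4 {N : ℕ} {α : ℝ} (hα : α ∈ Set.Ioc (0:ℝ) 1)
    (Ω : Set (E N)) (hΩ : IsStronglyPseudoconvexDomain 2 α Ω) :
    ∃ c C : ℝ, 0 < c ∧ c < C ∧ ∀ φ : ℂ → E N, IsComplexGeodesic Ω φ →
      (∀ ζ ∈ ball (0:ℂ) 1, bdist Ω (φ ζ) ≤ bdist Ω (φ 0)) →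
      (c * Metric.diam (φ '' ball (0:ℂ) 1) ≤ Real.sqrt (bdist Ω (φ 0)) ∧
       Real.sqrt (bdist Ω (φ 0)) ≤ C * Metric.diam (φ '' ball (0:ℂ) 1) ∧
       c * sSup ((fun ζ : ℂ => ‖deriv φ ζ‖) '' ball (0:ℂ) 1) ≤
          Metric.diam (φ '' ball (0:ℂ) 1) ∧
       Metric.diam (φ '' ball (0:ℂ) 1) ≤
          C * sSup ((fun ζ : ℂ => ‖deriv φ ζ‖) '' ball (0:ℂ) 1)) := by
  by_cases hfr : (frontier Ω).Nonempty
  · obtain ⟨G⟩ := exists_geom hα hΩ hfr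
    obtain ⟨L, hL, H⟩ := G.exists_comparison
    have hL0 : 0 < L + 1 := by linarith
    refine ⟨(L + 1)⁻¹, L + 1, by positivity,
      (inv_lt_one_of_one_lt₀ (by linarith)).trans (by linarith), fun φ hφ hb => ?_⟩
    obtain ⟨h1, h2, h3, h4⟩ := H φ hφ hb
    have hd : 0 ≤ Metric.diam (φ '' ball (0:ℂ) 1) := Metric.diam_nonneg
    have hs : 0 ≤ sSup ((fun ζ : ℂ => ‖deriv φ ζ‖) '' ball (0:ℂ) 1) :=
      Real.sSup_nonneg fun x hx => by
        obtain ⟨z, _, rfl⟩ := hx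
        exact norm_nonneg _
    refine ⟨?_, by linarith, ?_, by linarith⟩
    · rw [inv_mul_le_iff₀ hL0]
      linarith [Real.sqrt_nonneg (bdist Ω (φ 0))]
    · rw [inv_mul_le_iff₀ hL0]
      linarith
  · exact ⟨1, 2, one_pos, one_lt_two, fun φ hφ _ =>
      absurd (hφ.frontier_nonempty hΩ.2.2.1) hfr⟩

end InvDist
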